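/- Let d ≥ 4, 1 < p < p_d = (2d−2)/(d+1), and ε < (d−1)(1/p − 1/p_d). Then for every integer ℓ ≥ 0 and every measurable h : ℝ^d × [2^ℓ, ∞) → ℂ, ‖∫_{ℝ^d} ∫_{2^ℓ}^∞ h(y,r) F_{y,r} dr dy‖_{L^p(ℝ^d)} ≤ C 2^{−ℓε} 2^{ℓd/p} (∫_{2^ℓ}^∞ ∑_{W ∈ 𝒲^ℓ} sup_{y∈W} |h(y,r)|^p r^{d−1} dr)^{1/p}, where C depends only on d, p, ε and ψ. -/

import Mathlib

open MeasureTheory Metric Set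
open scoped FourierTransform ENNReal NNReal

noncomputable section

abbrev Ed (d : ℕ) := EuclideanSpace ℝ (Fin d)

/-- Surface measure on the sphere of radius `r` centered at the origin in `ℝ^d`:
the `(d-1)`-dimensional Hausdorff measure restricted to the sphere. -/
def sphereM (d : ℕ) (r : ℝ) : Measure (Ed d) :=
  (μH[(d : ℝ) - 1]).restrict (Metric.sphere (0 : Ed d) r)

/-- `ψ₀` is admissible: radial, `C^∞`, supported in the ball of radius `1/10`, and
its Fourier transform vanishes to order `20d` at the origin. -/
def Admissible (d : ℕ) (ψ₀ : Ed d → ℂ) : Prop :=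
  ContDiff ℝ (⊤ : ℕ∞) ψ₀ ∧
  (∀ x, ψ₀ x ≠ 0 → ‖x‖ ≤ 1 / 10) ∧
  (∀ x y : Ed d, ‖x‖ = ‖y‖ → ψ₀ x = ψ₀ y) ∧
  (∀ n : ℕ, n < 20 * d → iteratedFDeriv ℝ n (𝓕 ψ₀) 0 = 0)

/-- `ψ = ψ₀ * ψ₀` (convolution). -/
def psiOf (d : ℕ) (ψ₀ : Ed d → ℂ) : Ed d → ℂ :=
  fun x => ∫ y, ψ₀ y * ψ₀ (x - y)

/-- `F_{y,r} = σ_r * ψ(· - y)`. -/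
def Fyr (d : ℕ) (ψ₀ : Ed d → ℂ) (y : Ed d) (r : ℝ) : Ed d → ℂ :=
  fun x => ∫ z, psiOf d ψ₀ (x - y - z) ∂(sphereM d r)

/-- The dyadic cube of sidelength `2^ν` indexed by `z ∈ ℤ^d`. -/
def Wcube (d : ℕ) (ν : ℤ) (z : Fin d → ℤ) : Set (Ed d) :=
  {x | ∀ i, x i ∈ Set.Ico ((z i : ℝ) * 2 ^ ν) (((z i : ℝ) + 1) * 2 ^ ν)}

/-- The unit sphere has finite `(d-1)`-dimensional Hausdorff measure. -/
theorem hausdorff_sphere_lt_top (n : ℕ) :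
    (μH[(n : ℝ)] : Measure (Ed (n + 1))) (Metric.sphere 0 1) < ∞ := by
  classical
  let φ : Fin (n + 1) → ℝ → (Fin n → ℝ) → Ed (n + 1) :=
    fun i s y => WithLp.toLp 2 (Fin.insertNth (α := fun _ => ℝ) i s y)
  let Φ : Fin (n + 1) → ℝ → (Fin n → ℝ) → Ed (n + 1) := fun i s y => ‖φ i s y‖⁻¹ • φ i s y
  let Q : Set (Fin n → ℝ) := Set.Icc (fun _ => -1) (fun _ => 1)
  have hne : ∀ i (s : ℝ), s ≠ 0 → ∀ y, φ i s y ≠ 0 := by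
    intro i s hs y h
    apply hs
    have := congrArg (fun v : Ed (n + 1) => v i) h
    simpa [φ] using this
  have hsm : ∀ i (s : ℝ), ContDiff ℝ 1 (φ i s) := by
    intro i s
    rw [contDiff_piLp]
    intro j
    refine Fin.succAboveCases i ?_ (fun k => ?_) j
    · simp only [φ, Fin.insertNth_apply_same]; exact contDiff_const
    · simp only [φ, Fin.insertNth_apply_succAbove]; exact contDiff_apply ℝ ℝ k
  have hΦ : ∀ i (s : ℝ), s ≠ 0 → ContDiff ℝ 1 (Φ i s) := by
    intro i s hs
    have h1 : ContDiff ℝ 1 (fun y => ‖φ i s y‖) := (hsm i s).norm ℝ (hne i s hs)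
    exact (h1.inv (fun y => norm_ne_zero_iff.2 (hne i s hs y))).smul (hsm i s)
  have hfin : ∀ i (s : ℝ), s ≠ 0 → (μH[(n : ℝ)] : Measure (Ed (n + 1))) (Φ i s '' Q) < ∞ := by
    intro i s hs
    obtain ⟨K, hK⟩ := (hΦ i s hs).contDiffOn.exists_lipschitzOnWith (s := Q) one_ne_zero
      (convex_Icc _ _) isCompact_Icc
    refine (hK.hausdorffMeasure_image_le (Nat.cast_nonneg n)).trans_lt ?_
    have h2 : (μH[(n : ℝ)] : Measure (Fin n → ℝ)) Q < ∞ := by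
      have := @hausdorffMeasure_pi_real (Fin n) _
      rw [Fintype.card_fin] at this
      rw [this]
      exact isCompact_Icc.measure_lt_top
    exact ENNReal.mul_lt_top (ENNReal.rpow_lt_top_of_nonneg (Nat.cast_nonneg n) ENNReal.coe_ne_top) h2
  have hcov : Metric.sphere (0 : Ed (n + 1)) 1 ⊆
      ⋃ i : Fin (n + 1), (Φ i 1 '' Q ∪ Φ i (-1) '' Q) := by
    intro x hx
    have hx1 : ‖x‖ = 1 := by simpa using hx
    obtain ⟨i, hi⟩ := Finite.exists_max (fun i => |x i|)
    have hpos : 0 < |x i| := by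
      rcases (abs_nonneg (x i)).lt_or_eq with h | h
      · exact h
      · exfalso
        have : x = 0 := by
          ext j
          have := hi j
          rw [← h] at this
          simpa using this
        rw [this] at hx1; simp at hx1
    have key : ∀ s : ℝ, x i = s * |x i| → x ∈ Φ i s '' Q := by
      intro s hs
      refine ⟨fun k => x (i.succAbove k) / |x i|, ?_, ?_⟩
      · constructor
        · intro k
          have := hi (i.succAbove k)
          show -1 ≤ x (i.succAbove k) / |x i|
          rw [le_div_iff₀ hpos]
          have := (abs_le.1 this).1
          linarith
        · intro k
          have := hi (i.succAbove k)
          show x (i.succAbove k) / |x i| ≤ 1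
          rw [div_le_iff₀ hpos]
          have := (abs_le.1 this).2
          linarith
      · have hφ : φ i s (fun k => x (i.succAbove k) / |x i|) = |x i|⁻¹ • x := by
          ext j
          refine Fin.succAboveCases i ?_ (fun k => ?_) j
          · simp only [φ, Fin.insertNth_apply_same, PiLp.smul_apply, smul_eq_mul]
            field_simp
            exact hs.symm
          · simp only [φ, Fin.insertNth_apply_succAbove, PiLp.smul_apply, smul_eq_mul]
            field_simp
        show ‖φ i s _‖⁻¹ • φ i s _ = x
        rw [hφ, norm_smul, hx1, smul_smul]
        simp [hpos.ne']
    refine Set.mem_iUnion.2 ⟨i, ?_⟩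
    rcases abs_choice (x i) with h | h
    · left; exact key 1 (by rw [one_mul, h])
    · right; exact key (-1) (by rw [h]; ring)
  refine (measure_mono hcov).trans_lt ?_
  refine (measure_iUnion_le _).trans_lt ?_
  rw [tsum_fintype]
  refine ENNReal.sum_lt_top.2 (fun i _ => ?_)
  refine (measure_union_le _ _).trans_lt ?_
  exact ENNReal.add_lt_top.2 ⟨hfin i 1 one_ne_zero, hfin i (-1) (by norm_num)⟩

open scoped Pointwise in
theorem sphereM_eq_smul_map (d : ℕ) (hd : 1 ≤ d) (r : ℝ) (hr : 0 < r) :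
    sphereM d r = ENNReal.ofReal (r ^ (d - 1)) • (sphereM d 1).map (fun x => r • x) := by
  have hd' : (0 : ℝ) ≤ (d : ℝ) - 1 := by
    have : (1 : ℝ) ≤ d := by exact_mod_cast hd
    linarith
  have hm : Measurable (fun x : Ed d => r • x) := measurable_const_smul r
  ext s hs
  rw [Measure.smul_apply, Measure.map_apply hm hs, sphereM, sphereM, Measure.restrict_apply hs,
    Measure.restrict_apply (hm hs)]
  have : s ∩ sphere (0 : Ed d) r = r • ((fun x : Ed d => r • x) ⁻¹' s ∩ sphere (0 : Ed d) 1) := by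
    ext x
    constructor
    · rintro ⟨h1, h2⟩
      refine ⟨r⁻¹ • x, ⟨?_, ?_⟩, ?_⟩
      · simpa [smul_smul, hr.ne'] using h1
      · have h2 : ‖x‖ = r := by simpa using h2
        simp [norm_smul, h2, abs_of_pos hr, hr.ne']
      · simp [smul_smul, hr.ne']
    · rintro ⟨y, ⟨h1, h2⟩, rfl⟩
      refine ⟨h1, ?_⟩
      have h2 : ‖y‖ = 1 := by simpa using h2
      simp [norm_smul, h2, abs_of_pos hr]
  rw [this, Measure.hausdorffMeasure_smul₀ hd' hr.ne']
  rw [ENNReal.smul_def]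
  congr 1
  have h3 : ((d : ℝ) - 1) = ((d - 1 : ℕ) : ℝ) := by rw [Nat.cast_sub hd]; simp
  rw [h3, NNReal.rpow_natCast, ENNReal.ofReal, Real.toNNReal_pow hr.le]
  congr 2
  ext
  simp [abs_of_pos hr, hr.le]

theorem sphereM_finite_one (d : ℕ) (hd : 1 ≤ d) : IsFiniteMeasure (sphereM d 1) := by
  obtain ⟨n, rfl⟩ : ∃ n, d = n + 1 := ⟨d - 1, by omega⟩
  constructor
  rw [sphereM, Measure.restrict_apply_univ]
  have := hausdorff_sphere_lt_top n
  simpa using this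

theorem sphereM_map_isom (d : ℕ) (r : ℝ) (T : Ed d ≃ₗᵢ[ℝ] Ed d) :
    MeasurePreserving T (sphereM d r) (sphereM d r) := by
  have h := (T.toIsometryEquiv.measurePreserving_hausdorffMeasure ((d : ℝ) - 1)).restrict_preimage
    (s := sphere (0 : Ed d) r) isClosed_sphere.measurableSet
  have h2 : (T.toIsometryEquiv : Ed d → Ed d) ⁻¹' sphere 0 r = sphere 0 r := by
    ext x; simp
  rw [h2] at h
  exact h

theorem sphereM_ae (d : ℕ) (r : ℝ) : ∀ᵐ x ∂(sphereM d r), ‖x‖ = r := by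
  have := ae_restrict_mem (μ := (μH[(d : ℝ) - 1] : Measure (Ed d))) (isClosed_sphere (x := (0 : Ed d)) (ε := r)).measurableSet
  filter_upwards [this] with x hx
  simpa using hx

theorem exists_isom (d : ℕ) (v w : Ed d) (h : ‖v‖ = ‖w‖) : ∃ T : Ed d ≃ₗᵢ[ℝ] Ed d, T v = w :=
  ⟨_, Submodule.reflection_sub h⟩

theorem hasDerivAt_sphere_integral (d : ℕ) (hd : 1 ≤ d) (φ φ' : ℝ → ℝ)
    (hφ : ∀ t, HasDerivAt φ (φ' t) t) (hφ'c : Continuous φ') (b1 : ∀ t, |φ t| ≤ 1) (b2 : ∀ t, |φ' t| ≤ 1)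
    (c a b : Ed d → ℝ) (hc : Continuous c) (ha : Continuous a) (hb : Continuous b)
    (bc : ∀ x, ‖x‖ = 1 → |c x| ≤ 1) (bb : ∀ x, ‖x‖ = 1 → |b x| ≤ 1) (t : ℝ) :
    HasDerivAt (fun t => ∫ x, c x * φ (a x + t * b x) ∂(sphereM d 1))
      (∫ x, c x * b x * φ' (a x + t * b x) ∂(sphereM d 1)) t := by
  have := sphereM_finite_one d hd
  have hφc : Continuous φ := continuous_iff_continuousAt.2 (fun t => (hφ t).continuousAt)
  refine (hasDerivAt_integral_of_dominated_loc_of_deriv_le (bound := fun _ => 1)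
    (F := fun t x => c x * φ (a x + t * b x))
    (F' := fun t x => c x * b x * φ' (a x + t * b x)) (s := Set.univ) Filter.univ_mem ?_ ?_ ?_ ?_ ?_ ?_).2
  · exact Filter.Eventually.of_forall (fun t => by
      have : Continuous (fun x => c x * φ (a x + t * b x)) := by fun_prop
      exact this.aestronglyMeasurable)
  · have : Continuous (fun x => c x * φ (a x + t * b x)) := by fun_prop
    refine Integrable.of_bound this.aestronglyMeasurable 1 ?_
    filter_upwards [sphereM_ae d 1] with x hx
    rw [Real.norm_eq_abs, abs_mul]
    exact mul_le_one₀ (bc x hx) (abs_nonneg _) (b1 _)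
  · have : Continuous (fun x => c x * b x * φ' (a x + t * b x)) := by fun_prop
    exact this.aestronglyMeasurable
  · filter_upwards [sphereM_ae d 1] with x hx t _
    rw [Real.norm_eq_abs, abs_mul, abs_mul]
    exact mul_le_one₀ (mul_le_one₀ (bc x hx) (abs_nonneg _) (bb x hx)) (abs_nonneg _) (b2 _)
  · exact integrable_const _
  · filter_upwards with x t _
    have h1 : HasDerivAt (fun t => a x + t * b x) (b x) t := by
      simpa using ((hasDerivAt_id t).mul_const (b x)).const_add (a x)
    have h2 : HasDerivAt (fun t => c x * φ (a x + t * b x)) (c x * (φ' (a x + t * b x) * b x)) t :=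
      ((hφ (a x + t * b x)).comp t h1).const_mul (c x)
    exact h2.congr_deriv (by ring)

theorem abs_coord_le (d : ℕ) (x : Ed d) (i : Fin d) : |x i| ≤ ‖x‖ := by
  simpa using PiLp.norm_apply_le x i

/-- Radial profile of the Fourier transform of the surface measure of the unit sphere. -/
def sphB (d : ℕ) (i : Fin d) (s : ℝ) : ℝ := ∫ x, Real.cos (s * x i) ∂(sphereM d 1)
def sphB1 (d : ℕ) (i : Fin d) (s : ℝ) : ℝ := -∫ x, x i * Real.sin (s * x i) ∂(sphereM d 1)
def sphB2 (d : ℕ) (i : Fin d) (s : ℝ) : ℝ := -∫ x, x i * x i * Real.cos (s * x i) ∂(sphereM d 1)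

theorem sphB_deriv (d : ℕ) (i : Fin d) (s : ℝ) : HasDerivAt (sphB d i) (sphB1 d i s) s := by
  have hd : 1 ≤ d := by have := i.2; omega
  have := hasDerivAt_sphere_integral d hd Real.cos (fun t => - Real.sin t) Real.hasDerivAt_cos
    (by fun_prop) Real.abs_cos_le_one (fun t => by simpa using Real.abs_sin_le_one t)
    (fun _ => 1) (fun _ => 0) (fun x => x i) (by fun_prop) (by fun_prop) (by fun_prop)
    (fun x _ => by simp) (fun x hx => hx ▸ abs_coord_le d x i) s
  have e : (fun t => ∫ x : Ed d, 1 * Real.cos (0 + t * x i) ∂(sphereM d 1)) = sphB d i := by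
    funext s; simp [sphB]
  rw [e] at this
  exact this.congr_deriv (by simp [sphB1, integral_neg])

theorem sphB1_deriv (d : ℕ) (i : Fin d) (s : ℝ) : HasDerivAt (sphB1 d i) (sphB2 d i s) s := by
  have hd : 1 ≤ d := by have := i.2; omega
  have := (hasDerivAt_sphere_integral d hd Real.sin Real.cos Real.hasDerivAt_sin
    (by fun_prop) Real.abs_sin_le_one Real.abs_cos_le_one
    (fun x => x i) (fun _ => 0) (fun x => x i) (by fun_prop) (by fun_prop) (by fun_prop)
    (fun x hx => hx ▸ abs_coord_le d x i) (fun x hx => hx ▸ abs_coord_le d x i) s).fun_neg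
  have e : (fun t => - ∫ x : Ed d, x i * Real.sin (0 + t * x i) ∂(sphereM d 1)) = sphB1 d i := by
    funext s; simp [sphB1]
  rw [e] at this
  exact this.congr_deriv (by simp [sphB2])

theorem sphB_norm (d : ℕ) (i : Fin d) (ξ : Ed d) :
    ∫ x, Real.cos (inner ℝ x ξ) ∂(sphereM d 1) = sphB d i ‖ξ‖ := by
  obtain ⟨T, hT⟩ := exists_isom d (EuclideanSpace.single i ‖ξ‖) ξ (by simp)
  rw [sphB, ← (sphereM_map_isom d 1 T).integral_comp T.toHomeomorph.measurableEmbedding]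
  refine integral_congr_ae (Filter.Eventually.of_forall fun x => ?_)
  show Real.cos (inner ℝ (T x) ξ) = _
  conv_lhs => rw [← hT, T.inner_map_map]
  simp [EuclideanSpace.inner_single_right]

theorem sphB_ode_aux (d : ℕ) (i j : Fin d) (hij : i ≠ j) (s : ℝ) (hs : 0 < s) :
    ∫ x, x j * x j * Real.cos (s * x i) ∂(sphereM d 1) = - sphB1 d i s / s := by
  have hd : 1 ≤ d := by have := i.2; omega
  have hE : ∀ t : ℝ, ∫ x, 1 * Real.cos (s * x i + t * x j) ∂(sphereM d 1) = sphB d i (√(s ^ 2 + t ^ 2)) := by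
    intro t
    have := sphB_norm d i (EuclideanSpace.single i s + EuclideanSpace.single j t)
    have hn : ‖(EuclideanSpace.single i s + EuclideanSpace.single j t : Ed d)‖ = √(s ^ 2 + t ^ 2) := by
      have h0 : inner ℝ (EuclideanSpace.single i s : Ed d) (EuclideanSpace.single j t) = 0 := by
        simp [EuclideanSpace.inner_single_left, hij]
      have h1 := norm_add_sq_eq_norm_sq_add_norm_sq_of_inner_eq_zero _ _ h0
      rw [← Real.sqrt_sq (norm_nonneg _), sq, h1]
      simp [sq]
    rw [hn] at this
    rw [← this]
    refine integral_congr_ae (Filter.Eventually.of_forall fun x => ?_)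
    simp [inner_add_right, EuclideanSpace.inner_single_right]
  have hD := fun t => hasDerivAt_sphere_integral d hd Real.cos (fun t => - Real.sin t) Real.hasDerivAt_cos
    (by fun_prop) Real.abs_cos_le_one (fun t => by simpa using Real.abs_sin_le_one t)
    (fun _ => 1) (fun x => s * x i) (fun x => x j) (by fun_prop) (by fun_prop) (by fun_prop)
    (fun x _ => by simp) (fun x hx => hx ▸ abs_coord_le d x j) t
  simp only [hE] at hD
  have hq : ∀ t : ℝ, 0 < √(s ^ 2 + t ^ 2) := fun t => Real.sqrt_pos.2 (by positivity)
  have hD' : ∀ t : ℝ, HasDerivAt (fun t => sphB d i (√(s ^ 2 + t ^ 2)))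
      (t * (sphB1 d i (√(s ^ 2 + t ^ 2)) / √(s ^ 2 + t ^ 2))) t := by
    intro t
    have h1 : HasDerivAt (fun t : ℝ => s ^ 2 + t ^ 2) (2 * t) t := by
      simpa using (hasDerivAt_pow 2 t).const_add (s ^ 2)
    have h2 := h1.sqrt (by positivity)
    have h3' := (sphB_deriv d i (√(s ^ 2 + t ^ 2))).comp t h2
    have h3 : HasDerivAt (fun t => sphB d i (√(s ^ 2 + t ^ 2))) _ t := h3'
    refine h3.congr_deriv ?_
    field_simp
  have hEq : ∀ t : ℝ, ∫ x, x j * Real.sin (s * x i + t * x j) ∂(sphereM d 1)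
      = - (t * (sphB1 d i (√(s ^ 2 + t ^ 2)) / √(s ^ 2 + t ^ 2))) := by
    intro t
    rw [← (hD t).unique (hD' t), ← integral_neg]
    congr 1; funext x; ring
  have hD2 := hasDerivAt_sphere_integral d hd Real.sin Real.cos Real.hasDerivAt_sin
    (by fun_prop) Real.abs_sin_le_one Real.abs_cos_le_one
    (fun x => x j) (fun x => s * x i) (fun x => x j) (by fun_prop) (by fun_prop) (by fun_prop)
    (fun x hx => hx ▸ abs_coord_le d x j) (fun x hx => hx ▸ abs_coord_le d x j) 0
  simp only [hEq] at hD2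
  have hcont : ContinuousAt (fun t : ℝ => - (sphB1 d i (√(s ^ 2 + t ^ 2)) / √(s ^ 2 + t ^ 2))) 0 := by
    have c1 : Continuous (sphB1 d i) := continuous_iff_continuousAt.2 (fun t => (sphB1_deriv d i t).continuousAt)
    have c2 : Continuous (fun t : ℝ => √(s ^ 2 + t ^ 2)) := by fun_prop
    exact (((c1.comp c2).div c2 (fun t => (hq t).ne')).neg).continuousAt
  have hD3 : HasDerivAt (fun t : ℝ => - (t * (sphB1 d i (√(s ^ 2 + t ^ 2)) / √(s ^ 2 + t ^ 2))))
      (- (sphB1 d i (√(s ^ 2 + 0 ^ 2)) / √(s ^ 2 + 0 ^ 2))) 0 := by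
    rw [hasDerivAt_iff_tendsto_slope]
    have h4 := hcont.tendsto.mono_left (nhdsWithin_le_nhds (s := {0}ᶜ))
    refine h4.congr' ?_
    filter_upwards [self_mem_nhdsWithin] with t ht
    have ht : t ≠ 0 := ht
    rw [slope_def_field]
    field_simp
    ring
  have := hD2.unique hD3
  have e : √(s ^ 2 + 0 ^ 2) = s := by simp [Real.sqrt_sq hs.le]
  rw [e] at this
  simp only [zero_mul, add_zero] at this
  rw [this]; ring

theorem sphB_ode (d : ℕ) (i : Fin d) (s : ℝ) (hs : 0 < s) :
    s * (sphB d i s + sphB2 d i s) = - ((d : ℝ) - 1) * sphB1 d i s := by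
  classical
  have hd : 1 ≤ d := by have := i.2; omega
  have := sphereM_finite_one d hd
  have hIntg : ∀ j : Fin d, Integrable (fun x : Ed d => x j * x j * Real.cos (s * x i)) (sphereM d 1) := by
    intro j
    have : Continuous (fun x : Ed d => x j * x j * Real.cos (s * x i)) := by fun_prop
    refine Integrable.of_bound this.aestronglyMeasurable 1 ?_
    filter_upwards [sphereM_ae d 1] with x hx
    have h1 := abs_coord_le d x j
    rw [hx] at h1
    rw [Real.norm_eq_abs, abs_mul, abs_mul]
    exact mul_le_one₀ (mul_le_one₀ h1 (abs_nonneg _) h1) (abs_nonneg _) (Real.abs_cos_le_one _)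
  have h1 : sphB d i s = ∑ j : Fin d, ∫ x, x j * x j * Real.cos (s * x i) ∂(sphereM d 1) := by
    rw [← integral_finsetSum _ (fun j _ => hIntg j), sphB]
    refine integral_congr_ae ?_
    filter_upwards [sphereM_ae d 1] with x hx
    rw [← Finset.sum_mul]
    have : ∑ j, x j * x j = 1 := by
      have := EuclideanSpace.norm_sq_eq x
      rw [hx] at this
      simp only [Real.norm_eq_abs, sq_abs] at this
      rw [one_pow] at this
      rw [this]
      exact Finset.sum_congr rfl (fun j _ => by ring)
    rw [this, one_mul]
  rw [h1, ← Finset.add_sum_erase _ _ (Finset.mem_univ i)]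
  have h2 : ∑ j ∈ Finset.univ.erase i, ∫ x, x j * x j * Real.cos (s * x i) ∂(sphereM d 1)
      = ∑ j ∈ Finset.univ.erase i, (- sphB1 d i s / s) := by
    refine Finset.sum_congr rfl (fun j hj => ?_)
    exact sphB_ode_aux d i j (Finset.ne_of_mem_erase hj).symm s hs
  rw [h2, Finset.sum_const, Finset.card_erase_of_mem (Finset.mem_univ i), Finset.card_univ,
    Fintype.card_fin, nsmul_eq_mul, Nat.cast_sub hd, sphB2]
  field_simp
  push_cast
  ring

/-- Decay of the profile by the energy method for the Bessel equation. -/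
theorem sphB_decay (d : ℕ) (i : Fin d) :
    ∃ C : ℝ, 0 < C ∧ ∀ s : ℝ, 0 < s → |sphB d i s| ≤ C * s ^ (-(((d : ℝ) - 1) / 2)) := by
  have hd : 1 ≤ d := by have := i.2; omega
  have hd1 : (1 : ℝ) ≤ d := by exact_mod_cast hd
  have := sphereM_finite_one d hd
  set κ : ℝ := ((d : ℝ) - 1) / 2 with hκ
  have hκ0 : 0 ≤ κ := by rw [hκ]; linarith
  set B := sphB d i with hB
  set v : ℝ → ℝ := fun s => sphB1 d i s + κ * B s / s with hv
  set E : ℝ → ℝ := fun s => (s ^ κ * B s) ^ 2 + (s ^ κ * v s) ^ 2 with hE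
  set c : ℝ := |κ ^ 2 - κ| with hc
  have hE' : ∀ s : ℝ, 0 < s → HasDerivAt E (2 * (s ^ κ * B s) * (s ^ κ * v s) * ((κ ^ 2 - κ) / s ^ 2)) s := by
    intro s hs
    have hp : HasDerivAt (fun s : ℝ => s ^ κ) (κ * s ^ κ / s) s := by
      have := Real.hasDerivAt_rpow_const (x := s) (p := κ) (Or.inl hs.ne')
      rw [Real.rpow_sub_one hs.ne'] at this
      exact this.congr_deriv (by ring)
    have hb := sphB_deriv d i s
    have hb1 := sphB1_deriv d i s
    have hv' : HasDerivAt v (sphB2 d i s + (κ * sphB1 d i s * s - κ * B s) / s ^ 2) s := by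
      have h3 := ((hb.const_mul κ).fun_div (hasDerivAt_id s) hs.ne')
      have h4 : HasDerivAt v _ s := hb1.add h3
      refine h4.congr_deriv ?_
      simp [hB]
    have h5 : HasDerivAt E _ s := ((hp.mul hb).pow 2).add ((hp.mul hv').pow 2)
    refine h5.congr_deriv ?_
    have ode : sphB2 d i s = - B s - 2 * κ * sphB1 d i s / s := by
      have := sphB_ode d i s hs
      rw [eq_sub_iff_add_eq, ← sub_eq_zero]
      have e : s * (sphB2 d i s + 2 * κ * sphB1 d i s / s - -B s) = 0 := by
        field_simp
        rw [hκ]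
        linarith
      exact (mul_eq_zero.1 e).resolve_left hs.ne'
    simp only [Pi.mul_apply, hv, ode, ← hB]
    generalize s ^ κ = P
    norm_num
    field_simp
    ring
  set G : ℝ → ℝ := fun s => E s * Real.exp (c / s) with hG
  have hG' : ∀ s : ℝ, 0 < s → HasDerivAt G
      (2 * (s ^ κ * B s) * (s ^ κ * v s) * ((κ ^ 2 - κ) / s ^ 2) * Real.exp (c / s) +
        E s * (Real.exp (c / s) * (-c / s ^ 2))) s := by
    intro s hs
    have h1 : HasDerivAt (fun s : ℝ => c / s) (-c / s ^ 2) s := by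
      have h2 : HasDerivAt (fun s : ℝ => c / s) _ s := (hasDerivAt_const s c).fun_div (hasDerivAt_id s) hs.ne'
      exact h2.congr_deriv (by simp)
    exact (hE' s hs).mul h1.exp
  have hanti : AntitoneOn G (Set.Ici 1) := by
    refine antitoneOn_of_deriv_nonpos (convex_Ici 1) ?_ ?_ ?_
    · intro s hs
      exact (hG' s (lt_of_lt_of_le one_pos hs)).continuousAt.continuousWithinAt
    · intro s hs
      rw [interior_Ici] at hs
      exact (hG' s (lt_trans one_pos hs)).differentiableAt.differentiableWithinAt
    · intro s hs
      rw [interior_Ici] at hs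
      have hs0 : 0 < s := lt_trans one_pos hs
      rw [(hG' s hs0).deriv]
      have h1 : 2 * (s ^ κ * B s) * (s ^ κ * v s) * (κ ^ 2 - κ) ≤ E s * c := by
        have h2 : |2 * (s ^ κ * B s) * (s ^ κ * v s)| ≤ E s := by
          rw [abs_le]
          constructor <;> simp only [hE] <;> nlinarith [sq_nonneg (s ^ κ * B s - s ^ κ * v s), sq_nonneg (s ^ κ * B s + s ^ κ * v s)]
        calc _ ≤ |2 * (s ^ κ * B s) * (s ^ κ * v s) * (κ ^ 2 - κ)| := le_abs_self _
          _ = |2 * (s ^ κ * B s) * (s ^ κ * v s)| * c := abs_mul _ _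
          _ ≤ _ := mul_le_mul_of_nonneg_right h2 (abs_nonneg _)
      have h3 : 2 * (s ^ κ * B s) * (s ^ κ * v s) * ((κ ^ 2 - κ) / s ^ 2) * Real.exp (c / s) +
        E s * (Real.exp (c / s) * (-c / s ^ 2)) =
        (2 * (s ^ κ * B s) * (s ^ κ * v s) * (κ ^ 2 - κ) - E s * c) * (Real.exp (c / s) / s ^ 2) := by
        field_simp
        ring
      rw [h3]
      exact mul_nonpos_of_nonpos_of_nonneg (by linarith) (by positivity)
  set C1 : ℝ := √(G 1) with hC1
  set C2 : ℝ := (sphereM d 1).real Set.univ with hC2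
  have hC20 : 0 ≤ C2 := measureReal_nonneg
  refine ⟨C1 + C2 + 1, by positivity, fun s hs => ?_⟩
  have hsp : 0 < s ^ (-κ) := Real.rpow_pos_of_pos hs _
  rcases le_total 1 s with h1 | h1
  · have hEs : E s ≤ G 1 := by
      have := hanti (Set.mem_Ici.2 le_rfl) (Set.mem_Ici.2 h1) h1
      refine le_trans ?_ this
      have h6 : 1 ≤ Real.exp (c / s) := Real.one_le_exp (by positivity)
      have h7 : 0 ≤ E s := by positivity
      exact le_mul_of_one_le_right h7 h6
    have h8 : (s ^ κ * B s) ^ 2 ≤ G 1 := le_trans (by simp only [hE]; nlinarith [sq_nonneg (s ^ κ * v s)]) hEs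
    have h9 := Real.abs_le_sqrt h8
    rw [abs_mul, abs_of_pos (Real.rpow_pos_of_pos hs κ)] at h9
    calc |B s| = s ^ (-κ) * (s ^ κ * |B s|) := by
          rw [← mul_assoc, ← Real.rpow_add hs]; simp
      _ ≤ s ^ (-κ) * C1 := by gcongr
      _ ≤ (C1 + C2 + 1) * s ^ (-κ) := by nlinarith
  · have h2 : |B s| ≤ C2 := by
      have := norm_integral_le_of_norm_le_const (μ := sphereM d 1) (f := fun x : Ed d => Real.cos (s * x i)) (C := 1)
        (Filter.Eventually.of_forall (fun x => Real.abs_cos_le_one _))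
      rw [one_mul] at this
      exact this
    have h3 : 1 ≤ s ^ (-κ) := Real.one_le_rpow_of_pos_of_le_one_of_nonpos hs h1 (by linarith)
    have : 0 ≤ C1 := Real.sqrt_nonneg _
    nlinarith

section PartB1

open scoped Convolution

/-- Fourier transform of the surface measure of the sphere of radius `r`. -/
def chi (d : ℕ) (r : ℝ) (ξ : Ed d) : ℝ :=
  r ^ (d - 1) * ∫ x, Real.cos (inner ℝ x ((2 * Real.pi * r) • ξ)) ∂(sphereM d 1)

theorem chi_eq (d : ℕ) (hd : 1 ≤ d) (r : ℝ) (hr : 0 < r) (ξ : Ed d) :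
    ∫ z, (Real.fourierChar (-inner ℝ z ξ) : ℂ) ∂(sphereM d r) = (chi d r ξ : ℂ) := by
  have := sphereM_finite_one d hd
  rw [sphereM_eq_smul_map d hd r hr, integral_smul_measure, ENNReal.toReal_ofReal (by positivity),
    integral_map (by fun_prop) (by fun_prop)]
  rw [chi, Complex.ofReal_mul, Complex.real_smul]
  congr 1
  have h1 : ∀ z : Ed d, (Real.fourierChar (-inner ℝ (r • z) ξ) : ℂ) =
      ((Real.cos (inner ℝ z ((2 * Real.pi * r) • ξ)) : ℝ) : ℂ) -
       ((Real.sin (inner ℝ z ((2 * Real.pi * r) • ξ)) : ℝ) : ℂ) * Complex.I := by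
    intro z
    have e : (((2 * Real.pi * -inner ℝ (r • z) ξ : ℝ) : ℂ) * Complex.I) =
        ((-(inner ℝ z ((2 * Real.pi * r) • ξ)) : ℝ) : ℂ) * Complex.I := by
      congr 2
      rw [inner_smul_left, inner_smul_right]
      simp
      ring
    rw [Real.fourierChar_apply, e, Complex.exp_mul_I, ← Complex.ofReal_cos, ← Complex.ofReal_sin,
      Real.cos_neg, Real.sin_neg]
    push_cast
    ring
  have hI : ∀ g : ℝ → ℝ, Continuous g → (∀ t, |g t| ≤ 1) → Integrable (fun z : Ed d => g (inner ℝ z ((2 * Real.pi * r) • ξ))) (sphereM d 1) := by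
    intro g hg hb
    refine Integrable.of_bound (Continuous.aestronglyMeasurable (by fun_prop)) 1 ?_
    exact Filter.Eventually.of_forall fun x => hb _
  simp_rw [h1]
  rw [integral_sub (hI _ Real.continuous_cos Real.abs_cos_le_one).ofReal
    ((hI _ Real.continuous_sin Real.abs_sin_le_one).ofReal.mul_const _), integral_mul_const,
    integral_complex_ofReal, integral_complex_ofReal]
  have h2 : ∫ x, Real.sin (inner ℝ x ((2 * Real.pi * r) • ξ)) ∂(sphereM d 1) = 0 := by
    have h3 := (sphereM_map_isom d 1 (LinearIsometryEquiv.neg ℝ)).integral_comp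
      (LinearIsometryEquiv.neg ℝ).toHomeomorph.measurableEmbedding
      (fun x : Ed d => Real.sin (inner ℝ x ((2 * Real.pi * r) • ξ)))
    simp only [LinearIsometryEquiv.coe_neg, inner_neg_left, Real.sin_neg, integral_neg] at h3
    linarith
  rw [h2]; simp

theorem chi_sphB (d : ℕ) (i : Fin d) (r : ℝ) (ξ : Ed d) :
    chi d r ξ = r ^ (d - 1) * sphB d i ‖(2 * Real.pi * r) • ξ‖ := by
  rw [chi, sphB_norm d i]

theorem chi_continuous (d : ℕ) (hd : 1 ≤ d) (r : ℝ) : Continuous (chi d r) := by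
  have c1 : Continuous (sphB d ⟨0, hd⟩) :=
    continuous_iff_continuousAt.2 (fun t => (sphB_deriv d _ t).continuousAt)
  have : chi d r = fun ξ => r ^ (d - 1) * sphB d ⟨0, hd⟩ ‖(2 * Real.pi * r) • ξ‖ :=
    funext fun ξ => chi_sphB d ⟨0, hd⟩ r ξ
  rw [this]
  exact continuous_const.mul (c1.comp (by fun_prop))

theorem chi_radial (d : ℕ) (hd : 1 ≤ d) (r : ℝ) (ξ η : Ed d) (h : ‖ξ‖ = ‖η‖) : chi d r ξ = chi d r η := by
  rw [chi_sphB d ⟨0, hd⟩, chi_sphB d ⟨0, hd⟩, norm_smul, norm_smul, h]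

theorem chi_decay (d : ℕ) (hd : 1 ≤ d) : ∃ C : ℝ, 0 < C ∧ ∀ r : ℝ, 0 < r → ∀ ξ : Ed d, ξ ≠ 0 →
    |chi d r ξ| ≤ C * r ^ (((d : ℝ) - 1) / 2) * ‖ξ‖ ^ (-(((d : ℝ) - 1) / 2)) := by
  obtain ⟨C, hC, h⟩ := sphB_decay d ⟨0, hd⟩
  refine ⟨C * (2 * Real.pi) ^ (-(((d : ℝ) - 1) / 2)), by positivity, fun r hr ξ hξ => ?_⟩
  have hξ' : 0 < ‖ξ‖ := norm_pos_iff.2 hξ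
  have hpi := Real.pi_pos
  rw [chi_sphB d ⟨0, hd⟩, norm_smul, abs_mul, abs_of_pos (by positivity : 0 < r ^ (d - 1)), Real.norm_of_nonneg (by positivity)]
  have h1 := h (2 * Real.pi * r * ‖ξ‖) (by positivity)
  have h2 : r ^ (d - 1) = r ^ (((d : ℝ) - 1) / 2) * r ^ (((d : ℝ) - 1) / 2) := by
    rw [← Real.rpow_add hr, ← Real.rpow_natCast, Nat.cast_sub hd]
    congr 1; push_cast; ring
  have h3 : r ^ (((d : ℝ) - 1) / 2) * r ^ (-(((d : ℝ) - 1) / 2)) = 1 := by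
    rw [← Real.rpow_add hr]; simp
  calc _ ≤ r ^ (d - 1) * (C * (2 * Real.pi * r * ‖ξ‖) ^ (-(((d : ℝ) - 1) / 2))) := by gcongr
    _ = r ^ (((d : ℝ) - 1) / 2) * (r ^ (((d : ℝ) - 1) / 2) * r ^ (-(((d : ℝ) - 1) / 2))) *
        (C * ((2 * Real.pi) ^ (-(((d : ℝ) - 1) / 2)) * ‖ξ‖ ^ (-(((d : ℝ) - 1) / 2)))) := by
      rw [h2, Real.mul_rpow (by positivity) (by positivity), Real.mul_rpow (by positivity) (by positivity)]
      ring
    _ = _ := by rw [h3]; ring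

/-- Taylor estimate: a function flat at the origin. -/
theorem flat_bound (d N : ℕ) (g : SchwartzMap (Ed d) ℂ)
    (hg : ∀ n < N, iteratedFDeriv ℝ n (g : Ed d → ℂ) 0 = 0) :
    ∃ C : ℝ, 0 < C ∧ ∀ x, ‖g x‖ ≤ C * ‖x‖ ^ N := by
  have key : ∀ k ≤ N, ∃ C : ℝ, 0 < C ∧ ∀ x, ‖iteratedFDeriv ℝ (N - k) (g : Ed d → ℂ) x‖ ≤ C * ‖x‖ ^ k := by
    intro k
    induction k with
    | zero =>
      intro _
      obtain ⟨C, hC, h⟩ := g.decay 0 N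
      exact ⟨C, hC, fun x => by simpa using h x⟩
    | succ k ih =>
      intro hk
      obtain ⟨C, hC, h⟩ := ih (by omega)
      refine ⟨C, hC, fun x => ?_⟩
      have e : N - k = (N - (k + 1)) + 1 := by omega
      have hs := Convex.norm_image_sub_le_of_norm_fderiv_le (𝕜 := ℝ)
        (f := iteratedFDeriv ℝ (N - (k + 1)) (g : Ed d → ℂ)) (C := C * ‖x‖ ^ k)
        (s := Metric.closedBall 0 ‖x‖) (x := 0) (y := x)
        (fun y _ => ((g.smooth ⊤).differentiable_iteratedFDeriv (WithTop.coe_lt_coe.2 (ENat.natCast_lt_top _))) y)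
        (fun y hy => by
          rw [norm_fderiv_iteratedFDeriv, ← e]
          refine (h y).trans ?_
          have : ‖y‖ ≤ ‖x‖ := by simpa using hy
          gcongr) (convex_closedBall _ _) (by simp) (by simp)
      rw [hg _ (by omega), sub_zero, sub_zero] at hs
      rw [pow_succ]; linarith
  obtain ⟨C, hC, h⟩ := key N le_rfl
  exact ⟨C, hC, fun x => by have := h x; rw [Nat.sub_self, norm_iteratedFDeriv_zero] at this; exact this⟩

end PartB1

section PartB2

open scoped Convolution

theorem adm_compact (d : ℕ) (ψ₀ : Ed d → ℂ) (hψ : Admissible d ψ₀) : HasCompactSupport ψ₀ :=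
  HasCompactSupport.intro (isCompact_closedBall (0 : Ed d) (1 / 10)) (fun x hx => by
    by_contra h
    exact hx (by simpa using hψ.2.1 x h))

theorem adm_integrable (d : ℕ) (ψ₀ : Ed d → ℂ) (hψ : Admissible d ψ₀) : Integrable ψ₀ :=
  hψ.1.continuous.integrable_of_hasCompactSupport (adm_compact d ψ₀ hψ)

theorem phat_schwartz (d : ℕ) (ψ₀ : Ed d → ℂ) (hψ : Admissible d ψ₀) :
    ∃ g : SchwartzMap (Ed d) ℂ, (g : Ed d → ℂ) = 𝓕 ψ₀ := by
  refine ⟨𝓕 ((adm_compact d ψ₀ hψ).toSchwartzMap hψ.1), ?_⟩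
  rw [SchwartzMap.fourier_coe]
  rfl

theorem phat_bound (d : ℕ) (hd : 1 ≤ d) (ψ₀ : Ed d → ℂ) (hψ : Admissible d ψ₀) :
    ∃ C : ℝ, 0 < C ∧ ∀ ξ, ‖𝓕 ψ₀ ξ‖ ≤ C * ‖ξ‖ ^ (((d : ℝ) - 1) / 2) := by
  obtain ⟨g, hg⟩ := phat_schwartz d ψ₀ hψ
  obtain ⟨C1, hC1, h1⟩ := flat_bound d d g (fun n hn => by rw [hg]; exact hψ.2.2.2 n (by omega))
  obtain ⟨C2, hC2, h2⟩ := g.decay 0 0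
  have hd1 : (1 : ℝ) ≤ d := by exact_mod_cast hd
  refine ⟨C1 + C2, by positivity, fun ξ => ?_⟩
  rw [← hg]
  rcases le_total ‖ξ‖ 1 with h | h
  · calc ‖g ξ‖ ≤ C1 * ‖ξ‖ ^ d := h1 ξ
      _ ≤ C1 * ‖ξ‖ ^ (((d : ℝ) - 1) / 2) := by
        gcongr
        rw [← Real.rpow_natCast]
        rcases (norm_nonneg ξ).eq_or_lt with h0 | h0
        · rw [← h0, Real.zero_rpow (by positivity)]
          positivity
        · exact Real.rpow_le_rpow_of_exponent_ge h0 h (by linarith)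
      _ ≤ _ := by gcongr; linarith
  · have h3 := h2 ξ
    simp only [pow_zero, one_mul, norm_iteratedFDeriv_zero] at h3
    calc ‖g ξ‖ ≤ C2 * 1 := by linarith
      _ ≤ C2 * ‖ξ‖ ^ (((d : ℝ) - 1) / 2) := by
        gcongr
        exact Real.one_le_rpow h (by linarith)
      _ ≤ _ := by gcongr; linarith

theorem phat_radial (d : ℕ) (ψ₀ : Ed d → ℂ) (hψ : Admissible d ψ₀) (ξ η : Ed d) (h : ‖ξ‖ = ‖η‖) :
    𝓕 ψ₀ ξ = 𝓕 ψ₀ η := by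
  obtain ⟨T, hT⟩ := exists_isom d ξ η h
  rw [← hT, ← Real.fourier_comp_linearIsometry]
  have e : ψ₀ ∘ T = ψ₀ := by
    funext x
    exact hψ.2.2.1 _ _ (by simp)
  rw [e]

theorem psi_conv (d : ℕ) (ψ₀ : Ed d → ℂ) :
    psiOf d ψ₀ = ψ₀ ⋆[ContinuousLinearMap.mul ℂ ℂ, volume] ψ₀ := by
  funext x
  rw [convolution_mul]; rfl

theorem contDiff_conv (d : ℕ) (μ : Measure (Ed d)) (f g : Ed d → ℂ) (hf : LocallyIntegrable f μ)
    (hg : ContDiff ℝ (⊤ : ℕ∞) g) (hc : HasCompactSupport g) :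
    ContDiff ℝ (⊤ : ℕ∞) (f ⋆[ContinuousLinearMap.mul ℂ ℂ, μ] g) := by
  have : (f ⋆[ContinuousLinearMap.mul ℂ ℂ, μ] g) = f ⋆[ContinuousLinearMap.mul ℝ ℂ, μ] g := rfl
  rw [this]
  exact hc.contDiff_convolution_right _ hf hg

theorem psi_contDiff (d : ℕ) (ψ₀ : Ed d → ℂ) (hψ : Admissible d ψ₀) :
    ContDiff ℝ (⊤ : ℕ∞) (psiOf d ψ₀) := by
  rw [psi_conv]
  exact contDiff_conv d _ _ _ (adm_integrable d ψ₀ hψ).locallyIntegrable hψ.1 (adm_compact d ψ₀ hψ)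

theorem psi_supp (d : ℕ) (ψ₀ : Ed d → ℂ) (hψ : Admissible d ψ₀) (x : Ed d) (hx : psiOf d ψ₀ x ≠ 0) :
    ‖x‖ ≤ 1 / 5 := by
  by_contra hc
  apply hx
  rw [psiOf]
  have : ∀ y, ψ₀ y * ψ₀ (x - y) = 0 := by
    intro y
    by_contra h
    have h1 := hψ.2.1 _ (left_ne_zero_of_mul h)
    have h2 := hψ.2.1 _ (right_ne_zero_of_mul h)
    have := norm_add_le y (x - y)
    rw [add_sub_cancel] at this
    apply hc; linarith
  simp [this]

theorem psi_compact (d : ℕ) (ψ₀ : Ed d → ℂ) (hψ : Admissible d ψ₀) : HasCompactSupport (psiOf d ψ₀) :=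
  HasCompactSupport.intro (isCompact_closedBall (0 : Ed d) (1 / 5)) (fun x hx => by
    by_contra h
    exact hx (by simpa using psi_supp d ψ₀ hψ x h))

theorem psi_integrable (d : ℕ) (ψ₀ : Ed d → ℂ) (hψ : Admissible d ψ₀) : Integrable (psiOf d ψ₀) :=
  (psi_contDiff d ψ₀ hψ).continuous.integrable_of_hasCompactSupport (psi_compact d ψ₀ hψ)

theorem psi_fourier (d : ℕ) (ψ₀ : Ed d → ℂ) (hψ : Admissible d ψ₀) (ξ : Ed d) :
    𝓕 (psiOf d ψ₀) ξ = 𝓕 ψ₀ ξ ^ 2 := by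
  rw [psi_conv, Real.fourier_mul_convolution_eq (adm_integrable d ψ₀ hψ) (adm_integrable d ψ₀ hψ), sq]

theorem sphereM_finite (d : ℕ) (hd : 1 ≤ d) (r : ℝ) (hr : 0 < r) : IsFiniteMeasure (sphereM d r) := by
  have := sphereM_finite_one d hd
  rw [sphereM_eq_smul_map d hd r hr]
  constructor
  rw [Measure.smul_apply, smul_eq_mul]
  exact ENNReal.mul_lt_top ENNReal.ofReal_lt_top (measure_lt_top _ _)

/-- The kernel `σ_r * ψ`. -/
def Gr (d : ℕ) (ψ₀ : Ed d → ℂ) (r : ℝ) : Ed d → ℂ := fun x => ∫ z, psiOf d ψ₀ (x - z) ∂(sphereM d r)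

theorem Fyr_eq (d : ℕ) (ψ₀ : Ed d → ℂ) (y : Ed d) (r : ℝ) (x : Ed d) : Fyr d ψ₀ y r x = Gr d ψ₀ r (x - y) := rfl

theorem Gr_contDiff (d : ℕ) (hd : 1 ≤ d) (ψ₀ : Ed d → ℂ) (hψ : Admissible d ψ₀) (r : ℝ) (hr : 0 < r) :
    ContDiff ℝ (⊤ : ℕ∞) (Gr d ψ₀ r) := by
  have := sphereM_finite d hd r hr
  have e : Gr d ψ₀ r = (fun _ => (1 : ℂ)) ⋆[ContinuousLinearMap.mul ℂ ℂ, sphereM d r] psiOf d ψ₀ := by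
    funext x; rw [convolution_mul]; simp [Gr]
  rw [e]
  exact contDiff_conv d _ _ _ (integrable_const _).locallyIntegrable (psi_contDiff d ψ₀ hψ) (psi_compact d ψ₀ hψ)

theorem Gr_supp (d : ℕ) (ψ₀ : Ed d → ℂ) (hψ : Admissible d ψ₀) (r : ℝ) (x : Ed d) (hx : Gr d ψ₀ r x ≠ 0) :
    |‖x‖ - r| ≤ 1 / 5 := by
  by_contra hc
  apply hx
  rw [Gr]
  apply integral_eq_zero_of_ae
  filter_upwards [sphereM_ae d r] with z hz
  by_contra h
  have h1 := psi_supp d ψ₀ hψ _ h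
  have := abs_norm_sub_norm_le x z
  rw [hz] at this
  exact hc (this.trans h1)

theorem Gr_compact (d : ℕ) (ψ₀ : Ed d → ℂ) (hψ : Admissible d ψ₀) (r : ℝ) : HasCompactSupport (Gr d ψ₀ r) :=
  HasCompactSupport.intro (isCompact_closedBall (0 : Ed d) (r + 1 / 5)) (fun x hx => by
    by_contra h
    apply hx
    have := (abs_le.1 (Gr_supp d ψ₀ hψ r x h)).2
    simp; linarith)

theorem Gr_integrable (d : ℕ) (hd : 1 ≤ d) (ψ₀ : Ed d → ℂ) (hψ : Admissible d ψ₀) (r : ℝ) (hr : 0 < r) :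
    Integrable (Gr d ψ₀ r) :=
  (Gr_contDiff d hd ψ₀ hψ r hr).continuous.integrable_of_hasCompactSupport (Gr_compact d ψ₀ hψ r)

theorem Gr_fourier (d : ℕ) (hd : 1 ≤ d) (ψ₀ : Ed d → ℂ) (hψ : Admissible d ψ₀) (r : ℝ) (hr : 0 < r) (ξ : Ed d) :
    𝓕 (Gr d ψ₀ r) ξ = chi d r ξ * 𝓕 ψ₀ ξ ^ 2 := by
  have := sphereM_finite d hd r hr
  rw [Real.fourier_eq]
  have h1 : ∀ x, Real.fourierChar (-inner ℝ x ξ) • Gr d ψ₀ r x =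
      ∫ z, Real.fourierChar (-inner ℝ x ξ) • psiOf d ψ₀ (x - z) ∂(sphereM d r) := by
    intro x
    rw [Gr]
    simp only [Circle.smul_def, smul_eq_mul]
    rw [integral_const_mul]
  simp_rw [h1]
  have hψc := (psi_contDiff d ψ₀ hψ).continuous
  rw [integral_integral_swap]
  · have h2 : ∀ z, ∫ x, Real.fourierChar (-inner ℝ x ξ) • psiOf d ψ₀ (x - z) =
      (Real.fourierChar (-inner ℝ z ξ) : ℂ) * 𝓕 (psiOf d ψ₀) ξ := by
      intro z
      rw [Real.fourier_eq, ← integral_const_mul,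
        ← integral_sub_right_eq_self (fun x => (Real.fourierChar (-inner ℝ z ξ) : ℂ) * Real.fourierChar (-inner ℝ x ξ) • psiOf d ψ₀ x) z]
      congr 1
      funext x
      simp only [Circle.smul_def, smul_eq_mul]
      rw [← mul_assoc, ← Circle.coe_mul, ← AddChar.map_add_eq_mul]
      congr 3
      rw [inner_sub_left]; ring
    simp_rw [h2]
    rw [integral_mul_const, chi_eq d hd r hr, psi_fourier d ψ₀ hψ]
  · have hm : Continuous (fun q : Ed d × Ed d => Real.fourierChar (-inner ℝ q.1 ξ) • psiOf d ψ₀ (q.1 - q.2)) := by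
      have : Continuous (fun q : Ed d × Ed d => Real.fourierChar (-inner ℝ q.1 ξ)) :=
        Real.continuous_fourierChar.comp (by fun_prop)
      fun_prop
    show Integrable (fun q : Ed d × Ed d => Real.fourierChar (-inner ℝ q.1 ξ) • psiOf d ψ₀ (q.1 - q.2)) _
    rw [integrable_prod_iff' hm.aestronglyMeasurable]
    have e : ∀ y, ∫ x, ‖Real.fourierChar (-inner ℝ x ξ) • psiOf d ψ₀ (x - y)‖ = ∫ x, ‖psiOf d ψ₀ x‖ := by
      intro y
      simp only [Circle.smul_def, norm_smul, Circle.norm_coe, one_mul]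
      exact integral_sub_right_eq_self (fun x => ‖psiOf d ψ₀ x‖) y
    refine ⟨Filter.Eventually.of_forall fun y => ?_, ?_⟩
    · have h3 := (psi_integrable d ψ₀ hψ).comp_sub_right y
      refine h3.mono (hm.comp (by fun_prop : Continuous (fun x : Ed d => (x, y)))).aestronglyMeasurable ?_
      exact Filter.Eventually.of_forall fun x => by simp only [Circle.smul_def, norm_smul, Circle.norm_coe, one_mul]; exact le_rfl
    · simp_rw [e]
      exact integrable_const _

end PartB2

section PartB3

open scoped Convolution

/-- Bounded measurable functions with bounded support. -/
structure NiceB (d : ℕ) (b : Ed d → ℂ) : Prop where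
  meas : Measurable b
  le_one : ∀ y, ‖b y‖ ≤ 1
  supp : ∃ R : ℝ, ∀ y, b y ≠ 0 → ‖y‖ ≤ R

theorem NiceB.compact {d : ℕ} {b : Ed d → ℂ} (h : NiceB d b) : HasCompactSupport b := by
  obtain ⟨R, hR⟩ := h.supp
  exact HasCompactSupport.intro (isCompact_closedBall (0 : Ed d) R) (fun x hx => by
    by_contra h
    exact hx (by simpa using hR x h))

theorem NiceB.integrable {d : ℕ} {b : Ed d → ℂ} (h : NiceB d b) : Integrable b := by
  obtain ⟨R, hR⟩ := h.supp
  have h1 : IntegrableOn b (Metric.closedBall 0 R) :=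
    Measure.integrableOn_of_bounded (M := 1) measure_closedBall_lt_top.ne h.meas.aestronglyMeasurable
      (Filter.Eventually.of_forall h.le_one)
  refine (integrableOn_iff_integrable_of_support_subset ?_).1 h1
  intro y hy
  simpa using hR y hy

/-- The building blocks. -/
def fb (d : ℕ) (ψ₀ : Ed d → ℂ) (b : Ed d → ℂ) (r : ℝ) : Ed d → ℂ :=
  fun x => ∫ y, b y * Fyr d ψ₀ y r x

theorem fb_conv (d : ℕ) (ψ₀ : Ed d → ℂ) (b : Ed d → ℂ) (r : ℝ) :
    fb d ψ₀ b r = b ⋆[ContinuousLinearMap.mul ℂ ℂ, volume] (Gr d ψ₀ r) := by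
  funext x; rw [convolution_mul]; rfl

theorem conv_schwartz (d : ℕ) (b g : Ed d → ℂ) (hb : NiceB d b) (hg : ContDiff ℝ (⊤ : ℕ∞) g)
    (hc : HasCompactSupport g) :
    ∃ f : SchwartzMap (Ed d) ℂ, (f : Ed d → ℂ) = b ⋆[ContinuousLinearMap.mul ℂ ℂ, volume] g ∧
      ∀ ξ, 𝓕 f ξ = 𝓕 b ξ * 𝓕 g ξ := by
  have h1 := HasCompactSupport.convolution (ContinuousLinearMap.mul ℂ ℂ) (μ := volume) hb.compact hc
  refine ⟨h1.toSchwartzMap (contDiff_conv d _ _ _ hb.integrable.locallyIntegrable hg hc), rfl, fun ξ => ?_⟩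
  rw [← Real.fourier_mul_convolution_eq hb.integrable (hg.continuous.integrable_of_hasCompactSupport hc)]
  rfl

theorem fb_schwartz (d : ℕ) (hd : 1 ≤ d) (ψ₀ : Ed d → ℂ) (hψ : Admissible d ψ₀) (b : Ed d → ℂ) (hb : NiceB d b)
    (r : ℝ) (hr : 0 < r) :
    ∃ f : SchwartzMap (Ed d) ℂ, (f : Ed d → ℂ) = fb d ψ₀ b r ∧
      ∀ ξ, 𝓕 f ξ = 𝓕 b ξ * (chi d r ξ * 𝓕 ψ₀ ξ ^ 2) := by
  obtain ⟨f, h1, h2⟩ := conv_schwartz d b (Gr d ψ₀ r) hb (Gr_contDiff d hd ψ₀ hψ r hr) (Gr_compact d ψ₀ hψ r)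
  refine ⟨f, by rw [h1, fb_conv], fun ξ => by rw [h2, Gr_fourier d hd ψ₀ hψ r hr]⟩

theorem schwartz_sq_integrable (d : ℕ) (f : SchwartzMap (Ed d) ℂ) : Integrable (fun x => ‖f x‖ ^ 2) :=
  (f.memLp 2 volume).integrable_norm_pow (by norm_num)

theorem chi_phat (d : ℕ) (hd : 1 ≤ d) (ψ₀ : Ed d → ℂ) (hψ : Admissible d ψ₀) :
    ∃ C : ℝ, 0 < C ∧ ∀ r : ℝ, 0 < r → ∀ ξ : Ed d, ξ ≠ 0 →
      |chi d r ξ| * ‖𝓕 ψ₀ ξ‖ ≤ C * r ^ (((d : ℝ) - 1) / 2) := by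
  obtain ⟨C1, hC1, h1⟩ := chi_decay d hd
  obtain ⟨C2, hC2, h2⟩ := phat_bound d hd ψ₀ hψ
  refine ⟨C1 * C2, by positivity, fun r hr ξ hξ => ?_⟩
  have hξ' : 0 < ‖ξ‖ := norm_pos_iff.2 hξ
  have e : ‖ξ‖ ^ (-(((d : ℝ) - 1) / 2)) * ‖ξ‖ ^ (((d : ℝ) - 1) / 2) = 1 := by
    rw [← Real.rpow_add hξ']; simp
  calc _ ≤ (C1 * r ^ (((d : ℝ) - 1) / 2) * ‖ξ‖ ^ (-(((d : ℝ) - 1) / 2))) * (C2 * ‖ξ‖ ^ (((d : ℝ) - 1) / 2)) := by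
        gcongr
        · exact h1 r hr ξ hξ
        · exact h2 ξ
    _ = C1 * C2 * r ^ (((d : ℝ) - 1) / 2) * (‖ξ‖ ^ (-(((d : ℝ) - 1) / 2)) * ‖ξ‖ ^ (((d : ℝ) - 1) / 2)) := by ring
    _ = _ := by rw [e, mul_one]

theorem rpow_half_sq (d : ℕ) (hd : 1 ≤ d) (r : ℝ) (hr : 0 < r) :
    (r ^ (((d : ℝ) - 1) / 2)) ^ 2 = r ^ (d - 1) := by
  rw [← Real.rpow_natCast, ← Real.rpow_mul hr.le, ← Real.rpow_natCast r, Nat.cast_sub hd]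
  congr 1; push_cast; ring

theorem ne_zero_ae (d : ℕ) (hd : 1 ≤ d) : ∀ᵐ ξ : Ed d, ξ ≠ 0 := by
  have : Nonempty (Fin d) := ⟨⟨0, hd⟩⟩
  have : Nontrivial (Ed d) := inferInstance
  rw [ae_iff]
  simp

/-- L² bound for building blocks (P1). -/
theorem fb_L2 (d : ℕ) (hd : 1 ≤ d) (ψ₀ : Ed d → ℂ) (hψ : Admissible d ψ₀) :
    ∃ C : ℝ, 0 < C ∧ ∀ (b : Ed d → ℂ), NiceB d b → ∀ r : ℝ, 0 < r →
      ∫ x, ‖fb d ψ₀ b r x‖ ^ 2 ≤ C * r ^ (d - 1) * ∫ y, ‖b y‖ := by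
  obtain ⟨C, hC, h⟩ := chi_phat d hd ψ₀ hψ
  set L : ℝ := ∫ x, ‖ψ₀ x‖ with hL
  have hL0 : 0 ≤ L := integral_nonneg fun _ => norm_nonneg _
  refine ⟨C ^ 2 * (L ^ 2 + 1), by positivity, fun b hb r hr => ?_⟩
  obtain ⟨f, hf1, hf2⟩ := fb_schwartz d hd ψ₀ hψ b hb r hr
  obtain ⟨g, hg1, hg2⟩ := conv_schwartz d b ψ₀ hb hψ.1 (adm_compact d ψ₀ hψ)
  have hB : 0 ≤ ∫ y, ‖b y‖ := integral_nonneg fun _ => norm_nonneg _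
  have hg3 : ∫ x, ‖g x‖ ^ 2 ≤ L ^ 2 * ∫ y, ‖b y‖ := by
    set k : Ed d → ℝ := (fun y => ‖b y‖) ⋆[ContinuousLinearMap.mul ℝ ℝ, volume] (fun y => ‖ψ₀ y‖) with hk
    have hki : Integrable k := hb.integrable.norm.integrable_convolution _ (adm_integrable d ψ₀ hψ).norm
    have hk1 : ∀ x, ‖g x‖ ≤ k x := by
      intro x
      rw [hg1, convolution_mul, hk, convolution_mul]
      refine (norm_integral_le_integral_norm _).trans (le_of_eq ?_)
      simp only [norm_mul]
    have hk2 : ∀ x, k x ≤ L := by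
      intro x
      rw [hk, convolution_mul, hL, ← integral_sub_left_eq_self (fun y => ‖ψ₀ y‖) volume x]
      refine integral_mono_of_nonneg (Filter.Eventually.of_forall fun y => by positivity)
        ((adm_integrable d ψ₀ hψ).norm.comp_sub_left x) (Filter.Eventually.of_forall fun y => ?_)
      exact mul_le_of_le_one_left (norm_nonneg _) (hb.le_one y)
    calc ∫ x, ‖g x‖ ^ 2 ≤ ∫ x, L * k x := by
          refine integral_mono_of_nonneg (Filter.Eventually.of_forall fun y => by positivity)
            (hki.const_mul L) (Filter.Eventually.of_forall fun x => ?_)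
          show ‖g x‖ ^ 2 ≤ L * k x
          rw [sq]
          exact mul_le_mul ((hk1 x).trans (hk2 x)) (hk1 x) (norm_nonneg _) hL0
      _ = L * ((∫ y, ‖b y‖) * L) := by
          rw [integral_const_mul, hk, integral_convolution _ hb.integrable.norm (adm_integrable d ψ₀ hψ).norm]
          rfl
      _ = _ := by ring
  rw [← hf1]
  calc ∫ x, ‖f x‖ ^ 2 = ∫ ξ, ‖𝓕 f ξ‖ ^ 2 := (SchwartzMap.integral_norm_sq_fourier f).symm
    _ ≤ ∫ ξ, (C ^ 2 * r ^ (d - 1)) * ‖𝓕 g ξ‖ ^ 2 := by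
        refine integral_mono_of_nonneg (Filter.Eventually.of_forall fun y => by positivity)
          ((schwartz_sq_integrable d (𝓕 g)).const_mul _) ?_
        filter_upwards [ne_zero_ae d hd] with ξ hξ
        rw [hf2, hg2]
        have h1 := h r hr ξ hξ
        have e : ‖𝓕 b ξ * (chi d r ξ * 𝓕 ψ₀ ξ ^ 2)‖ = (|chi d r ξ| * ‖𝓕 ψ₀ ξ‖) * ‖𝓕 b ξ * 𝓕 ψ₀ ξ‖ := by
          simp only [norm_mul, norm_pow, Complex.norm_real, Real.norm_eq_abs]; ring
        rw [e, mul_pow, ← rpow_half_sq d hd r hr, ← mul_pow C]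
        gcongr
    _ = C ^ 2 * r ^ (d - 1) * ∫ x, ‖g x‖ ^ 2 := by
        rw [integral_const_mul, SchwartzMap.integral_norm_sq_fourier]
    _ ≤ C ^ 2 * r ^ (d - 1) * (L ^ 2 * ∫ y, ‖b y‖) := by gcongr
    _ ≤ C ^ 2 * r ^ (d - 1) * ((L ^ 2 + 1) * ∫ y, ‖b y‖) := by gcongr; linarith
    _ = _ := by ring

theorem fb_supp (d : ℕ) (ψ₀ : Ed d → ℂ) (hψ : Admissible d ψ₀) (b : Ed d → ℂ) (r : ℝ) (x : Ed d)
    (hx : fb d ψ₀ b r x ≠ 0) : ∃ y, b y ≠ 0 ∧ |‖x - y‖ - r| ≤ 1 / 5 := by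
  by_contra hc
  push Not at hc
  apply hx
  rw [fb]
  apply integral_eq_zero_of_ae
  refine Filter.Eventually.of_forall fun y => ?_
  by_contra h
  exact absurd (Gr_supp d ψ₀ hψ r _ (right_ne_zero_of_mul h)) (not_le.2 (hc y (left_ne_zero_of_mul h)))

theorem radial_fourier (d : ℕ) (hd : 1 ≤ d) : ∃ C : ℝ, 0 < C ∧ ∀ (M : Ed d → ℂ), Integrable M →
    (∀ ξ η, ‖ξ‖ = ‖η‖ → M ξ = M η) →
    Integrable (fun ξ => ‖ξ‖ ^ (-(((d : ℝ) - 1) / 2)) * ‖M ξ‖) → ∀ w : Ed d, w ≠ 0 →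
    (sphereM d 1 univ).toReal * ‖𝓕 M w‖ ≤
      C * ‖w‖ ^ (-(((d : ℝ) - 1) / 2)) * ∫ ξ, ‖ξ‖ ^ (-(((d : ℝ) - 1) / 2)) * ‖M ξ‖ := by
  have hfin := sphereM_finite_one d hd
  obtain ⟨C, hC, h⟩ := chi_decay d hd
  refine ⟨C, hC, fun M hM hrad hMi w hw => ?_⟩
  have hw' : 0 < ‖w‖ := norm_pos_iff.2 hw
  have h1 : ∀ η : Ed d, ‖η‖ = ‖w‖ → 𝓕 M η = 𝓕 M w := by
    intro η hη
    obtain ⟨T, hT⟩ := exists_isom d η w hη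
    rw [← hT, ← Real.fourier_comp_linearIsometry]
    have e : M ∘ T = M := by
      funext x
      exact hrad _ _ (by simp)
    rw [e]
  have h2 : ∫ θ, 𝓕 M (‖w‖ • θ) ∂(sphereM d 1) = ((sphereM d 1 univ).toReal : ℂ) * 𝓕 M w := by
    have : ∫ θ, 𝓕 M (‖w‖ • θ) ∂(sphereM d 1) = ∫ θ, 𝓕 M w ∂(sphereM d 1) := by
      refine integral_congr_ae ?_
      filter_upwards [sphereM_ae d 1] with θ hθ
      exact h1 _ (by rw [norm_smul, hθ]; simp)
    rw [this, integral_const, Complex.real_smul]; rfl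
  have h3 : ∫ θ, 𝓕 M (‖w‖ • θ) ∂(sphereM d 1) = ∫ ξ, M ξ * chi d 1 (‖w‖ • ξ) := by
    simp_rw [Real.fourier_eq]
    rw [integral_integral_swap]
    · congr 1
      funext ξ
      rw [← chi_eq d hd 1 one_pos, ← integral_const_mul]
      congr 1
      funext θ
      rw [Circle.smul_def, smul_eq_mul, mul_comm, inner_smul_right, inner_smul_right, real_inner_comm]
    · have hm : Continuous (fun q : Ed d × Ed d => (Real.fourierChar (-inner ℝ q.2 (‖w‖ • q.1)) : ℂ)) :=
        continuous_subtype_val.comp (Real.continuous_fourierChar.comp (by fun_prop))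
      have h5 : Integrable (fun q : Ed d × Ed d => (1 : ℂ) * M q.2) ((sphereM d 1).prod volume) :=
        (integrable_const (1 : ℂ)).mul_prod hM
      have h6 := h5.bdd_mul (c := 1) hm.aestronglyMeasurable (Filter.Eventually.of_forall fun q => by
        rw [Circle.norm_coe])
      refine h6.congr (Filter.Eventually.of_forall fun q => ?_)
      simp [Function.uncurry, Circle.smul_def]
  have h4 : (sphereM d 1 univ).toReal * ‖𝓕 M w‖ = ‖∫ ξ, M ξ * chi d 1 (‖w‖ • ξ)‖ := by
    rw [← h3, h2, norm_mul, Complex.norm_real, Real.norm_of_nonneg ENNReal.toReal_nonneg]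
  rw [h4, ← integral_const_mul]
  refine norm_integral_le_of_norm_le (hMi.const_mul _) ?_
  filter_upwards [ne_zero_ae d hd] with ξ hξ
  have h7 := h 1 one_pos (‖w‖ • ξ) (by simp [hw, hξ])
  rw [Real.one_rpow, mul_one, norm_smul, norm_norm, Real.mul_rpow (norm_nonneg _) (norm_nonneg _)] at h7
  rw [norm_mul, Complex.norm_real, Real.norm_eq_abs]
  calc ‖M ξ‖ * _ ≤ ‖M ξ‖ * (C * (‖w‖ ^ (-(((d : ℝ) - 1) / 2)) * ‖ξ‖ ^ (-(((d : ℝ) - 1) / 2)))) := by gcongr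
    _ = _ := by ring

end PartB3

section PartB4

open scoped Convolution

theorem fourier_pair (d : ℕ) (b b' M : Ed d → ℂ) (hb : Integrable b) (hb' : Integrable b') (hM : Integrable M) :
    ∫ ξ, starRingEnd ℂ (𝓕 b ξ) * 𝓕 b' ξ * M ξ =
      ∫ q : Ed d × Ed d, starRingEnd ℂ (b q.1) * b' q.2 * 𝓕 M (q.2 - q.1) ∂(volume.prod volume) := by
  have h1 : ∀ ξ, starRingEnd ℂ (𝓕 b ξ) * 𝓕 b' ξ * M ξ =
      ∫ q : Ed d × Ed d, starRingEnd ℂ (b q.1) * b' q.2 *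
        ((Real.fourierChar (-inner ℝ ξ (q.2 - q.1)) : ℂ) * M ξ) ∂(volume.prod volume) := by
    intro ξ
    rw [Real.fourier_eq, Real.fourier_eq, ← integral_conj, ← integral_prod_mul, ← integral_mul_const]
    congr 1
    funext q
    simp only [Circle.smul_def, smul_eq_mul, map_mul]
    have e : (Real.fourierChar (-inner ℝ ξ (q.2 - q.1)) : ℂ) =
      starRingEnd ℂ (Real.fourierChar (-inner ℝ q.1 ξ) : ℂ) * Real.fourierChar (-inner ℝ q.2 ξ) := by
      rw [← Circle.coe_inv_eq_conj, ← Circle.coe_mul, ← AddChar.map_neg_eq_inv, ← AddChar.map_add_eq_mul]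
      congr 2
      rw [inner_sub_right, real_inner_comm ξ, real_inner_comm ξ]; ring
    rw [e]; ring
  simp_rw [h1]
  rw [integral_integral_swap]
  · congr 1
    funext q
    rw [integral_const_mul, Real.fourier_eq]
    rfl
  · have hm : Continuous (fun q : Ed d × (Ed d × Ed d) => (Real.fourierChar (-inner ℝ q.1 (q.2.2 - q.2.1)) : ℂ)) :=
      continuous_subtype_val.comp (Real.continuous_fourierChar.comp (by fun_prop))
    have hbc : Integrable (fun y => starRingEnd ℂ (b y)) :=
      (Complex.conjLIE.toContinuousLinearEquiv.toContinuousLinearMap.integrable_comp hb)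
    have h5 := hM.mul_prod (hbc.mul_prod hb')
    have h6 := h5.bdd_mul (c := 1) hm.aestronglyMeasurable (Filter.Eventually.of_forall fun q => by
        rw [Circle.norm_coe])
    refine h6.congr (Filter.Eventually.of_forall fun q => ?_)
    simp only [Function.uncurry]
    ring

/-- Almost orthogonality (P2). -/
theorem fb_inner (d : ℕ) (hd : 1 ≤ d) (ψ₀ : Ed d → ℂ) (hψ : Admissible d ψ₀) :
    ∃ C : ℝ, 0 < C ∧ ∀ (b b' : Ed d → ℂ), NiceB d b → NiceB d b' → ∀ r r' : ℝ, 0 < r → 0 < r' →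
      ∀ δ : ℝ, 0 < δ → (∀ y y', b y ≠ 0 → b' y' ≠ 0 → δ ≤ ‖y - y'‖) →
      ‖∫ x, inner ℂ (fb d ψ₀ b r x) (fb d ψ₀ b' r' x)‖ ≤
        C * (r * r') ^ (((d : ℝ) - 1) / 2) * δ ^ (-(((d : ℝ) - 1) / 2)) * ((∫ y, ‖b y‖) * ∫ y, ‖b' y‖) := by
  have hfin := sphereM_finite_one d hd
  obtain ⟨C, hC, h⟩ := chi_phat d hd ψ₀ hψ
  obtain ⟨C2, hC2, h2⟩ := phat_bound d hd ψ₀ hψ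
  obtain ⟨C3, hC3, h3⟩ := radial_fourier d hd
  obtain ⟨g, hg⟩ := phat_schwartz d ψ₀ hψ
  obtain ⟨K, hK, hgK⟩ := g.decay 0 0
  have hgi : Integrable (fun ξ => ‖𝓕 ψ₀ ξ‖) := by rw [← hg]; exact g.integrable.norm
  have hgK' : ∀ ξ, ‖𝓕 ψ₀ ξ‖ ≤ K := fun ξ => by simpa [hg] using hgK ξ
  have hgc : Continuous (𝓕 ψ₀) := by rw [← hg]; exact g.continuous
  set A : ℝ := ∫ ξ, ‖𝓕 ψ₀ ξ‖ with hA
  have hA0 : 0 ≤ A := integral_nonneg fun _ => norm_nonneg _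
  set s : ℝ := (sphereM d 1 univ).toReal with hs
  have hd1 : (0:ℝ) ≤ ((d : ℝ) - 1) / 2 := by
    have : (1:ℝ) ≤ d := by exact_mod_cast hd
    linarith
  set κ : ℝ := ((d : ℝ) - 1) / 2 with hκ
  refine ⟨s⁻¹ * (C3 * (C ^ 2 * C2)) * A + 1, by positivity, fun b b' hb hb' r r' hr hr' δ hδ hsep => ?_⟩
  obtain ⟨f, hf1, hf2⟩ := fb_schwartz d hd ψ₀ hψ b hb r hr
  obtain ⟨f', hf1', hf2'⟩ := fb_schwartz d hd ψ₀ hψ b' hb' r' hr'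
  set M : Ed d → ℂ := fun ξ => ((chi d r ξ * chi d r' ξ * ‖𝓕 ψ₀ ξ‖ ^ 4 : ℝ) : ℂ) with hM
  have hMn : ∀ ξ, ‖M ξ‖ = (|chi d r ξ| * ‖𝓕 ψ₀ ξ‖) * (|chi d r' ξ| * ‖𝓕 ψ₀ ξ‖) * ‖𝓕 ψ₀ ξ‖ * ‖𝓕 ψ₀ ξ‖ := by
    intro ξ
    rw [hM, Complex.norm_real, Real.norm_eq_abs, abs_mul, abs_mul, abs_of_nonneg (by positivity : (0:ℝ) ≤ ‖𝓕 ψ₀ ξ‖ ^ 4)]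
    ring
  have hMc : Continuous M := by
    have := chi_continuous d hd r
    have := chi_continuous d hd r'
    fun_prop
  have hM1 : ∀ ξ : Ed d, ξ ≠ 0 → ‖M ξ‖ ≤ (C * r ^ κ) * (C * r' ^ κ) * ‖𝓕 ψ₀ ξ‖ * ‖𝓕 ψ₀ ξ‖ := by
    intro ξ hξ
    rw [hMn]
    have h10 := mul_le_mul (h r hr ξ hξ) (h r' hr' ξ hξ) (by positivity) (by positivity)
    exact mul_le_mul_of_nonneg_right (mul_le_mul_of_nonneg_right h10 (norm_nonneg _)) (norm_nonneg _)
  have hMi : Integrable M := by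
    refine (hgi.const_mul ((C * r ^ κ) * (C * r' ^ κ) * K)).mono' hMc.aestronglyMeasurable ?_
    filter_upwards [ne_zero_ae d hd] with ξ hξ
    refine (hM1 ξ hξ).trans ?_
    gcongr
    exact hgK' ξ
  have hrr : (C * r ^ κ) * (C * r' ^ κ) = C ^ 2 * (r * r') ^ κ := by
    rw [Real.mul_rpow hr.le hr'.le]; ring
  have hM2 : ∀ ξ : Ed d, ξ ≠ 0 → ‖ξ‖ ^ (-κ) * ‖M ξ‖ ≤ (C ^ 2 * (r * r') ^ κ * C2) * ‖𝓕 ψ₀ ξ‖ := by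
    intro ξ hξ
    have hξ' : 0 < ‖ξ‖ := norm_pos_iff.2 hξ
    have e : ‖ξ‖ ^ (-κ) * ‖ξ‖ ^ κ = 1 := by
      rw [← Real.rpow_add hξ']; simp
    calc _ ≤ ‖ξ‖ ^ (-κ) * ((C * r ^ κ) * (C * r' ^ κ) * (C2 * ‖ξ‖ ^ κ) * ‖𝓕 ψ₀ ξ‖) := by
          gcongr
          refine (hM1 ξ hξ).trans ?_
          gcongr
          exact h2 ξ
      _ = (‖ξ‖ ^ (-κ) * ‖ξ‖ ^ κ) * (((C * r ^ κ) * (C * r' ^ κ) * C2) * ‖𝓕 ψ₀ ξ‖) := by ring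
      _ = _ := by rw [e, hrr]; ring
  have hMi2 : Integrable (fun ξ => ‖ξ‖ ^ (-κ) * ‖M ξ‖) := by
    refine (hgi.const_mul (C ^ 2 * (r * r') ^ κ * C2)).mono' ?_ ?_
    · exact (Measurable.aestronglyMeasurable (by fun_prop))
    · filter_upwards [ne_zero_ae d hd] with ξ hξ
      rw [Real.norm_of_nonneg (by positivity)]
      exact hM2 ξ hξ
  have hMI : ∫ ξ, ‖ξ‖ ^ (-κ) * ‖M ξ‖ ≤ (C ^ 2 * (r * r') ^ κ * C2) * A := by
    rw [hA, ← integral_const_mul]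
    refine integral_mono_ae hMi2 (hgi.const_mul _) ?_
    filter_upwards [ne_zero_ae d hd] with ξ hξ using hM2 ξ hξ
  have hrad : ∀ ξ η : Ed d, ‖ξ‖ = ‖η‖ → M ξ = M η := by
    intro ξ η he
    simp only [hM, chi_radial d hd _ ξ η he, phat_radial d ψ₀ hψ ξ η he]
  -- the pointwise bound for the Fourier transform of M
  have hFM : ∀ w : Ed d, w ≠ 0 → ‖𝓕 M w‖ ≤ (s⁻¹ * (C3 * (C ^ 2 * C2)) * A) * (r * r') ^ κ * ‖w‖ ^ (-κ) := by
    intro w hw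
    by_cases hs0 : s = 0
    · have : sphereM d 1 = 0 := by
        rw [hs, ENNReal.toReal_eq_zero_iff] at hs0
        rcases hs0 with h | h
        · exact Measure.measure_univ_eq_zero.1 h
        · exact absurd h (measure_ne_top _ _)
      have hM0 : M = 0 := by
        funext ξ
        simp [hM, chi, this]
      have : 𝓕 M w = 0 := by rw [Real.fourier_eq, hM0]; simp
      rw [this, norm_zero]
      positivity
    · have hsp : 0 < s := lt_of_le_of_ne ENNReal.toReal_nonneg (Ne.symm hs0)
      have h6 := h3 M hMi hrad hMi2 w hw
      have h7 : s * ‖𝓕 M w‖ ≤ C3 * ‖w‖ ^ (-κ) * ((C ^ 2 * (r * r') ^ κ * C2) * A) :=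
        h6.trans (by gcongr)
      calc ‖𝓕 M w‖ = s⁻¹ * (s * ‖𝓕 M w‖) := by field_simp
        _ ≤ s⁻¹ * (C3 * ‖w‖ ^ (-κ) * ((C ^ 2 * (r * r') ^ κ * C2) * A)) := by gcongr
        _ = _ := by ring
  have e1 : ∫ x, inner ℂ (fb d ψ₀ b r x) (fb d ψ₀ b' r' x) = ∫ ξ, starRingEnd ℂ (𝓕 b ξ) * 𝓕 b' ξ * M ξ := by
    rw [← hf1, ← hf1', ← SchwartzMap.integral_inner_fourier_fourier]
    congr 1
    funext ξ
    rw [hf2, hf2', RCLike.inner_apply']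
    simp only [map_mul, map_pow, Complex.conj_ofReal, hM]
    push_cast
    have : ((‖𝓕 ψ₀ ξ‖ : ℝ) : ℂ) ^ 4 = starRingEnd ℂ (𝓕 ψ₀ ξ) ^ 2 * 𝓕 ψ₀ ξ ^ 2 := by
      rw [← mul_pow, ← Complex.normSq_eq_conj_mul_self, Complex.normSq_eq_norm_sq]
      push_cast; ring
    rw [this]
    ring
  rw [e1, fourier_pair d b b' M hb.integrable hb'.integrable hMi]
  have e2 : (∫ y, ‖b y‖) * ∫ y, ‖b' y‖ = ∫ q : Ed d × Ed d, ‖b q.1‖ * ‖b' q.2‖ ∂(volume.prod volume) :=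
    (integral_prod_mul _ _).symm
  rw [e2, ← integral_const_mul]
  refine norm_integral_le_of_norm_le ((hb.integrable.norm.mul_prod hb'.integrable.norm).const_mul _) ?_
  refine Filter.Eventually.of_forall fun q => ?_
  by_cases hq : b q.1 = 0
  · simp [hq]
  by_cases hq' : b' q.2 = 0
  · simp [hq']
  have hq2 := hsep _ _ hq hq'
  rw [← norm_neg, neg_sub] at hq2
  have hne : q.2 - q.1 ≠ 0 := norm_pos_iff.1 (hδ.trans_le hq2)
  have h9 : ‖q.2 - q.1‖ ^ (-κ) ≤ δ ^ (-κ) := Real.rpow_le_rpow_of_nonpos hδ hq2 (by linarith)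
  rw [norm_mul, norm_mul, RCLike.norm_conj, mul_comm]
  gcongr
  refine (hFM _ hne).trans ?_
  gcongr
  linarith

end PartB4

/-- annulus -/
def ann (d : ℕ) (y : Ed d) (s w : ℝ) : Set (Ed d) := {x | |dist x y - s| ≤ w}

theorem ann_subset_ball (d : ℕ) (y : Ed d) (s w : ℝ) : ann d y s w ⊆ Metric.closedBall y (s + w) := by
  intro x hx
  have hx' : |dist x y - s| ≤ w := hx
  have := (abs_le.1 hx').2
  simp only [Metric.mem_closedBall]; linarith

theorem ann_vol (d : ℕ) (hd : 1 ≤ d) : ∃ C : ℝ, 0 < C ∧ ∀ (y : Ed d) (s w : ℝ), 0 ≤ s → 0 ≤ w →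
    volume.real (ann d y s w) ≤ C * (s + w) ^ (d - 1) * w := by
  have : Nonempty (Fin d) := ⟨⟨0, hd⟩⟩
  have : Nontrivial (Ed d) := inferInstance
  set ω : ℝ := volume.real (Metric.ball (0 : Ed d) 1) with hω
  have hω0 : 0 ≤ ω := measureReal_nonneg
  refine ⟨(ω + 1) * (2 * d), by positivity, fun y s w hs hw => ?_⟩
  set t : ℝ := max (s - w) 0 with ht
  have ht0 : 0 ≤ t := le_max_right _ _
  have hts : t ≤ s + w := max_le (by linarith) (by linarith)
  have hts2 : s + w - t ≤ 2 * w := by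
    have := le_max_left (s - w) 0
    rw [← ht] at this; linarith
  have h1 : ann d y s w ⊆ Metric.closedBall y (s + w) \ Metric.ball y t := by
    intro x hx
    refine ⟨ann_subset_ball d y s w hx, fun hb => ?_⟩
    have hx' : |dist x y - s| ≤ w := hx
    have h2 := (abs_le.1 hx').1
    have h3 : dist x y < t := hb
    rcases max_cases (s - w) 0 with ⟨h, _⟩ | ⟨h, _⟩
    · rw [ht, h] at h3; linarith
    · rw [ht, h] at h3
      exact absurd h3 (not_lt.2 dist_nonneg)
  have hball : volume.real (Metric.ball y t) = t ^ d * ω := by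
    rw [measureReal_def, Measure.addHaar_ball _ _ ht0, ENNReal.toReal_mul, ENNReal.toReal_ofReal (by positivity)]
    simp [hω, measureReal_def]
  have hfr : Module.finrank ℝ (Ed d) = d := by simp
  calc volume.real (ann d y s w) ≤ volume.real (Metric.closedBall y (s + w) \ Metric.ball y t) :=
        measureReal_mono h1 (ne_top_of_le_ne_top measure_closedBall_lt_top.ne (measure_mono sdiff_subset))
    _ = (s + w) ^ d * ω - t ^ d * ω := by
        rw [measureReal_sdiff (Metric.ball_subset_closedBall.trans (Metric.closedBall_subset_closedBall hts))
          Metric.isOpen_ball.measurableSet measure_closedBall_lt_top.ne, Measure.addHaar_real_closedBall _ _ (by positivity),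
          hball, hfr]
    _ = ω * ((s + w) ^ d - t ^ d) := by ring
    _ ≤ ω * (2 * w * d * (s + w) ^ (d - 1)) := by
        gcongr
        have h4 := abs_pow_sub_pow_le (s + w) t d
        rw [abs_of_nonneg (sub_nonneg.2 hts), abs_of_nonneg (by linarith : 0 ≤ s + w), abs_of_nonneg ht0,
          max_eq_left hts] at h4
        refine (le_abs_self _).trans (h4.trans ?_)
        gcongr
    _ ≤ (ω + 1) * (2 * w * d * (s + w) ^ (d - 1)) := by gcongr; linarith
    _ = _ := by ring

open Classical in
theorem support_lemma (d : ℕ) (hd : 1 ≤ d) (c : ℝ) (hc : 1 ≤ c) : ∃ C : ℝ, 0 < C ∧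
    ∀ {ι : Type} (S A : Finset ι) (y : ι → Ed d) (m : ι → ℕ) (L u : ℝ), 1 ≤ L → 0 < u →
    (∀ a ∈ A, ∃ ρ : ℝ, L ≤ ρ ∧ ρ ≤ 200 * m a ∧
      u * ρ ≤ L ^ d * ((S.filter fun a' => dist (y a') (y a) ≤ ρ ∧ |(m a' : ℝ) - m a| ≤ ρ ∧ m a ≤ 8 * m a').card : ℝ)) →
    volume.real (⋃ a ∈ A, ann d (y a) (m a) (c * L)) ≤ C * u⁻¹ * (L ^ d * ∑ a ∈ S, (m a : ℝ) ^ (d - 1)) := by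
  obtain ⟨C0, hC0, hann⟩ := ann_vol d hd
  refine ⟨C0 * (1 + 200 * (c + 10)) ^ (d - 1) * (c + 10) * 8 ^ (d - 1), by positivity, ?_⟩
  intro ι S A y m L u hL hu hA
  choose! ρ hρ using hA
  obtain ⟨B', hB'A, hdisj, hcov⟩ := Vitali.exists_disjoint_subfamily_covering_enlargement_closedBall
    (↑A : Set ι) (fun a => ((y a, (m a : ℝ)) : Ed d × ℝ)) ρ (∑ a ∈ A, 200 * (m a : ℝ))
    (fun a ha => (hρ a ha).2.1.trans (Finset.single_le_sum (f := fun a => 200 * (m a : ℝ)) (fun _ _ => by positivity) ha)) 5 (by norm_num)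
  set B : Finset ι := A.filter (· ∈ B') with hB
  have hBm : ∀ b, b ∈ B ↔ b ∈ B' := fun b => by
    rw [hB, Finset.mem_filter]; exact ⟨fun h => h.2, fun h => ⟨hB'A h, h⟩⟩
  have hBA : ∀ b ∈ B, b ∈ A := fun b hb => (Finset.mem_filter.1 hb).1
  set N : ι → Finset ι := fun a => S.filter fun a' => dist (y a') (y a) ≤ ρ a ∧ |(m a' : ℝ) - m a| ≤ ρ a ∧ m a ≤ 8 * m a' with hN
  have hsub : (⋃ a ∈ A, ann d (y a) (m a) (c * L)) ⊆ ⋃ b ∈ B, ann d (y b) (m b) ((c + 10) * ρ b) := by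
    intro x hx
    simp only [mem_iUnion] at hx ⊢
    obtain ⟨a, ha, hxa⟩ := hx
    obtain ⟨b, hb, hab⟩ := hcov a ha
    have hbB := (hBm b).2 hb
    refine ⟨b, hbB, ?_⟩
    have hρa := hρ a ha
    have hρb := hρ b (hBA b hbB)
    have hmem := hab (Metric.mem_closedBall_self (by linarith [hρa.1]))
    rw [Metric.mem_closedBall, Prod.dist_eq, max_le_iff] at hmem
    have h1 : |(m a : ℝ) - m b| ≤ 5 * ρ b := hmem.2
    have h2 : dist (y a) (y b) ≤ 5 * ρ b := hmem.1
    have h3 := dist_triangle x (y a) (y b)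
    have h4 := dist_triangle_right x (y a) (y b)
    have h5 : |dist x (y a) - m a| ≤ c * L := hxa
    have h6 : c * L ≤ c * ρ b := by gcongr; exact hρb.1
    show |dist x (y b) - m b| ≤ (c + 10) * ρ b
    rw [abs_le] at *
    constructor <;> linarith
  have hone : ∀ b ∈ B, volume.real (ann d (y b) (m b) ((c + 10) * ρ b)) ≤
      C0 * (1 + 200 * (c + 10)) ^ (d - 1) * (c + 10) * 8 ^ (d - 1) * u⁻¹ * L ^ d * ∑ a ∈ N b, (m a : ℝ) ^ (d - 1) := by
    intro b hb
    obtain ⟨h1, h2, h3⟩ := hρ b (hBA b hb)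
    have hρ0 : 0 < ρ b := by linarith
    have h4 : ((m b : ℝ) ^ (d - 1)) * (N b).card ≤ ∑ a ∈ N b, 8 ^ (d - 1) * (m a : ℝ) ^ (d - 1) := by
      rw [mul_comm, ← nsmul_eq_mul]
      refine Finset.card_nsmul_le_sum _ _ _ (fun a ha => ?_)
      rw [← mul_pow]
      have : m b ≤ 8 * m a := (Finset.mem_filter.1 ha).2.2.2
      gcongr
      exact_mod_cast this
    calc _ ≤ C0 * (m b + (c + 10) * ρ b) ^ (d - 1) * ((c + 10) * ρ b) := hann _ _ _ (by positivity) (by positivity)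
      _ ≤ C0 * ((1 + 200 * (c + 10)) * m b) ^ (d - 1) * ((c + 10) * ρ b) := by
          gcongr
          nlinarith
      _ = C0 * (1 + 200 * (c + 10)) ^ (d - 1) * (c + 10) * u⁻¹ * (m b : ℝ) ^ (d - 1) * (u * ρ b) := by
          rw [mul_pow]; field_simp
      _ ≤ C0 * (1 + 200 * (c + 10)) ^ (d - 1) * (c + 10) * u⁻¹ * (m b : ℝ) ^ (d - 1) * (L ^ d * (N b).card) := by
          gcongr
      _ = C0 * (1 + 200 * (c + 10)) ^ (d - 1) * (c + 10) * u⁻¹ * L ^ d * ((m b : ℝ) ^ (d - 1) * (N b).card) := by ring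
      _ ≤ C0 * (1 + 200 * (c + 10)) ^ (d - 1) * (c + 10) * u⁻¹ * L ^ d * ∑ a ∈ N b, 8 ^ (d - 1) * (m a : ℝ) ^ (d - 1) := by gcongr
      _ = _ := by rw [← Finset.mul_sum]; ring
  have hNd : ∀ b ∈ B, ∀ b' ∈ B, b ≠ b' → Disjoint (N b) (N b') := by
    intro b hb b' hb' hne
    rw [Finset.disjoint_left]
    intro a ha ha'
    have h1 := (Finset.mem_filter.1 ha).2
    have h2 := (Finset.mem_filter.1 ha').2
    have h3 := hdisj ((hBm b).1 hb) ((hBm b').1 hb') hne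
    have h4 : ((y a, (m a : ℝ)) : Ed d × ℝ) ∈ Metric.closedBall ((y b, (m b : ℝ)) : Ed d × ℝ) (ρ b) := by
      rw [Metric.mem_closedBall, Prod.dist_eq]; exact max_le h1.1 h1.2.1
    have h5 : ((y a, (m a : ℝ)) : Ed d × ℝ) ∈ Metric.closedBall ((y b', (m b' : ℝ)) : Ed d × ℝ) (ρ b') := by
      rw [Metric.mem_closedBall, Prod.dist_eq]; exact max_le h2.1 h2.2.1
    exact Set.disjoint_left.1 h3 h4 h5
  calc _ ≤ volume.real (⋃ b ∈ B, ann d (y b) (m b) ((c + 10) * ρ b)) := by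
        refine measureReal_mono hsub (ne_of_lt ?_)
        refine (measure_biUnion_finset_le _ _).trans_lt (ENNReal.sum_lt_top.2 fun b _ => ?_)
        exact (measure_mono (ann_subset_ball d _ _ _)).trans_lt measure_closedBall_lt_top
    _ ≤ ∑ b ∈ B, volume.real (ann d (y b) (m b) ((c + 10) * ρ b)) := measureReal_biUnion_finset_le _ _
    _ ≤ ∑ b ∈ B, C0 * (1 + 200 * (c + 10)) ^ (d - 1) * (c + 10) * 8 ^ (d - 1) * u⁻¹ * L ^ d * ∑ a ∈ N b, (m a : ℝ) ^ (d - 1) :=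
        Finset.sum_le_sum hone
    _ = C0 * (1 + 200 * (c + 10)) ^ (d - 1) * (c + 10) * 8 ^ (d - 1) * u⁻¹ * L ^ d * ∑ a ∈ B.biUnion N, (m a : ℝ) ^ (d - 1) := by
        rw [← Finset.mul_sum, Finset.sum_biUnion (fun b hb b' hb' h => hNd b hb b' hb' h)]
    _ ≤ C0 * (1 + 200 * (c + 10)) ^ (d - 1) * (c + 10) * 8 ^ (d - 1) * u⁻¹ * L ^ d * ∑ a ∈ S, (m a : ℝ) ^ (d - 1) := by
        gcongr
        intro a ha
        obtain ⟨b, _, hb⟩ := Finset.mem_biUnion.1 ha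
        exact (Finset.mem_filter.1 hb).1
    _ = _ := by ring

theorem log_spec (q g : ℝ) (hq : 0 < q) (hg : q ≤ g) :
    q * 2 ^ (Nat.log 2 ⌊g / q⌋₊) ≤ g ∧ g < q * 2 ^ (Nat.log 2 ⌊g / q⌋₊ + 1) := by
  have h1 : 1 ≤ g / q := by rwa [le_div_iff₀ hq, one_mul]
  have h2 : ⌊g / q⌋₊ ≠ 0 := by
    have := (Nat.one_le_floor_iff _).2 h1
    omega
  have h3 := Nat.pow_log_le_self 2 h2
  have h4 := Nat.lt_pow_succ_log_self (b := 2) one_lt_two ⌊g / q⌋₊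
  have h5 : (2 : ℝ) ^ (Nat.log 2 ⌊g / q⌋₊) ≤ g / q := by
    have : ((2 ^ (Nat.log 2 ⌊g / q⌋₊) : ℕ) : ℝ) ≤ (⌊g / q⌋₊ : ℝ) := by exact_mod_cast h3
    push_cast at this
    exact this.trans (Nat.floor_le (by linarith))
  have h6 : g / q < (2 : ℝ) ^ (Nat.log 2 ⌊g / q⌋₊ + 1) := by
    have := (Nat.floor_lt (by linarith)).1 h4
    push_cast at this
    exact this
  rw [le_div_iff₀ hq] at h5
  rw [div_lt_iff₀ hq] at h6
  constructor <;> linarith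

open Classical in
/-- Summation over dyadic shells. -/
theorem dyadic_sum (κ : ℝ) (hκ : 1 < κ) : ∃ C : ℝ, 0 < C ∧ ∀ {ι : Type} (T : Finset ι) (g f : ι → ℝ) (q W : ℝ),
    0 < q → 0 ≤ W → (∀ a ∈ T, q ≤ g a) →
    (∀ i : ℕ, ∑ a ∈ T.filter (fun a => q * 2 ^ i ≤ g a ∧ g a < q * 2 ^ (i + 1)), f a ≤ W * (q * 2 ^ i) ^ (1 - κ)) →
    ∑ a ∈ T, f a ≤ C * W * q ^ (1 - κ) := by
  set x : ℝ := 2 ^ (1 - κ) with hx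
  have hx0 : 0 ≤ x := by positivity
  have hx1 : x < 1 := Real.rpow_lt_one_of_one_lt_of_neg (by norm_num) (by linarith)
  refine ⟨(1 - x)⁻¹, inv_pos.2 (by linarith), ?_⟩
  intro ι T g f q W hq hW hg hf
  set lev : ι → ℕ := fun a => Nat.log 2 ⌊g a / q⌋₊ with hlev
  have hpow : ∀ i : ℕ, (q * 2 ^ i) ^ (1 - κ) = q ^ (1 - κ) * x ^ i := by
    intro i
    rw [Real.mul_rpow hq.le (by positivity), hx, ← Real.rpow_natCast, ← Real.rpow_natCast, ← Real.rpow_mul (by norm_num),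
      ← Real.rpow_mul (by norm_num), mul_comm (i : ℝ)]
  rw [← Finset.sum_fiberwise_of_maps_to (t := T.image lev) (g := lev) (fun a ha => Finset.mem_image_of_mem _ ha)]
  calc _ ≤ ∑ i ∈ T.image lev, W * q ^ (1 - κ) * x ^ i := by
        refine Finset.sum_le_sum fun i hi => ?_
        have e : T.filter (fun a => lev a = i) = T.filter (fun a => q * 2 ^ i ≤ g a ∧ g a < q * 2 ^ (i + 1)) := by
          refine Finset.filter_congr fun a ha => ?_
          have hs := log_spec q (g a) hq (hg a ha)
          constructor
          · rintro rfl; exact hs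
          · rintro ⟨h1, h2⟩
            have h3 : q * 2 ^ lev a < q * 2 ^ (i + 1) := hs.1.trans_lt h2
            have h4 : q * 2 ^ i < q * 2 ^ (lev a + 1) := h1.trans_lt hs.2
            have h5 := (pow_lt_pow_iff_right₀ (by norm_num : (1:ℝ) < 2)).1 (lt_of_mul_lt_mul_left h3 hq.le)
            have h6 := (pow_lt_pow_iff_right₀ (by norm_num : (1:ℝ) < 2)).1 (lt_of_mul_lt_mul_left h4 hq.le)
            omega
        rw [e, mul_assoc, ← hpow]
        exact hf i
    _ = W * q ^ (1 - κ) * ∑ i ∈ T.image lev, x ^ i := by rw [Finset.mul_sum]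
    _ ≤ W * q ^ (1 - κ) * (1 - x)⁻¹ := by
        gcongr
        rw [← tsum_geometric_of_lt_one hx0 hx1]
        exact (summable_geometric_of_lt_one hx0 hx1).sum_le_tsum _ (fun _ _ => by positivity)
    _ = _ := by ring

open Classical in
theorem overlap_count (d : ℕ) {ι : Type} (F : Finset ι) (y : ι → Ed d) (s : ℝ) (X : Set (Ed d)) (hX : MeasurableSet X)
    (hXf : volume X ≠ ⊤) (N : ℕ) (hs : 0 ≤ s)
    (h1 : ∀ a ∈ F, Metric.closedBall (y a) s ⊆ X)
    (h2 : ∀ x, (F.filter fun a => dist x (y a) ≤ s).card ≤ N) :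
    (F.card : ℝ) * (s ^ d * volume.real (Metric.ball (0 : Ed d) 1)) ≤ N * volume.real X := by
  have e1 : ∀ a : ι, volume (Metric.closedBall (y a) s) = ENNReal.ofReal (s ^ d * volume.real (Metric.ball (0 : Ed d) 1)) := by
    intro a
    rw [← ENNReal.ofReal_toReal (measure_closedBall_lt_top (x := y a) (r := s) (μ := volume)).ne]
    congr 1
    have := Measure.addHaar_real_closedBall (volume : Measure (Ed d)) (y a) hs
    simpa [measureReal_def] using this
  have h3 : ∑ a ∈ F, volume (Metric.closedBall (y a) s) ≤ N * volume X := by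
    calc _ = ∑ a ∈ F, ∫⁻ x, (Metric.closedBall (y a) s).indicator 1 x := by
          refine Finset.sum_congr rfl fun a _ => ?_
          rw [lintegral_indicator_one Metric.isClosed_closedBall.measurableSet]
      _ = ∫⁻ x, ∑ a ∈ F, (Metric.closedBall (y a) s).indicator 1 x := by
          rw [lintegral_finsetSum]
          intro a _
          exact measurable_one.indicator Metric.isClosed_closedBall.measurableSet
      _ ≤ ∫⁻ x, X.indicator (fun _ => (N : ℝ≥0∞)) x := by
          refine lintegral_mono fun x => ?_
          have e : ∑ a ∈ F, (Metric.closedBall (y a) s).indicator (1 : Ed d → ℝ≥0∞) x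
              = ((F.filter fun a => dist x (y a) ≤ s).card : ℝ≥0∞) := by
            rw [Finset.card_filter]
            push_cast
            refine Finset.sum_congr rfl fun a _ => ?_
            simp [Set.indicator_apply]
          show _ ≤ X.indicator (fun _ => (N : ℝ≥0∞)) x
          by_cases hx : x ∈ X
          · rw [Set.indicator_of_mem hx, e]
            exact_mod_cast h2 x
          · rw [Set.indicator_of_notMem hx, e, nonpos_iff_eq_zero, Nat.cast_eq_zero, Finset.card_eq_zero,
              Finset.filter_eq_empty_iff]
            intro a ha h
            exact hx (h1 a ha h)
      _ = _ := by rw [lintegral_indicator_const hX]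
  rw [Finset.sum_congr rfl (fun a _ => e1 a), Finset.sum_const, nsmul_eq_mul] at h3
  have h4 := ENNReal.toReal_mono (ENNReal.mul_ne_top (by simp) hXf) h3
  rw [ENNReal.toReal_mul, ENNReal.toReal_mul, ENNReal.toReal_ofReal (by positivity)] at h4
  simp only [ENNReal.toReal_natCast] at h4
  exact h4

theorem ann_measurable (d : ℕ) (y : Ed d) (s w : ℝ) : MeasurableSet (ann d y s w) := by
  have : IsClosed (ann d y s w) := isClosed_le (by fun_prop) (by fun_prop)
  exact this.measurableSet

open Classical in
theorem far_near (d : ℕ) (hd : 4 ≤ d) (c : ℝ) (hc : 1 ≤ c) : ∃ C : ℝ, 0 < C ∧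
    ∀ {ι : Type} (A : Finset ι) (y : ι → Ed d) (m : ι → ℕ) (L U R K : ℝ) (E : ι → ι → ℝ),
    1 ≤ L → 0 ≤ U → 4 * c * L ≤ R → U ≤ R ^ (((d : ℝ) - 1) / 2) → 0 ≤ K →
    (∀ a ∈ A, ∀ a' ∈ A, E a a' ≠ 0 → |(m a : ℝ) - m a'| ≤ dist (y a) (y a') + c * L ∧
      dist (y a) (y a') ≤ m a + m a' + c * L) →
    (∀ a ∈ A, ∀ a' ∈ A, c * L ≤ dist (y a) (y a') →
      E a a' ≤ K * L ^ (2 * d) * ((m a : ℝ) * m a') ^ (((d : ℝ) - 1) / 2) * dist (y a) (y a') ^ (-(((d : ℝ) - 1) / 2))) →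
    (∀ a ∈ A, ∀ ρ : ℝ, L ≤ ρ → ρ ≤ 200 * m a →
      L ^ d * ((A.filter fun a' => dist (y a') (y a) ≤ ρ ∧ |(m a' : ℝ) - m a| ≤ ρ ∧ m a ≤ 8 * m a').card : ℝ) ≤ U * ρ) →
    ∀ a ∈ A, ∑ a' ∈ A.filter (fun a' => (R ≤ m a' ∧ m a' + R ≤ m a) ∧ E a a' ≠ 0 ∧ m a ≤ 8 * m a'), E a a'
      ≤ C * (K * L ^ d * (m a : ℝ) ^ (d - 1) * R) := by
  set κ : ℝ := ((d : ℝ) - 1) / 2 with hκd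
  have hd' : (4 : ℝ) ≤ d := by exact_mod_cast hd
  have hκ : 1 < κ := by rw [hκd]; linarith
  obtain ⟨C, hC, H⟩ := dyadic_sum κ hκ
  refine ⟨C * 5 * 2 ^ (κ - 1), by positivity, ?_⟩
  intro ι A y m L U R K E hL hU hR hUR hK hsup hE hCH a ha
  have hcL : 0 < c * L := by positivity
  have hcL1 : L ≤ c * L := by nlinarith
  have hR0 : 0 < R := by linarith
  set T := A.filter (fun a' => (R ≤ m a' ∧ m a' + R ≤ m a) ∧ E a a' ≠ 0 ∧ m a ≤ 8 * m a') with hT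
  have hW : 0 ≤ 5 * (K * L ^ d * (m a : ℝ) ^ (d - 1)) * U := by positivity
  have hg : ∀ a' ∈ T, R / 2 ≤ dist (y a) (y a') := by
    intro a' ha'
    obtain ⟨h1, ⟨h2, h3⟩, h4, h5⟩ := by simpa only [hT, Finset.mem_filter] using ha'
    have := (abs_le.1 (hsup a ha a' h1 h4).1).2
    linarith
  have key := H T (fun a' => dist (y a) (y a')) (fun a' => E a a') (R / 2) _ (by linarith) hW hg ?_
  · refine key.trans ?_
    have e1 : (R / 2) ^ (1 - κ) = 2 ^ (κ - 1) * R ^ (1 - κ) := by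
      rw [Real.div_rpow hR0.le (by norm_num), div_eq_mul_inv, ← Real.rpow_neg (by norm_num), mul_comm]
      congr 2; ring
    have e2 : U * R ^ (1 - κ) ≤ R := by
      calc _ ≤ R ^ κ * R ^ (1 - κ) := by gcongr
        _ = R := by rw [← Real.rpow_add hR0]; simp
    rw [e1]
    calc _ = (C * 5 * 2 ^ (κ - 1)) * (K * L ^ d * (m a : ℝ) ^ (d - 1)) * (U * R ^ (1 - κ)) := by ring
      _ ≤ (C * 5 * 2 ^ (κ - 1)) * (K * L ^ d * (m a : ℝ) ^ (d - 1)) * R := by gcongr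
      _ = _ := by ring
  intro i
  set s : ℝ := R / 2 * 2 ^ i with hs
  have hs2 : R / 2 * 2 ^ (i + 1) = 2 * s := by rw [hs]; ring
  have hsR : R / 2 ≤ s := by
    rw [hs]; exact le_mul_of_one_le_right (by linarith) (one_le_pow₀ (by norm_num))
  have hs0 : 0 < s := by linarith
  rw [hs2]
  set F := T.filter (fun a' => s ≤ dist (y a) (y a') ∧ dist (y a) (y a') < 2 * s) with hF
  have hFm : ∀ a' ∈ F, a' ∈ A ∧ R ≤ m a' ∧ m a' + R ≤ m a ∧ E a a' ≠ 0 ∧ (m a : ℝ) ≤ 8 * m a' ∧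
      s ≤ dist (y a) (y a') ∧ dist (y a) (y a') < 2 * s := by
    intro a' ha'
    simp only [hF, hT, Finset.mem_filter] at ha'
    exact ⟨ha'.1.1, ha'.1.2.1.1, ha'.1.2.1.2, ha'.1.2.2.1, by exact_mod_cast ha'.1.2.2.2, ha'.2.1, ha'.2.2⟩
  rcases F.eq_empty_or_nonempty with h0 | ⟨a0, h0⟩
  · rw [h0, Finset.sum_empty]; positivity
  obtain ⟨p1, p2, p3, p4, p5, p6, p7⟩ := hFm a0 h0
  have hcount : L ^ d * (F.card : ℝ) ≤ U * (5 * s) := by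
    refine le_trans ?_ (hCH a0 p1 (5 * s) (by linarith) ?_)
    · refine mul_le_mul_of_nonneg_left ?_ (by positivity)
      rw [Nat.cast_le]
      refine Finset.card_le_card fun a' ha' => ?_
      obtain ⟨q1, q2, q3, q4, q5, q6, q7⟩ := hFm a' ha'
      have b1 := abs_le.1 (hsup a ha a' q1 q4).1
      have b2 := abs_le.1 (hsup a ha a0 p1 p4).1
      simp only [Finset.mem_filter]
      refine ⟨q1, ?_, ?_, ?_⟩
      · have := dist_triangle_left (y a') (y a0) (y a)
        linarith
      · rw [abs_le]; constructor <;> linarith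
      · have : (m a0 : ℝ) ≤ 8 * m a' := by linarith
        exact_mod_cast this
    · have := (hsup a ha a0 p1 p4).2
      linarith
  have hm0 : (0 : ℝ) ≤ m a := by positivity
  have hb : ∀ a' ∈ F, E a a' ≤ K * L ^ (2 * d) * (m a : ℝ) ^ (d - 1) * s ^ (-κ) := by
    intro a' ha'
    obtain ⟨q1, q2, q3, q4, q5, q6, q7⟩ := hFm a' ha'
    refine (hE a ha a' q1 (by linarith)).trans ?_
    have e1 : ((m a : ℝ) * m a') ^ κ ≤ (m a : ℝ) ^ (d - 1) := by
      calc ((m a : ℝ) * m a') ^ κ ≤ ((m a : ℝ) * m a) ^ κ := by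
            apply Real.rpow_le_rpow (by positivity) _ (by linarith)
            apply mul_le_mul_of_nonneg_left _ hm0
            linarith
        _ = (m a : ℝ) ^ (d - 1) := by
            rw [← sq, ← Real.rpow_natCast, ← Real.rpow_mul hm0, ← Real.rpow_natCast]
            congr 1
            rw [Nat.cast_sub (by omega)]; push_cast; rw [hκd]; ring
    have e2 : dist (y a) (y a') ^ (-κ) ≤ s ^ (-κ) :=
      Real.rpow_le_rpow_of_nonpos hs0 q6 (by linarith)
    have hk : 0 ≤ K * L ^ (2 * d) := by positivity
    refine mul_le_mul (mul_le_mul_of_nonneg_left e1 hk) e2 (by positivity) (by positivity)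
  calc _ ≤ ∑ a' ∈ F, K * L ^ (2 * d) * (m a : ℝ) ^ (d - 1) * s ^ (-κ) := Finset.sum_le_sum hb
    _ = (L ^ d * (F.card : ℝ)) * (K * L ^ d * (m a : ℝ) ^ (d - 1) * s ^ (-κ)) := by
        rw [Finset.sum_const, nsmul_eq_mul]; ring
    _ ≤ (U * (5 * s)) * (K * L ^ d * (m a : ℝ) ^ (d - 1) * s ^ (-κ)) := by gcongr
    _ = 5 * (K * L ^ d * (m a : ℝ) ^ (d - 1)) * U * (s ^ (1:ℝ) * s ^ (-κ)) := by rw [Real.rpow_one]; ring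
    _ = _ := by rw [← Real.rpow_add hs0]; rfl

open Classical in
theorem far_far (d : ℕ) (hd : 4 ≤ d) (c : ℝ) (hc : 1 ≤ c) : ∃ C : ℝ, 0 < C ∧
    ∀ {ι : Type} (A : Finset ι) (y : ι → Ed d) (m : ι → ℕ) (L U R K : ℝ) (E : ι → ι → ℝ),
    1 ≤ L → 0 ≤ U → 4 * c * L ≤ R → U ≤ R ^ (((d : ℝ) - 1) / 2) → 0 ≤ K →
    (∀ a ∈ A, ∀ a' ∈ A, E a a' ≠ 0 → |(m a : ℝ) - m a'| ≤ dist (y a) (y a') + c * L ∧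
      dist (y a) (y a') ≤ m a + m a' + c * L) →
    (∀ a ∈ A, ∀ a' ∈ A, c * L ≤ dist (y a) (y a') →
      E a a' ≤ K * L ^ (2 * d) * ((m a : ℝ) * m a') ^ (((d : ℝ) - 1) / 2) * dist (y a) (y a') ^ (-(((d : ℝ) - 1) / 2))) →
    (∀ a ∈ A, ∀ ρ : ℝ, L ≤ ρ → ρ ≤ 200 * m a →
      L ^ d * ((A.filter fun a' => dist (y a') (y a) ≤ ρ ∧ |(m a' : ℝ) - m a| ≤ ρ ∧ m a ≤ 8 * m a').card : ℝ) ≤ U * ρ) →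
    ∀ a ∈ A, ∑ a' ∈ A.filter (fun a' => (R ≤ m a' ∧ m a' + R ≤ m a) ∧ E a a' ≠ 0 ∧ ¬ m a ≤ 8 * m a'), E a a'
      ≤ C * (K * L ^ d * (m a : ℝ) ^ (d - 1) * R) := by
  set κ : ℝ := ((d : ℝ) - 1) / 2 with hκd
  have hd' : (4 : ℝ) ≤ d := by exact_mod_cast hd
  have hκ : 1 < κ := by rw [hκd]; linarith
  obtain ⟨C, hC, H⟩ := dyadic_sum κ hκ
  obtain ⟨Cv, hCv, HV⟩ := ann_vol d (by omega)
  set ω : ℝ := volume.real (Metric.ball (0 : Ed d) 1) with hω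
  have hω0 : 0 < ω := by
    rw [hω, measureReal_def]
    exact ENNReal.toReal_pos (Metric.measure_ball_pos _ _ one_pos).ne' measure_ball_lt_top.ne
  set C' : ℝ := 4 ^ κ * 8 * Cv * 2 ^ (d - 1) / ω with hC'
  have hC'0 : 0 < C' := by positivity
  refine ⟨C * C', by positivity, ?_⟩
  intro ι A y m L U R K E hL hU hR hUR hK hsup hE hCH a ha
  have hcL : 0 < c * L := by positivity
  have hcL1 : L ≤ c * L := by nlinarith
  have hR0 : 0 < R := by linarith
  set T := A.filter (fun a' => (R ≤ m a' ∧ m a' + R ≤ m a) ∧ E a a' ≠ 0 ∧ ¬ m a ≤ 8 * m a') with hT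
  have hW : 0 ≤ C' * (K * L ^ d * (m a : ℝ) ^ (d - 1)) * U := by positivity
  have hg : ∀ a' ∈ T, R ≤ m a' := by
    intro a' ha'
    exact (by simpa only [hT, Finset.mem_filter] using ha' : _ ∧ (_ ∧ _) ∧ _ ∧ _).2.1.1
  have key := H T (fun a' => (m a' : ℝ)) (fun a' => E a a') R _ hR0 hW hg ?_
  · refine key.trans ?_
    have e2 : U * R ^ (1 - κ) ≤ R := by
      calc _ ≤ R ^ κ * R ^ (1 - κ) := by gcongr
        _ = R := by rw [← Real.rpow_add hR0]; simp
    calc _ = (C * C') * (K * L ^ d * (m a : ℝ) ^ (d - 1)) * (U * R ^ (1 - κ)) := by ring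
      _ ≤ (C * C') * (K * L ^ d * (m a : ℝ) ^ (d - 1)) * R := by gcongr
      _ = _ := by ring
  intro i
  set s : ℝ := R * 2 ^ i with hs
  have hs2 : R * 2 ^ (i + 1) = 2 * s := by rw [hs]; ring
  have hsR : R ≤ s := by
    rw [hs]; exact le_mul_of_one_le_right (by linarith) (one_le_pow₀ (by norm_num))
  have hs0 : 0 < s := by linarith
  rw [hs2]
  set F := T.filter (fun a' => s ≤ (m a' : ℝ) ∧ (m a' : ℝ) < 2 * s) with hF
  have hFm : ∀ a' ∈ F, a' ∈ A ∧ R ≤ m a' ∧ m a' + R ≤ m a ∧ E a a' ≠ 0 ∧ 8 * (m a' : ℝ) < m a ∧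
      s ≤ (m a' : ℝ) ∧ (m a' : ℝ) < 2 * s := by
    intro a' ha'
    simp only [hF, hT, Finset.mem_filter] at ha'
    exact ⟨ha'.1.1, ha'.1.2.1.1, ha'.1.2.1.2, ha'.1.2.2.1, by exact_mod_cast (not_le.1 ha'.1.2.2.2), ha'.2.1, ha'.2.2⟩
  rcases F.eq_empty_or_nonempty with h0 | ⟨a0, h0⟩
  · rw [h0, Finset.sum_empty]; positivity
  obtain ⟨p1, p2, p3, p4, p5, p6, p7⟩ := hFm a0 h0
  have hm0 : (0 : ℝ) < m a := by linarith
  have hoc := overlap_count d F y s (ann d (y a) (m a) (4 * s)) (ann_measurable _ _ _ _)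
    (ne_top_of_le_ne_top (measure_closedBall_lt_top (x := y a) (r := (m a : ℝ) + 4 * s)).ne
      (measure_mono (ann_subset_ball _ _ _ _))) ⌊U * (2 * s) / L ^ d⌋₊ hs0.le ?_ ?_
  · have hN : (⌊U * (2 * s) / L ^ d⌋₊ : ℝ) ≤ U * (2 * s) / L ^ d := Nat.floor_le (by positivity)
    have hv : volume.real (ann d (y a) (m a) (4 * s)) ≤ Cv * (2 ^ (d - 1) * (m a : ℝ) ^ (d - 1)) * (4 * s) := by
      refine (HV _ _ _ hm0.le (by positivity)).trans ?_
      rw [← mul_pow]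
      gcongr
      linarith
    have hcount : (F.card : ℝ) ≤ (U * (2 * s) / L ^ d) * (Cv * (2 ^ (d - 1) * (m a : ℝ) ^ (d - 1)) * (4 * s)) / (s ^ d * ω) := by
      rw [le_div_iff₀ (by positivity)]
      exact hoc.trans (mul_le_mul hN hv (by positivity) (by positivity))
    have hb : ∀ a' ∈ F, E a a' ≤ K * L ^ (2 * d) * (4 ^ κ * s ^ κ) := by
      intro a' ha'
      obtain ⟨q1, q2, q3, q4, q5, q6, q7⟩ := hFm a' ha'
      have b1 := abs_le.1 (hsup a ha a' q1 q4).1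
      have hΔ : (m a : ℝ) / 2 ≤ dist (y a) (y a') := by linarith
      refine (hE a ha a' q1 (by linarith)).trans ?_
      rw [mul_assoc]
      refine mul_le_mul_of_nonneg_left ?_ (by positivity)
      calc ((m a : ℝ) * m a') ^ κ * dist (y a) (y a') ^ (-κ)
          ≤ ((m a : ℝ) * (2 * s)) ^ κ * ((m a : ℝ) / 2) ^ (-κ) := by
            refine mul_le_mul (Real.rpow_le_rpow (by positivity) ?_ (by linarith))
              (Real.rpow_le_rpow_of_nonpos (by positivity) hΔ (by linarith)) (by positivity) (by positivity)
            apply mul_le_mul_of_nonneg_left _ hm0.le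
            linarith
        _ = 4 ^ κ * s ^ κ := by
            rw [Real.rpow_neg (by positivity), ← div_eq_mul_inv, ← Real.div_rpow (by positivity) (by positivity),
              ← Real.mul_rpow (by norm_num) hs0.le]
            congr 1
            field_simp
            ring
    have epow : s ^ 2 / s ^ d * s ^ κ = s ^ (1 - κ) := by
      rw [← Real.rpow_natCast, ← Real.rpow_natCast, ← Real.rpow_sub hs0, ← Real.rpow_add hs0]
      congr 1
      push_cast
      rw [hκd]; ring
    calc _ ≤ ∑ a' ∈ F, K * L ^ (2 * d) * (4 ^ κ * s ^ κ) := Finset.sum_le_sum hb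
      _ = (F.card : ℝ) * (K * L ^ (2 * d) * (4 ^ κ * s ^ κ)) := by
          rw [Finset.sum_const, nsmul_eq_mul]
      _ ≤ _ * (K * L ^ (2 * d) * (4 ^ κ * s ^ κ)) := mul_le_mul_of_nonneg_right hcount (by positivity)
      _ = C' * (K * (L ^ (2 * d) / L ^ d) * (m a : ℝ) ^ (d - 1)) * U * (s ^ 2 / s ^ d * s ^ κ) := by
          rw [hC']; field_simp; ring
      _ = _ := by
          rw [epow, two_mul, pow_add, mul_div_assoc, div_self (by positivity), mul_one]
  · intro a' ha' x hx
    obtain ⟨q1, q2, q3, q4, q5, q6, q7⟩ := hFm a' ha'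
    have b1 := abs_le.1 (hsup a ha a' q1 q4).1
    have b2 := (hsup a ha a' q1 q4).2
    have hx' : dist x (y a') ≤ s := hx
    have b3 := dist_triangle x (y a') (y a)
    have b4 := dist_triangle_left (y a) (y a') x
    rw [dist_comm (y a') (y a)] at b3
    show |dist x (y a) - m a| ≤ 4 * s
    rw [abs_le]
    constructor <;> linarith
  · intro x
    rcases (F.filter fun a => dist x (y a) ≤ s).eq_empty_or_nonempty with h1 | ⟨a1, h1⟩
    · rw [h1]; simp
    rw [Finset.mem_filter] at h1
    obtain ⟨h1, hx1⟩ := h1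
    obtain ⟨p1, p2, p3, p4, p5, p6, p7⟩ := hFm a1 h1
    apply Nat.le_floor
    rw [le_div_iff₀ (by positivity), mul_comm]
    refine le_trans ?_ (hCH a1 p1 (2 * s) (by linarith) (by linarith))
    refine mul_le_mul_of_nonneg_left ?_ (by positivity)
    rw [Nat.cast_le]
    refine Finset.card_le_card fun a' ha' => ?_
    rw [Finset.mem_filter] at ha'
    obtain ⟨q1, q2, q3, q4, q5, q6, q7⟩ := hFm a' ha'.1
    simp only [Finset.mem_filter]
    refine ⟨q1, ?_, ?_, ?_⟩
    · have := dist_triangle_left (y a') (y a1) x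
      linarith [ha'.2]
    · rw [abs_le]; constructor <;> linarith
    · have : (m a1 : ℝ) ≤ 8 * m a' := by linarith
      exact_mod_cast this

section PartC4

open Classical in
theorem far_sum (d : ℕ) (hd : 4 ≤ d) (c : ℝ) (hc : 1 ≤ c) : ∃ C : ℝ, 0 < C ∧
    ∀ {ι : Type} (A : Finset ι) (y : ι → Ed d) (m : ι → ℕ) (L U R K : ℝ) (E : ι → ι → ℝ),
    1 ≤ L → 0 ≤ U → 4 * c * L ≤ R → U ≤ R ^ (((d : ℝ) - 1) / 2) → 0 ≤ K →
    (∀ a ∈ A, ∀ a' ∈ A, E a a' ≠ 0 → |(m a : ℝ) - m a'| ≤ dist (y a) (y a') + c * L ∧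
      dist (y a) (y a') ≤ m a + m a' + c * L) →
    (∀ a ∈ A, ∀ a' ∈ A, c * L ≤ dist (y a) (y a') →
      E a a' ≤ K * L ^ (2 * d) * ((m a : ℝ) * m a') ^ (((d : ℝ) - 1) / 2) * dist (y a) (y a') ^ (-(((d : ℝ) - 1) / 2))) →
    (∀ a ∈ A, ∀ ρ : ℝ, L ≤ ρ → ρ ≤ 200 * m a →
      L ^ d * ((A.filter fun a' => dist (y a') (y a) ≤ ρ ∧ |(m a' : ℝ) - m a| ≤ ρ ∧ m a ≤ 8 * m a').card : ℝ) ≤ U * ρ) →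
    ∀ a ∈ A, ∑ a' ∈ A.filter (fun a' => R ≤ m a' ∧ m a' + R ≤ m a), E a a'
      ≤ C * (K * L ^ d * (m a : ℝ) ^ (d - 1) * R) := by
  obtain ⟨C1, hC1, h1⟩ := far_near d hd c hc
  obtain ⟨C2, hC2, h2⟩ := far_far d hd c hc
  refine ⟨C1 + C2, by positivity, ?_⟩
  intro ι A y m L U R K E hL hU hR hUR hK hsup hE hCH a ha
  have k1 := h1 A y m L U R K E hL hU hR hUR hK hsup hE hCH a ha
  have k2 := h2 A y m L U R K E hL hU hR hUR hK hsup hE hCH a ha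
  have e0 : ∑ a' ∈ A.filter (fun a' => R ≤ m a' ∧ m a' + R ≤ m a), E a a' =
      ∑ a' ∈ (A.filter (fun a' => R ≤ m a' ∧ m a' + R ≤ m a)).filter (fun a' => E a a' ≠ 0), E a a' := by
    rw [Finset.sum_filter_ne_zero]
  rw [e0, ← Finset.sum_filter_add_sum_filter_not _ (fun a' => m a ≤ 8 * m a'), add_mul]
  refine add_le_add ?_ ?_
  · refine le_trans (le_of_eq ?_) k1
    congr 1
    ext a'; simp only [Finset.mem_filter]; tauto
  · refine le_trans (le_of_eq ?_) k2
    congr 1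
    ext a'; simp only [Finset.mem_filter]; tauto

theorem sum_norm_sq_le {H : Type} [NormedAddCommGroup H] {ι : Type} (s : Finset ι) (v : ι → H) :
    ‖∑ a ∈ s, v a‖ ^ 2 ≤ s.card * ∑ a ∈ s, ‖v a‖ ^ 2 :=
  (pow_le_pow_left₀ (norm_nonneg _) (norm_sum_le _ _) 2).trans sq_sum_le_card_mul_sum_sq

variable {H : Type} [NormedAddCommGroup H] [InnerProductSpace ℂ H]

open Classical in
theorem block_l2 {ι : Type} (B : Finset ι) (β : ι → ℕ) (v : ι → H) :
    ‖∑ a ∈ B, v a‖ ^ 2 ≤ ∑ j ∈ B.image β, ‖∑ a ∈ B.filter (fun a => β a = j), v a‖ ^ 2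
      + ∑ a ∈ B, ∑ a' ∈ B.filter (fun a' => β a' ≠ β a), ‖inner ℂ (v a) (v a')‖ := by
  have e : ∀ s : Finset ι, ∀ t : Finset ι, (inner ℂ (∑ a ∈ s, v a) (∑ a ∈ t, v a) : ℂ) = ∑ a ∈ s, ∑ a' ∈ t, inner ℂ (v a) (v a') := by
    intro s t
    rw [sum_inner]
    exact Finset.sum_congr rfl fun a _ => inner_sum _ _ _
  have e2 : ∀ s : Finset ι, ‖∑ a ∈ s, v a‖ ^ 2 = ∑ a ∈ s, ∑ a' ∈ s, RCLike.re (inner ℂ (v a) (v a')) := by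
    intro s
    rw [← inner_self_eq_norm_sq (𝕜 := ℂ), e, map_sum]
    exact Finset.sum_congr rfl fun a _ => map_sum _ _ _
  rw [e2 B]
  have : ∀ a ∈ B, ∑ a' ∈ B, RCLike.re (inner ℂ (v a) (v a')) ≤
      ∑ a' ∈ B.filter (fun a' => β a' = β a), RCLike.re (inner ℂ (v a) (v a')) +
      ∑ a' ∈ B.filter (fun a' => β a' ≠ β a), ‖inner ℂ (v a) (v a')‖ := by
    intro a ha
    rw [← Finset.sum_filter_add_sum_filter_not B (fun a' => β a' = β a)]
    gcongr
    exact RCLike.re_le_norm _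
  refine (Finset.sum_le_sum this).trans ?_
  rw [Finset.sum_add_distrib]
  refine add_le_add (le_of_eq ?_) le_rfl
  rw [← Finset.sum_fiberwise_of_maps_to (t := B.image β) (g := β) (fun a ha => Finset.mem_image_of_mem _ ha)]
  refine Finset.sum_congr rfl fun j hj => ?_
  rw [e2]
  refine Finset.sum_congr rfl fun a ha => ?_
  rw [(Finset.mem_filter.1 ha).2]

open Classical in
theorem within_block {ι : Type} (B : Finset ι) (m : ι → ℕ) (v : ι → H) (R j : ℕ) (hR : 0 < R) (K : ℝ) (w : ℕ → ℝ)
    (hj : ∀ a ∈ B, m a / R = j)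
    (H1 : ∀ T ⊆ B, ∀ n, (∀ a ∈ T, m a = n) → ‖∑ a ∈ T, v a‖ ^ 2 ≤ K * w n * T.card) :
    ‖∑ a ∈ B, v a‖ ^ 2 ≤ R * (K * ∑ a ∈ B, w (m a)) := by
  rw [← Finset.sum_fiberwise_of_maps_to (t := B.image m) (g := m) (fun a ha => Finset.mem_image_of_mem _ ha)]
  refine (sum_norm_sq_le _ _).trans ?_
  have hcard : (B.image m).card ≤ R := by
    have : B.image m ⊆ Finset.Ico (R * j) (R * j + R) := by
      intro n hn
      obtain ⟨a, ha, rfl⟩ := Finset.mem_image.1 hn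
      have h1 := hj a ha
      have h2 := Nat.div_add_mod (m a) R
      have h3 := Nat.mod_lt (m a) hR
      rw [h1] at h2
      simp only [Finset.mem_Ico]; omega
    simpa using Finset.card_le_card this
  have h2 : ∑ n ∈ B.image m, ‖∑ a ∈ B.filter (fun a => m a = n), v a‖ ^ 2 ≤ K * ∑ a ∈ B, w (m a) := by
    rw [← Finset.sum_fiberwise_of_maps_to (s := B) (t := B.image m) (g := m) (f := fun a => w (m a)) (fun a ha => Finset.mem_image_of_mem _ ha),
      Finset.mul_sum]
    refine Finset.sum_le_sum fun n hn => ?_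
    refine (H1 _ (Finset.filter_subset _ _) n (fun a ha => (Finset.mem_filter.1 ha).2)).trans (le_of_eq ?_)
    rw [Finset.sum_congr rfl (g := fun _ => w n) (fun a ha => by rw [(Finset.mem_filter.1 ha).2]), Finset.sum_const, nsmul_eq_mul]
    ring
  exact mul_le_mul (by exact_mod_cast hcard) h2 (by positivity) (by positivity)

open Classical in
theorem l2_block {ι : Type} (A B : Finset ι) (hBA : B ⊆ A) (m : ι → ℕ) (v : ι → H) (R : ℕ) (hR : 0 < R) (K : ℝ) (w : ℕ → ℝ) (C : ℝ)
    (hsep : ∀ a ∈ B, ∀ a' ∈ B, m a / R ≠ m a' / R → 1 ≤ m a / R ∧ (m a / R + 2 ≤ m a' / R ∨ m a' / R + 2 ≤ m a / R))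
    (H1 : ∀ T ⊆ B, ∀ n, (∀ a ∈ T, m a = n) → ‖∑ a ∈ T, v a‖ ^ 2 ≤ K * w n * T.card)
    (H2 : ∀ a ∈ A, ∑ a' ∈ A.filter (fun a' => (R : ℝ) ≤ m a' ∧ (m a' : ℝ) + R ≤ m a), ‖inner ℂ (v a) (v a')‖ ≤ C * (K * w (m a) * R)) :
    ‖∑ a ∈ B, v a‖ ^ 2 ≤ (1 + 2 * C) * (R * (K * ∑ a ∈ B, w (m a))) := by
  refine (block_l2 B (fun a => m a / R) v).trans ?_
  have p1 : ∑ j ∈ B.image (fun a => m a / R), ‖∑ a ∈ B.filter (fun a => m a / R = j), v a‖ ^ 2 ≤ R * (K * ∑ a ∈ B, w (m a)) := by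
    rw [← Finset.sum_fiberwise_of_maps_to (s := B) (t := B.image (fun a => m a / R)) (g := (fun a => m a / R))
      (f := fun a => w (m a)) (fun a ha => Finset.mem_image_of_mem _ ha), Finset.mul_sum, Finset.mul_sum]
    refine Finset.sum_le_sum fun j hj => ?_
    refine within_block _ m v R j hR K w (fun a ha => (Finset.mem_filter.1 ha).2) ?_
    intro T hT n
    exact H1 T (hT.trans (Finset.filter_subset _ _)) n
  set far : ι → ι → Prop := fun a a' => (R : ℝ) ≤ m a' ∧ (m a' : ℝ) + R ≤ m a with hfar
  have far_of : ∀ a ∈ B, ∀ a' ∈ B, m a' / R + 2 ≤ m a / R → 1 ≤ m a' / R → far a a' := by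
    intro a ha a' ha' h h1
    have e1 := Nat.div_add_mod (m a) R
    have e2 := Nat.div_add_mod (m a') R
    have e3 := Nat.mod_lt (m a') hR
    have e4 : R * (m a' / R + 2) ≤ R * (m a / R) := Nat.mul_le_mul_left _ h
    have e5 : R * 1 ≤ R * (m a' / R) := Nat.mul_le_mul_left _ h1
    rw [mul_add] at e4
    constructor
    · have : R ≤ m a' := by omega
      exact_mod_cast this
    · have : m a' + R ≤ m a := by omega
      exact_mod_cast this
  have p2 : ∑ a ∈ B, ∑ a' ∈ B.filter (fun a' => far a a'), ‖inner ℂ (v a) (v a')‖ ≤ C * (R * (K * ∑ a ∈ B, w (m a))) := by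
    calc _ ≤ ∑ a ∈ B, C * (K * w (m a) * R) := by
          refine Finset.sum_le_sum fun a ha => ?_
          refine le_trans ?_ (H2 a (hBA ha))
          refine Finset.sum_le_sum_of_subset_of_nonneg (Finset.filter_subset_filter _ hBA) (fun _ _ _ => norm_nonneg _)
      _ = _ := by
          rw [Finset.mul_sum, Finset.mul_sum, Finset.mul_sum]
          refine Finset.sum_congr rfl fun a _ => by ring
  have p3 : ∑ a ∈ B, ∑ a' ∈ B.filter (fun a' => m a' / R ≠ m a / R), ‖inner ℂ (v a) (v a')‖ ≤
      2 * ∑ a ∈ B, ∑ a' ∈ B.filter (fun a' => far a a'), ‖inner ℂ (v a) (v a')‖ := by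
    have e : ∑ a ∈ B, ∑ a' ∈ B.filter (fun a' => far a a'), ‖inner ℂ (v a) (v a')‖ =
        ∑ a ∈ B, ∑ a' ∈ B.filter (fun a' => far a' a), ‖inner ℂ (v a) (v a')‖ := by
      simp only [Finset.sum_filter]
      rw [Finset.sum_comm]
      refine Finset.sum_congr rfl fun a _ => Finset.sum_congr rfl fun a' _ => ?_
      rw [norm_inner_symm]
    rw [two_mul]
    nth_rewrite 2 [e]
    rw [← Finset.sum_add_distrib]
    refine Finset.sum_le_sum fun a ha => ?_
    simp only [Finset.sum_filter]
    rw [← Finset.sum_add_distrib]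
    refine Finset.sum_le_sum fun a' ha' => ?_
    have hn := norm_nonneg (inner ℂ (v a) (v a'))
    by_cases h : m a' / R ≠ m a / R
    · rw [if_pos h]
      obtain ⟨h1, h2⟩ := hsep a' ha' a ha h
      obtain ⟨h3, _⟩ := hsep a ha a' ha' (Ne.symm h)
      rcases h2 with h2 | h2
      · rw [if_pos (far_of a ha a' ha' h2 h1)]
        split_ifs <;> linarith
      · rw [if_pos (far_of a' ha' a ha h2 h3)]
        split_ifs <;> linarith
    · rw [if_neg h]
      split_ifs <;> linarith
  calc _ ≤ R * (K * ∑ a ∈ B, w (m a)) + 2 * (C * (R * (K * ∑ a ∈ B, w (m a)))) := by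
        refine add_le_add p1 (p3.trans ?_)
        linarith
    _ = _ := by ring

open Classical in
theorem l2_lemma (d : ℕ) (hd : 4 ≤ d) (c : ℝ) (hc : 1 ≤ c) : ∃ C : ℝ, 0 < C ∧
    ∀ {ι : Type} (A : Finset ι) (y : ι → Ed d) (m : ι → ℕ) (v : ι → H) (L U K : ℝ) (R : ℕ),
    1 ≤ L → 0 ≤ U → 4 * c * L ≤ R → U ≤ (R : ℝ) ^ (((d : ℝ) - 1) / 2) → 0 ≤ K →
    (∀ a ∈ A, ∀ a' ∈ A, inner ℂ (v a) (v a') ≠ 0 → |(m a : ℝ) - m a'| ≤ dist (y a) (y a') + c * L ∧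
      dist (y a) (y a') ≤ m a + m a' + c * L) →
    (∀ a ∈ A, ∀ a' ∈ A, c * L ≤ dist (y a) (y a') →
      ‖inner ℂ (v a) (v a')‖ ≤ K * L ^ (2 * d) * ((m a : ℝ) * m a') ^ (((d : ℝ) - 1) / 2) * dist (y a) (y a') ^ (-(((d : ℝ) - 1) / 2))) →
    (∀ a ∈ A, ∀ ρ : ℝ, L ≤ ρ → ρ ≤ 200 * m a →
      L ^ d * ((A.filter fun a' => dist (y a') (y a) ≤ ρ ∧ |(m a' : ℝ) - m a| ≤ ρ ∧ m a ≤ 8 * m a').card : ℝ) ≤ U * ρ) →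
    (∀ T ⊆ A, ∀ n, (∀ a ∈ T, m a = n) → ‖∑ a ∈ T, v a‖ ^ 2 ≤ K * (L ^ d * (n : ℝ) ^ (d - 1)) * T.card) →
    ‖∑ a ∈ A, v a‖ ^ 2 ≤ C * (R * (K * (L ^ d * ∑ a ∈ A, (m a : ℝ) ^ (d - 1)))) := by
  obtain ⟨C, hC, HF⟩ := far_sum d hd c hc
  refine ⟨3 * (1 + 2 * C), by positivity, ?_⟩
  intro ι A y m v L U K R hL hU hR hUR hK hsup hE hCH H1
  have hR0 : 0 < R := by
    have : (0 : ℝ) < R := lt_of_lt_of_le (by positivity) hR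
    exact_mod_cast this
  have F := HF A y m L U R K (fun a a' => ‖inner ℂ (v a) (v a')‖) hL hU hR hUR hK
    (fun a ha a' ha' h => hsup a ha a' ha' (norm_ne_zero_iff.1 h)) hE hCH
  set w : ℕ → ℝ := fun n => L ^ d * (n : ℝ) ^ (d - 1) with hw
  set cls : ι → Fin 3 := fun a => if m a / R = 0 then 0 else if m a / R % 2 = 0 then 1 else 2 with hcls
  have key : ∀ k : Fin 3, ‖∑ a ∈ A.filter (fun a => cls a = k), v a‖ ^ 2 ≤
      (1 + 2 * C) * (R * (K * ∑ a ∈ A.filter (fun a => cls a = k), w (m a))) := by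
    intro k
    refine l2_block A _ (Finset.filter_subset _ _) m v R hR0 K w C ?_ ?_ ?_
    · intro a ha a' ha' hne
      have h1 := (Finset.mem_filter.1 ha).2
      have h2 := (Finset.mem_filter.1 ha').2
      rw [← h2] at h1
      simp only [hcls] at h1
      generalize m a / R = k1 at *
      generalize m a' / R = k2 at *
      split_ifs at h1 <;> first | omega | exact absurd h1 (by decide)
    · intro T hT n
      exact H1 T (hT.trans (Finset.filter_subset _ _)) n
    · intro a ha
      have := F a ha
      refine this.trans (le_of_eq ?_)
      simp only [hw]; ring
  have e := Finset.sum_fiberwise A cls v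
  have e' := Finset.sum_fiberwise A cls (fun a => w (m a))
  have e'' : L ^ d * ∑ a ∈ A, (m a : ℝ) ^ (d - 1) = ∑ a ∈ A, w (m a) := by
    rw [Finset.mul_sum]
  rw [← e, e'', ← e']
  refine (sum_norm_sq_le _ _).trans ?_
  calc _ ≤ ((Finset.univ : Finset (Fin 3)).card : ℝ) * ∑ k, (1 + 2 * C) * (R * (K * ∑ a ∈ A.filter (fun a => cls a = k), w (m a))) := by
        refine mul_le_mul_of_nonneg_left (Finset.sum_le_sum fun k _ => key k) (by positivity)
    _ = _ := by
        rw [Finset.card_univ, Fintype.card_fin, ← Finset.mul_sum, ← Finset.mul_sum, ← Finset.mul_sum]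
        push_cast
        ring

end PartC4

/-- Abstract family of functions attached to annuli. -/
structure FSys (d : ℕ) (c K L : ℝ) {ι : Type} (S : Finset ι) (y : ι → Ed d) (m : ι → ℕ) (f : ι → Ed d → ℂ) : Prop where
  hL : 1 ≤ L
  hm : ∀ a ∈ S, L ≤ m a
  mem : ∀ a, MemLp (f a) 2 (volume : Measure (Ed d))
  supp : ∀ a x, f a x ≠ 0 → x ∈ ann d (y a) (m a) (c * L)
  same : ∀ T ⊆ S, ∀ n, (∀ a ∈ T, m a = n) → ∫ x, ‖∑ a ∈ T, f a x‖ ^ 2 ≤ K * (L ^ d * (n : ℝ) ^ (d - 1)) * T.card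
  inn : ∀ a ∈ S, ∀ a' ∈ S, c * L ≤ dist (y a) (y a') →
    ‖∫ x, inner ℂ (f a x) (f a' x)‖ ≤ K * L ^ (2 * d) * ((m a : ℝ) * m a') ^ (((d : ℝ) - 1) / 2) * dist (y a) (y a') ^ (-(((d : ℝ) - 1) / 2))

theorem FSys.mono {d : ℕ} {c K L : ℝ} {ι : Type} {S S' : Finset ι} {y : ι → Ed d} {m : ι → ℕ} {f : ι → Ed d → ℂ}
    (h : FSys d c K L S y m f) (hS : S' ⊆ S) : FSys d c K L S' y m f :=
  ⟨h.hL, fun a ha => h.hm a (hS ha), h.mem, h.supp, fun T hT => h.same T (hT.trans hS),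
    fun a ha a' ha' => h.inn a (hS ha) a' (hS ha')⟩

theorem inner_toLp {d : ℕ} (f g : Ed d → ℂ) (hf : MemLp f 2 (volume : Measure (Ed d))) (hg : MemLp g 2 (volume : Measure (Ed d))) :
    inner ℂ hf.toLp hg.toLp = ∫ x, inner ℂ (f x) (g x) := by
  rw [L2.inner_def]
  refine integral_congr_ae ?_
  filter_upwards [hf.coeFn_toLp, hg.coeFn_toLp] with x h1 h2
  rw [h1, h2]

theorem norm_sq_toLp {d : ℕ} (f : Ed d → ℂ) (hf : MemLp f 2 (volume : Measure (Ed d))) :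
    ‖hf.toLp‖ ^ 2 = ∫ x, ‖f x‖ ^ 2 := by
  have h := inner_toLp f f hf hf
  rw [inner_self_eq_norm_sq_to_K] at h
  have : (∫ x, inner ℂ (f x) (f x)) = (((∫ x, ‖f x‖ ^ 2 : ℝ)) : ℂ) := by
    rw [← integral_complex_ofReal]
    congr 1; ext x
    rw [inner_self_eq_norm_sq_to_K]; push_cast; rfl
  rw [this] at h
  refine Complex.ofReal_injective ?_
  rw [← h]; push_cast; rfl

theorem sum_toLp {d : ℕ} {ι : Type} (T : Finset ι) (f : ι → Ed d → ℂ) (hf : ∀ a, MemLp (f a) 2 (volume : Measure (Ed d))) :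
    ‖∑ a ∈ T, (hf a).toLp‖ ^ 2 = ∫ x, ‖∑ a ∈ T, f a x‖ ^ 2 := by
  have h : MemLp (fun x => ∑ a ∈ T, f a x) 2 (volume : Measure (Ed d)) := memLp_finsetSum T (fun a _ => hf a)
  have e : ∑ a ∈ T, (hf a).toLp = h.toLp := by
    classical
    revert h
    induction T using Finset.induction_on with
    | empty => intro h; simp only [Finset.sum_empty]; exact (MemLp.toLp_zero _).symm
    | insert a T ha ih =>
      intro h
      have hT : MemLp (fun x => ∑ a ∈ T, f a x) 2 (volume : Measure (Ed d)) := memLp_finsetSum T (fun a _ => hf a)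
      rw [Finset.sum_insert ha, ih hT, ← MemLp.toLp_add]
      congr 1
      ext x; simp [Finset.sum_insert ha]
  rw [e, norm_sq_toLp]

open Classical in
theorem fsys_l2 (d : ℕ) (hd : 4 ≤ d) (c K : ℝ) (hc : 1 ≤ c) (hK : 0 ≤ K) : ∃ C : ℝ, 0 < C ∧
    ∀ {ι : Type} (A : Finset ι) (y : ι → Ed d) (m : ι → ℕ) (f : ι → Ed d → ℂ) (L U : ℝ),
    FSys d c K L A y m f → L ^ (d - 1) ≤ U →
    (∀ a ∈ A, ∀ ρ : ℝ, L ≤ ρ → ρ ≤ 200 * m a →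
      L ^ d * ((A.filter fun a' => dist (y a') (y a) ≤ ρ ∧ |(m a' : ℝ) - m a| ≤ ρ ∧ m a ≤ 8 * m a').card : ℝ) ≤ U * ρ) →
    ∫ x, ‖∑ a ∈ A, f a x‖ ^ 2 ≤ C * (U ^ (2 / ((d : ℝ) - 1)) * (L ^ d * ∑ a ∈ A, (m a : ℝ) ^ (d - 1))) := by
  obtain ⟨C, hC, H⟩ := l2_lemma (H := Lp ℂ 2 (volume : Measure (Ed d))) d hd (2 * c) (by linarith)
  refine ⟨C * (9 * c * K + 1), by positivity, ?_⟩
  intro ι A y m f L U hS hU hCH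
  have hL := hS.hL
  have hd' : (4 : ℝ) ≤ d := by exact_mod_cast hd
  have hL1 : 1 ≤ L ^ (d - 1) := one_le_pow₀ hL
  have hU1 : 1 ≤ U := hL1.trans hU
  set X : ℝ := U ^ (2 / ((d : ℝ) - 1)) with hX
  have hX1 : 1 ≤ X := Real.one_le_rpow hU1 (by apply div_nonneg <;> linarith)
  have hXL : L ≤ X := by
    have : L ^ 2 ≤ X := by
      calc L ^ 2 = (L ^ (d - 1)) ^ (2 / ((d : ℝ) - 1)) := by
            rw [← Real.rpow_natCast, ← Real.rpow_natCast, ← Real.rpow_mul (by linarith)]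
            congr 1
            rw [Nat.cast_sub (by omega)]; push_cast
            field_simp [show (d : ℝ) - 1 ≠ 0 by linarith]
        _ ≤ X := Real.rpow_le_rpow (by positivity) hU (by apply div_nonneg <;> linarith)
    nlinarith
  have h8 : 0 ≤ 8 * c * X := by positivity
  have hR1 := Nat.le_ceil (8 * c * X)
  have hR2 := Nat.ceil_lt_add_one h8
  set R := ⌈8 * c * X⌉₊ with hR
  have := H A y m (fun a => (hS.mem a).toLp) L U K R hL (by linarith) ?_ ?_ hK ?_ ?_ hCH ?_
  · rw [sum_toLp] at this
    refine this.trans ?_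
    have hRX : (R : ℝ) ≤ 9 * c * X := by nlinarith
    have hV : 0 ≤ L ^ d * ∑ a ∈ A, (m a : ℝ) ^ (d - 1) := by positivity
    calc _ ≤ C * ((9 * c * X) * (K * (L ^ d * ∑ a ∈ A, (m a : ℝ) ^ (d - 1)))) := by
          gcongr
      _ = C * (9 * c * K) * (X * (L ^ d * ∑ a ∈ A, (m a : ℝ) ^ (d - 1))) := by ring
      _ ≤ C * (9 * c * K + 1) * (X * (L ^ d * ∑ a ∈ A, (m a : ℝ) ^ (d - 1))) := by
          have : 0 ≤ X * (L ^ d * ∑ a ∈ A, (m a : ℝ) ^ (d - 1)) := by positivity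
          apply mul_le_mul_of_nonneg_right _ this
          nlinarith
  · nlinarith
  · calc U = X ^ (((d : ℝ) - 1) / 2) := by
          rw [hX, ← Real.rpow_mul (by linarith)]
          field_simp [show (d : ℝ) - 1 ≠ 0 by linarith]
          rw [Real.rpow_one]
      _ ≤ _ := by
          apply Real.rpow_le_rpow (by positivity) _ (by linarith)
          nlinarith
  · intro a ha a' ha' hne
    rw [inner_toLp] at hne
    have : ∃ x, f a x ≠ 0 ∧ f a' x ≠ 0 := by
      by_contra hcon
      push Not at hcon
      apply hne
      rw [← integral_zero (Ed d) ℂ]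
      congr 1; ext x
      by_cases hx : f a x = 0
      · simp [hx]
      · simp [hcon x hx]
    obtain ⟨x, h1, h2⟩ := this
    have b1 : |dist x (y a) - m a| ≤ c * L := hS.supp a x h1
    have b2 : |dist x (y a') - m a'| ≤ c * L := hS.supp a' x h2
    have t1 := dist_triangle_left (y a) (y a') x
    have t2 := dist_triangle x (y a) (y a')
    have t3 := dist_triangle x (y a') (y a)
    rw [dist_comm (y a') (y a)] at t3
    rw [abs_le] at b1 b2
    refine ⟨?_, by linarith⟩
    rw [abs_le]; constructor <;> linarith
  · intro a ha a' ha' h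
    rw [inner_toLp]
    refine hS.inn a ha a' ha' (le_trans ?_ h)
    nlinarith
  · intro T hT n hn
    rw [sum_toLp]
    exact hS.same T hT n hn

theorem eLpNorm_two_le {d : ℕ} (g : Ed d → ℂ) (hg : MemLp g 2 (volume : Measure (Ed d))) (B : ℝ) (h : ∫ x, ‖g x‖ ^ 2 ≤ B) :
    eLpNorm g 2 volume ≤ ENNReal.ofReal (B ^ (1 / 2 : ℝ)) := by
  rw [hg.eLpNorm_eq_integral_rpow_norm (by norm_num) (by norm_num)]
  refine ENNReal.ofReal_le_ofReal ?_
  simp only [ENNReal.toReal_ofNat, Real.rpow_ofNat]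
  rw [one_div]
  exact Real.rpow_le_rpow (integral_nonneg fun _ => by positivity) h (by norm_num)

theorem eLpNorm_supp {d : ℕ} (q : ℝ) (hq0 : 0 < q) (hq2 : q ≤ 2) (g : Ed d → ℂ) (hg : MemLp g 2 (volume : Measure (Ed d)))
    (X : Set (Ed d)) (hX : MeasurableSet X) (hXf : volume X ≠ ⊤) (hs : ∀ x, g x ≠ 0 → x ∈ X)
    (B V : ℝ) (h : ∫ x, ‖g x‖ ^ 2 ≤ B) (hV : volume.real X ≤ V) :
    eLpNorm g (ENNReal.ofReal q) volume ≤ ENNReal.ofReal (B ^ (1 / 2 : ℝ) * V ^ (1 / q - 1 / 2)) := by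
  have e0 : X.indicator g = g := by
    rw [Set.indicator_eq_self]; intro x hx; exact hs x hx
  have hB : 0 ≤ B := (integral_nonneg fun _ => by positivity).trans h
  have hV0 : 0 ≤ V := measureReal_nonneg.trans hV
  have h2 : eLpNorm g (ENNReal.ofReal q) volume ≤ eLpNorm g 2 (volume.restrict X) * (volume.restrict X) Set.univ ^ (1 / q - 1 / 2) := by
    conv_lhs => rw [← e0, eLpNorm_indicator_eq_eLpNorm_restrict hX]
    have := eLpNorm_le_eLpNorm_mul_rpow_measure_univ (μ := volume.restrict X) (f := g) (p := ENNReal.ofReal q) (q := 2) ?_ hg.1.restrict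
    · rw [ENNReal.toReal_ofReal hq0.le] at this
      simpa using this
    · rw [← ENNReal.ofReal_ofNat]
      exact ENNReal.ofReal_le_ofReal (by simpa using hq2)
  refine h2.trans ?_
  rw [ENNReal.ofReal_mul (by positivity)]
  refine mul_le_mul' ((eLpNorm_mono_measure _ Measure.restrict_le_self).trans (eLpNorm_two_le g hg B h)) ?_
  have hexp : 0 ≤ 1 / q - 1 / 2 := by
    rw [sub_nonneg]; exact one_div_le_one_div_of_le hq0 hq2
  rw [Measure.restrict_apply_univ, ← ENNReal.ofReal_rpow_of_nonneg hV0 hexp]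
  refine ENNReal.rpow_le_rpow ?_ hexp
  rw [← ENNReal.ofReal_toReal hXf]
  exact ENNReal.ofReal_le_ofReal hV

open Classical in
theorem fsys_piece (d : ℕ) (hd : 4 ≤ d) (c K : ℝ) (hc : 1 ≤ c) (hK : 0 ≤ K) (q : ℝ) (hq0 : 1 ≤ q) (hq2 : q ≤ 2) : ∃ C : ℝ, 0 < C ∧
    ∀ {ι : Type} (S A : Finset ι) (_ : A ⊆ S) (y : ι → Ed d) (m : ι → ℕ) (f : ι → Ed d → ℂ) (L u : ℝ),
    FSys d c K L S y m f → L ^ (d - 1) ≤ u →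
    (∀ a ∈ A, ∃ ρ : ℝ, L ≤ ρ ∧ ρ ≤ 200 * m a ∧
      u * ρ ≤ L ^ d * ((S.filter fun a' => dist (y a') (y a) ≤ ρ ∧ |(m a' : ℝ) - m a| ≤ ρ ∧ m a ≤ 8 * m a').card : ℝ)) →
    (∀ a ∈ A, ¬ ∃ ρ : ℝ, L ≤ ρ ∧ ρ ≤ 200 * m a ∧
      (2 * u) * ρ ≤ L ^ d * ((S.filter fun a' => dist (y a') (y a) ≤ ρ ∧ |(m a' : ℝ) - m a| ≤ ρ ∧ m a ≤ 8 * m a').card : ℝ)) →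
    eLpNorm (fun x => ∑ a ∈ A, f a x) (ENNReal.ofReal q) volume ≤
      ENNReal.ofReal (C * u ^ (-(1 / q - ((d : ℝ) + 1) / (2 * d - 2))) * (L ^ d * ∑ a ∈ S, (m a : ℝ) ^ (d - 1)) ^ (1 / q)) := by
  obtain ⟨C1, hC1, H1⟩ := fsys_l2 d hd c K hc hK
  obtain ⟨C2, hC2, H2⟩ := support_lemma d (by omega) c hc
  have hd' : (4 : ℝ) ≤ d := by exact_mod_cast hd
  set e : ℝ := 2 / ((d : ℝ) - 1) with he
  refine ⟨(C1 * 2 ^ e) ^ (1 / 2 : ℝ) * C2 ^ (1 / q - 1 / 2), by positivity, ?_⟩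
  intro ι S A hAS y m f L u hS hu hP hnP
  have hL := hS.hL
  have hL1 : 1 ≤ L ^ (d - 1) := one_le_pow₀ hL
  have hu0 : 0 < u := by linarith
  have hSA := hS.mono hAS
  set V : ℝ := L ^ d * ∑ a ∈ S, (m a : ℝ) ^ (d - 1) with hV
  have hV0 : 0 ≤ V := by positivity
  have h1 := H1 A y m f L (2 * u) hSA (by linarith) (by
    intro a ha ρ hρ1 hρ2
    by_contra hcon
    refine hnP a ha ⟨ρ, hρ1, hρ2, ?_⟩
    refine (not_le.1 hcon).le.trans ?_
    refine mul_le_mul_of_nonneg_left ?_ (by positivity)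
    rw [Nat.cast_le]
    exact Finset.card_le_card (Finset.filter_subset_filter _ hAS))
  have hVA : L ^ d * ∑ a ∈ A, (m a : ℝ) ^ (d - 1) ≤ V := by
    refine mul_le_mul_of_nonneg_left ?_ (by positivity)
    exact Finset.sum_le_sum_of_subset_of_nonneg hAS (fun _ _ _ => by positivity)
  have h1' : ∫ x, ‖∑ a ∈ A, f a x‖ ^ 2 ≤ (C1 * 2 ^ e) * u ^ e * V := by
    refine h1.trans ?_
    rw [Real.mul_rpow (by norm_num) hu0.le]
    calc _ ≤ C1 * (2 ^ e * u ^ e * V) := by gcongr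
      _ = _ := by ring
  have h2 := H2 S A y m L u hL hu0 hP
  have hXm : MeasurableSet (⋃ a ∈ A, ann d (y a) (m a) (c * L)) :=
    Finset.measurableSet_biUnion _ fun a _ => ann_measurable _ _ _ _
  have hXf : volume (⋃ a ∈ A, ann d (y a) (m a) (c * L)) ≠ ⊤ := by
    refine ((measure_biUnion_finset_le _ _).trans_lt ?_).ne
    refine ENNReal.sum_lt_top.2 fun a _ => ?_
    exact (measure_mono (ann_subset_ball _ _ _ _)).trans_lt measure_closedBall_lt_top
  refine (eLpNorm_supp q (by linarith) hq2 _ (memLp_finsetSum A (fun a _ => hS.mem a)) _ hXm hXf ?_ _ _ h1' h2).trans ?_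
  · intro x hx
    obtain ⟨a, ha, hne⟩ := Finset.exists_ne_zero_of_sum_ne_zero hx
    exact Set.mem_biUnion ha (hS.supp a x hne)
  refine ENNReal.ofReal_le_ofReal (le_of_eq ?_)
  rcases hV0.eq_or_lt with h0 | hV0
  · rw [← h0]
    simp only [mul_zero]
    rw [Real.zero_rpow (by norm_num), Real.zero_rpow (by positivity)]
    simp
  rw [Real.mul_rpow (by positivity) hV0.le, Real.mul_rpow (by positivity) (by positivity),
    Real.mul_rpow (by positivity) hV0.le, Real.mul_rpow hC2.le (by positivity),
    ← Real.rpow_mul hu0.le, ← Real.rpow_neg_one, ← Real.rpow_mul hu0.le]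
  have e1 : u ^ (-(1 / q - ((d : ℝ) + 1) / (2 * d - 2))) = u ^ (e * (1 / 2)) * u ^ (-1 * (1 / q - 1 / 2)) := by
    rw [← Real.rpow_add hu0]
    congr 1
    rw [he]
    field_simp [show (d : ℝ) - 1 ≠ 0 by linarith, show 2 * (d : ℝ) - 2 ≠ 0 by linarith]
    ring
  have e2 : V ^ (1 / q) = V ^ (1 / 2 : ℝ) * V ^ (1 / q - 1 / 2) := by
    rw [← Real.rpow_add hV0]; congr 1; ring
  rw [e1, e2]; ring

open Classical in
theorem fsys_lq (d : ℕ) (hd : 4 ≤ d) (c K : ℝ) (hc : 1 ≤ c) (hK : 0 ≤ K) (q : ℝ) (hq0 : 1 ≤ q)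
    (hqd : ((d : ℝ) + 1) / (2 * d - 2) < 1 / q) : ∃ C : ℝ, 0 < C ∧
    ∀ {ι : Type} (S : Finset ι) (y : ι → Ed d) (m : ι → ℕ) (f : ι → Ed d → ℂ) (L : ℝ),
    FSys d c K L S y m f →
    eLpNorm (fun x => ∑ a ∈ S, f a x) (ENNReal.ofReal q) volume ≤
      ENNReal.ofReal (C * (L ^ (d - 1)) ^ (-(1 / q - ((d : ℝ) + 1) / (2 * d - 2))) * (L ^ d * ∑ a ∈ S, (m a : ℝ) ^ (d - 1)) ^ (1 / q)) := by
  have hd' : (4 : ℝ) ≤ d := by exact_mod_cast hd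
  have hq2 : q ≤ 2 := by
    by_contra hcon
    have h1 : 1 / q < 1 / 2 := one_div_lt_one_div_of_lt (by norm_num) (not_le.1 hcon)
    have h2 : (1:ℝ) / 2 ≤ ((d : ℝ) + 1) / (2 * d - 2) := by
      rw [div_le_div_iff₀ (by norm_num) (by linarith)]; linarith
    linarith
  obtain ⟨C, hC, H⟩ := fsys_piece d hd c K hc hK q hq0 hq2
  set δ : ℝ := 1 / q - ((d : ℝ) + 1) / (2 * d - 2) with hδ
  have hδ0 : 0 < δ := by linarith
  set x : ℝ := 2 ^ (-δ) with hx
  have hx0 : 0 ≤ x := by positivity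
  have hx1 : x < 1 := Real.rpow_lt_one_of_one_lt_of_neg (by norm_num) (by linarith)
  refine ⟨C * (1 - x)⁻¹, mul_pos hC (inv_pos.2 (by linarith)), ?_⟩
  intro ι S y m f L hS
  have hL := hS.hL
  set u0 : ℝ := L ^ (d - 1) with hu0
  have hu1 : 1 ≤ u0 := one_le_pow₀ hL
  set P : ι → ℝ → Prop := fun a u => ∃ ρ : ℝ, L ≤ ρ ∧ ρ ≤ 200 * m a ∧
      u * ρ ≤ L ^ d * ((S.filter fun a' => dist (y a') (y a) ≤ ρ ∧ |(m a' : ℝ) - m a| ≤ ρ ∧ m a ≤ 8 * m a').card : ℝ) with hP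
  obtain ⟨N, hN⟩ := pow_unbounded_of_one_lt (L ^ d * (S.card : ℝ)) (one_lt_two : (1:ℝ) < 2)
  have hPN : ∀ a, ¬ P a (u0 * 2 ^ N) := by
    rintro a ⟨ρ, h1, h2, h3⟩
    have h4 : L ^ d * ((S.filter fun a' => dist (y a') (y a) ≤ ρ ∧ |(m a' : ℝ) - m a| ≤ ρ ∧ m a ≤ 8 * m a').card : ℝ) ≤ L ^ d * (S.card : ℝ) := by
      refine mul_le_mul_of_nonneg_left ?_ (by positivity)
      rw [Nat.cast_le]
      exact Finset.card_le_card (Finset.filter_subset _ _)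
    have h5 : (2:ℝ) ^ N ≤ u0 * 2 ^ N * ρ := by
      have : 1 ≤ u0 * ρ := by nlinarith
      have h6 : (0:ℝ) < 2 ^ N := by positivity
      nlinarith
    linarith
  have hP0 : ∀ a ∈ S, P a (u0 * 2 ^ 0) := by
    intro a ha
    have hm := hS.hm a ha
    refine ⟨L, le_rfl, by linarith, ?_⟩
    have : u0 * 2 ^ 0 * L = L ^ d := by
      rw [hu0, pow_zero, mul_one, ← pow_succ]; congr 1; omega
    rw [this]
    refine le_mul_of_one_le_right (by positivity) ?_
    rw [Nat.one_le_cast, Nat.one_le_iff_ne_zero, Finset.card_ne_zero]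
    refine ⟨a, Finset.mem_filter.2 ⟨ha, ?_, ?_, by omega⟩⟩
    · simp; linarith
    · simp; linarith
  set n : ι → ℕ := fun a => Nat.findGreatest (fun k => P a (u0 * 2 ^ k)) N with hn
  have hnS : ∀ a ∈ S, P a (u0 * 2 ^ n a) := fun a ha =>
    Nat.findGreatest_spec (P := fun k => P a (u0 * 2 ^ k)) (Nat.zero_le N) (hP0 a ha)
  have hnN : ∀ a, n a ≤ N := fun a => Nat.findGreatest_le N
  have hnn : ∀ a ∈ S, ¬ P a (u0 * 2 ^ (n a + 1)) := by
    intro a ha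
    have h1 : n a < N := lt_of_le_of_ne (hnN a) (fun h => hPN a (h ▸ hnS a ha))
    exact Nat.findGreatest_is_greatest (P := fun k => P a (u0 * 2 ^ k)) (Nat.lt_succ_self _) h1
  set V : ℝ := L ^ d * ∑ a ∈ S, (m a : ℝ) ^ (d - 1) with hV
  have hV0 : 0 ≤ V := by positivity
  have e : (fun x => ∑ a ∈ S, f a x) = ∑ k ∈ Finset.range (N + 1), fun x => ∑ a ∈ S.filter (fun a => n a = k), f a x := by
    ext x
    rw [Finset.sum_apply, Finset.sum_fiberwise_of_maps_to]
    intro a _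
    exact Finset.mem_range.2 (Nat.lt_succ_of_le (hnN a))
  rw [e]
  refine (eLpNorm_sum_le (fun k _ => (memLp_finsetSum _ (fun a _ => hS.mem a)).1) (by simpa using hq0)).trans ?_
  calc _ ≤ ∑ k ∈ Finset.range (N + 1), ENNReal.ofReal (C * u0 ^ (-δ) * V ^ (1 / q) * x ^ k) := by
        refine Finset.sum_le_sum fun k _ => ?_
        have hk : 1 ≤ (2 : ℝ) ^ k := one_le_pow₀ (by norm_num)
        refine (H S (S.filter (fun a => n a = k)) (Finset.filter_subset _ _) y m f L (u0 * 2 ^ k) hS ?_ ?_ ?_).trans ?_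
        · nlinarith
        · intro a ha
          obtain ⟨h1, h2⟩ := Finset.mem_filter.1 ha
          have := hnS a h1
          rw [h2] at this
          exact this
        · intro a ha
          obtain ⟨h1, h2⟩ := Finset.mem_filter.1 ha
          have := hnn a h1
          rw [h2, pow_succ, show u0 * (2 ^ k * 2) = 2 * (u0 * 2 ^ k) by ring] at this
          exact this
        · refine ENNReal.ofReal_le_ofReal (le_of_eq ?_)
          have e3 : ((2 : ℝ) ^ k) ^ (-δ) = x ^ k := by
            rw [hx, ← Real.rpow_natCast, ← Real.rpow_natCast,
              ← Real.rpow_mul (by norm_num), ← Real.rpow_mul (by norm_num), mul_comm (k : ℝ)]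
          rw [Real.mul_rpow (by linarith) (by positivity), e3]
          ring
    _ = ENNReal.ofReal (∑ k ∈ Finset.range (N + 1), C * u0 ^ (-δ) * V ^ (1 / q) * x ^ k) := by
        rw [ENNReal.ofReal_sum_of_nonneg]
        intro k _; positivity
    _ ≤ _ := by
        refine ENNReal.ofReal_le_ofReal ?_
        rw [← Finset.mul_sum]
        have : ∑ k ∈ Finset.range (N + 1), x ^ k ≤ (1 - x)⁻¹ := by
          rw [← tsum_geometric_of_lt_one hx0 hx1]
          exact (summable_geometric_of_lt_one hx0 hx1).sum_le_tsum _ (fun _ _ => by positivity)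
        calc _ ≤ C * u0 ^ (-δ) * V ^ (1 / q) * (1 - x)⁻¹ := by gcongr
          _ = _ := by ring

theorem geo_int (x : ℝ) (hx0 : 0 ≤ x) (hx1 : x < 1) (J : Finset ℤ) (k : ℤ) :
    ∑ j ∈ J, x ^ (j - k).natAbs ≤ 2 * (1 - x)⁻¹ := by
  have h : ∀ T : Finset ℤ, Set.InjOn (fun j : ℤ => (j - k).natAbs) T → ∑ j ∈ T, x ^ (j - k).natAbs ≤ (1 - x)⁻¹ := by
    intro T hT
    rw [← Finset.sum_image (f := fun n => x ^ n) hT, ← tsum_geometric_of_lt_one hx0 hx1]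
    exact (summable_geometric_of_lt_one hx0 hx1).sum_le_tsum _ (fun _ _ => by positivity)
  rw [← Finset.sum_filter_add_sum_filter_not J (fun j => k ≤ j), two_mul]
  refine add_le_add (h _ ?_) (h _ ?_)
  · intro a ha b hb hab
    simp only [Finset.coe_filter, Set.mem_ofPred_eq] at ha hb
    simp only at hab
    omega
  · intro a ha b hb hab
    simp only [Finset.coe_filter, Set.mem_ofPred_eq] at ha hb
    simp only at hab
    omega

theorem ptwise_interp (p p1 : ℝ) (hp : 1 < p) (hp1 : p < p1) : ∃ C : ℝ, 0 < C ∧ ∀ (J : Finset ℤ) (a : ℤ → ℝ),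
    (∀ j, 0 ≤ a j) →
    (∑ j ∈ J, a j) ^ p ≤ C * ∑ j ∈ J, (a j * ((2 : ℝ) ^ j) ^ (p - 1) + a j ^ p1 * ((2 : ℝ) ^ j) ^ (p - p1)) := by
  set α : ℝ := p - 1 with hα
  set β : ℝ := 1 - p / p1 with hβ
  have hα0 : 0 < α := by linarith
  have hp10 : 0 < p1 := by linarith
  have hβ0 : 0 < β := by
    rw [hβ, sub_pos, div_lt_one hp10]; exact hp1
  set x : ℝ := 2 ^ (-(min α β)) with hx
  have hmin : 0 < min α β := lt_min hα0 hβ0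
  have hx0 : 0 < x := by positivity
  have hx1 : x < 1 := Real.rpow_lt_one_of_one_lt_of_neg (by norm_num) (by linarith)
  have h1x : 0 < (1 - x)⁻¹ := inv_pos.2 (by linarith)
  refine ⟨(2 ^ α * (2 * (1 - x)⁻¹)) ^ p, by positivity, ?_⟩
  intro J a ha
  set N : ℤ → ℝ := fun j => a j * ((2 : ℝ) ^ j) ^ (p - 1) + a j ^ p1 * ((2 : ℝ) ^ j) ^ (p - p1) with hN
  have hN1 : ∀ j, 0 ≤ a j * ((2 : ℝ) ^ j) ^ (p - 1) := fun j => mul_nonneg (ha j) (by positivity)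
  have hN2 : ∀ j, 0 ≤ a j ^ p1 * ((2 : ℝ) ^ j) ^ (p - p1) := fun j => mul_nonneg (Real.rpow_nonneg (ha j) _) (by positivity)
  have hN0 : ∀ j, 0 ≤ N j := fun j => add_nonneg (hN1 j) (hN2 j)
  set B : ℝ := ∑ j ∈ J, N j with hB
  have hB0 : 0 ≤ B := Finset.sum_nonneg fun j _ => hN0 j
  have hle : ∀ j ∈ J, N j ≤ B := fun j hj => Finset.single_le_sum (fun j _ => hN0 j) hj
  rcases hB0.eq_or_lt with h0 | hB0
  · have : ∑ j ∈ J, a j = 0 := by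
      refine Finset.sum_eq_zero fun j hj => ?_
      have h1 := hle j hj
      have h2 : a j * ((2 : ℝ) ^ j) ^ (p - 1) ≤ 0 := by
        have := hN2 j
        simp only [hN] at h1
        linarith
      have h3 : (0:ℝ) < ((2 : ℝ) ^ j) ^ (p - 1) := by positivity
      have := ha j
      nlinarith
    rw [this, ← h0, Real.zero_rpow (by linarith), mul_zero]
  set Λ : ℝ := B ^ (1 / p) with hΛ
  have hΛ0 : 0 < Λ := by positivity
  have hΛp : Λ ^ p = B := by
    rw [hΛ, ← Real.rpow_mul hB0.le, one_div_mul_cancel (by linarith), Real.rpow_one]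
  obtain ⟨k, hk1, hk2⟩ : ∃ k : ℤ, (2 : ℝ) ^ k ≤ Λ ∧ Λ < (2 : ℝ) ^ (k + 1) :=
    exists_mem_Ico_zpow hΛ0 one_lt_two
  have hx2 : ∀ n : ℕ, x ^ n = (2 : ℝ) ^ (-(min α β) * n) := by
    intro n
    rw [hx, ← Real.rpow_natCast, ← Real.rpow_mul (by norm_num)]
  have hterm : ∀ j ∈ J, a j ≤ Λ * (2 ^ α * x ^ (j - k).natAbs) := by
    intro j hj
    have hB1 := hle j hj
    set l : ℝ := (2 : ℝ) ^ j with hl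
    have hl0 : 0 < l := by positivity
    have b1 : a j * l ^ (p - 1) ≤ B := by
      have := hN2 j; simp only [hN] at hB1; linarith
    have b2 : a j ^ p1 * l ^ (p - p1) ≤ B := by
      have := hN1 j; simp only [hN] at hB1; linarith
    rcases le_or_gt k j with hkj | hkj
    · -- large `j`
      have hn : (((j - k).natAbs : ℕ) : ℝ) = (j : ℝ) - k := by
        have : (((j - k).natAbs : ℕ) : ℤ) = j - k := by omega
        rw [← Int.cast_natCast, this]; push_cast; ring
      have c1 : a j ≤ B * l ^ (-α) := by
        rw [Real.rpow_neg hl0.le, ← div_eq_mul_inv, le_div_iff₀ (by positivity)]; exact b1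
      have c2 : B = Λ * Λ ^ α := by
        rw [← hΛp, hα]
        nth_rewrite 2 [← Real.rpow_one Λ]
        rw [← Real.rpow_add hΛ0]; congr 1; ring
      have c3 : Λ ^ α ≤ 2 ^ α * ((2:ℝ) ^ k) ^ α := by
        rw [← Real.mul_rpow (by norm_num) (by positivity)]
        refine Real.rpow_le_rpow hΛ0.le ?_ hα0.le
        rw [zpow_add₀ (by norm_num), zpow_one] at hk2
        linarith
      refine c1.trans ?_
      rw [c2, mul_assoc]
      refine mul_le_mul_of_nonneg_left ?_ hΛ0.le
      calc Λ ^ α * l ^ (-α) ≤ (2 ^ α * ((2:ℝ) ^ k) ^ α) * l ^ (-α) := by gcongr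
        _ = 2 ^ α * (2:ℝ) ^ (-α * ((j - k).natAbs : ℕ)) := by
            rw [mul_assoc, hn, hl, ← Real.rpow_intCast, ← Real.rpow_intCast, ← Real.rpow_mul (by norm_num),
              ← Real.rpow_mul (by norm_num), ← Real.rpow_add (by norm_num)]
            congr 2; ring
        _ ≤ _ := by
            rw [hx2]
            refine mul_le_mul_of_nonneg_left ?_ (by positivity)
            refine Real.rpow_le_rpow_of_exponent_le (by norm_num) ?_
            have := min_le_left α β
            have h0 : (0:ℝ) ≤ ((j - k).natAbs : ℕ) := by positivity
            nlinarith
    · have hn : (((j - k).natAbs : ℕ) : ℝ) = (k : ℝ) - j := by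
        have : (((j - k).natAbs : ℕ) : ℤ) = k - j := by omega
        rw [← Int.cast_natCast, this]; push_cast; ring
      have c1 : a j ≤ Λ ^ (p / p1) * l ^ β := by
        have h1 : a j ^ p1 ≤ B * l ^ (p1 - p) := by
          rw [show p1 - p = -(p - p1) by ring, Real.rpow_neg hl0.le, ← div_eq_mul_inv, le_div_iff₀ (by positivity)]; exact b2
        have h2 : (a j ^ p1) ^ (1 / p1) = a j := by
          rw [← Real.rpow_mul (ha j), mul_one_div_cancel (by linarith), Real.rpow_one]
        rw [← h2]
        refine (Real.rpow_le_rpow (Real.rpow_nonneg (ha j) _) h1 (by positivity)).trans (le_of_eq ?_)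
        rw [Real.mul_rpow hB0.le (by positivity), ← hΛp, ← Real.rpow_mul hΛ0.le, ← Real.rpow_mul hl0.le, hβ]
        congr 2 <;> field_simp
      have c2 : Λ ^ (p / p1) = Λ * Λ ^ (-β) := by
        nth_rewrite 2 [← Real.rpow_one Λ]
        rw [← Real.rpow_add hΛ0, hβ]; congr 1; ring
      have c3 : Λ ^ (-β) ≤ ((2:ℝ) ^ k) ^ (-β) :=
        Real.rpow_le_rpow_of_nonpos (by positivity) hk1 (by linarith)
      refine c1.trans ?_
      rw [c2, mul_assoc]
      refine mul_le_mul_of_nonneg_left ?_ hΛ0.le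
      calc Λ ^ (-β) * l ^ β ≤ ((2:ℝ) ^ k) ^ (-β) * l ^ β := by gcongr
        _ = (2:ℝ) ^ (-β * ((j - k).natAbs : ℕ)) := by
            rw [hn, hl, ← Real.rpow_intCast, ← Real.rpow_intCast, ← Real.rpow_mul (by norm_num),
              ← Real.rpow_mul (by norm_num), ← Real.rpow_add (by norm_num)]
            congr 1; ring
        _ ≤ x ^ (j - k).natAbs := by
            rw [hx2]
            refine Real.rpow_le_rpow_of_exponent_le (by norm_num) ?_
            have := min_le_right α β
            have h0 : (0:ℝ) ≤ ((j - k).natAbs : ℕ) := by positivity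
            nlinarith
        _ ≤ _ := by
            refine le_mul_of_one_le_left (by positivity) ?_
            exact Real.one_le_rpow (by norm_num) hα0.le
  have hsum : ∑ j ∈ J, a j ≤ Λ * (2 ^ α * (2 * (1 - x)⁻¹)) := by
    refine (Finset.sum_le_sum hterm).trans ?_
    rw [← Finset.mul_sum, ← Finset.mul_sum]
    have := geo_int x hx0.le hx1 J k
    gcongr
  calc _ ≤ (Λ * (2 ^ α * (2 * (1 - x)⁻¹))) ^ p :=
        Real.rpow_le_rpow (Finset.sum_nonneg fun j _ => ha j) hsum (by linarith)
    _ = _ := by rw [Real.mul_rpow hΛ0.le (by positivity), hΛp]; ring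

theorem level_bound {d : ℕ} (q B lam : ℝ) (hq : 0 < q) (hB : 0 ≤ B) (hlam : 0 < lam) (G : Ed d → ℂ)
    (h : eLpNorm (fun x => (lam : ℂ)⁻¹ * G x) (ENNReal.ofReal q) volume ≤ ENNReal.ofReal B) :
    ∫⁻ x, ‖G x‖ₑ ^ q ≤ ENNReal.ofReal ((lam * B) ^ q) := by
  have e : G = (lam : ℂ) • (fun x => (lam : ℂ)⁻¹ * G x) := by
    ext x
    have : (lam : ℂ) ≠ 0 := by exact_mod_cast hlam.ne'
    simp [this]
  have h1 : eLpNorm G (ENNReal.ofReal q) volume ≤ ENNReal.ofReal (lam * B) := by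
    rw [e, eLpNorm_const_smul, ENNReal.ofReal_mul hlam.le]
    refine mul_le_mul' (le_of_eq ?_) h
    rw [← ofReal_norm, Complex.norm_real, Real.norm_of_nonneg hlam.le]
  rw [eLpNorm_eq_lintegral_rpow_enorm_toReal (by simpa using hq) (by simp), ENNReal.toReal_ofReal hq.le] at h1
  have h2 := ENNReal.rpow_le_rpow h1 hq.le
  rw [← ENNReal.rpow_mul, one_div_mul_cancel hq.ne', ENNReal.rpow_one, ENNReal.ofReal_rpow_of_nonneg (by positivity) hq.le] at h2
  exact h2

open Classical in
theorem fsys_interp (d : ℕ) (hd : 4 ≤ d) (c K : ℝ) (hc : 1 ≤ c) (hK : 0 ≤ K) (p p1 : ℝ) (hp : 1 < p) (hp1 : p < p1)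
    (hqd : ((d : ℝ) + 1) / (2 * d - 2) < 1 / p1) : ∃ C : ℝ, 0 < C ∧
    ∀ {ι : Type} (S : Finset ι) (y : ι → Ed d) (m : ι → ℕ) (g : ι → Ed d → ℂ) (γ : ι → ℝ) (L : ℝ),
    1 ≤ L → (∀ a ∈ S, 0 < γ a) →
    (∀ S' ⊆ S, ∀ lam : ℝ, 0 < lam → (∀ a ∈ S', γ a ≤ lam) → FSys d c K L S' y m (fun a x => (lam : ℂ)⁻¹ * g a x)) →
    ∫⁻ x, ‖∑ a ∈ S, g a x‖ₑ ^ p ≤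
      ENNReal.ofReal (C * ((L ^ (d - 1)) ^ (-(1 / p1 - ((d : ℝ) + 1) / (2 * d - 2)))) ^ p *
        (L ^ d * ∑ a ∈ S, γ a ^ p * (m a : ℝ) ^ (d - 1))) := by
  have hp10 : 0 < p1 := by linarith
  have h1p1 : 1 / p1 ≤ 1 / 1 := one_div_le_one_div_of_le (by norm_num) (by linarith)
  obtain ⟨C0, hC0, HP⟩ := ptwise_interp p p1 hp hp1
  obtain ⟨C1, hC1, H1⟩ := fsys_lq d hd c K hc hK 1 le_rfl (by linarith)
  obtain ⟨C2, hC2, H2⟩ := fsys_lq d hd c K hc hK p1 (by linarith) hqd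
  set θ : ℝ := ((d : ℝ) + 1) / (2 * d - 2) with hθ
  refine ⟨C0 * (2 * C1 + (2 * C2) ^ p1), by positivity, ?_⟩
  intro ι S y m g γ L hL hγ HS
  set M : ℝ := (L ^ (d - 1)) ^ (-(1 / p1 - θ)) with hM
  have hu1 : 1 ≤ L ^ (d - 1) := one_le_pow₀ hL
  have hM0 : 0 < M := by positivity
  have hmeas : ∀ a, AEStronglyMeasurable (g a) volume := by
    intro a
    have := ((HS ∅ (by simp) 1 one_pos (by simp)).mem a).1
    simpa using this
  set lev : ι → ℤ := fun a => Int.log 2 (γ a) with hlev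
  have lev1 : ∀ a ∈ S, (2 : ℝ) ^ lev a ≤ γ a := fun a ha => by
    simpa using Int.zpow_log_le_self (b := 2) one_lt_two (hγ a ha)
  have lev2 : ∀ a ∈ S, γ a ≤ (2 : ℝ) ^ (lev a + 1) := fun a ha => by
    have := Int.lt_zpow_succ_log_self (b := 2) one_lt_two (γ a)
    simpa using this.le
  set J := S.image lev with hJ
  set Sj : ℤ → Finset ι := fun j => S.filter (fun a => lev a = j) with hSj
  set V : ℤ → ℝ := fun j => L ^ d * ∑ a ∈ Sj j, (m a : ℝ) ^ (d - 1) with hV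
  have hV0 : ∀ j, 0 ≤ V j := fun j => by positivity
  set G : ℤ → Ed d → ℂ := fun j x => ∑ a ∈ Sj j, g a x with hG
  have hGm : ∀ j, AEStronglyMeasurable (G j) volume := fun j => Finset.aestronglyMeasurable_fun_sum _ fun a _ => hmeas a
  have hFS : ∀ j, FSys d c K L (Sj j) y m (fun a x => ((2 * (2:ℝ) ^ j : ℝ) : ℂ)⁻¹ * g a x) := by
    intro j
    refine HS _ (Finset.filter_subset _ _) _ (by positivity) ?_
    intro a ha
    obtain ⟨h1, h2⟩ := Finset.mem_filter.1 ha
    have := lev2 a h1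
    rw [h2, zpow_add₀ (by norm_num), zpow_one] at this
    linarith
  have hGe : ∀ j, (fun x => ∑ a ∈ Sj j, ((2 * (2:ℝ) ^ j : ℝ) : ℂ)⁻¹ * g a x) = fun x => ((2 * (2:ℝ) ^ j : ℝ) : ℂ)⁻¹ * G j x := by
    intro j; ext x; rw [hG, Finset.mul_sum]
  have B1 : ∀ j, ∫⁻ x, ‖G j x‖ₑ ≤ ENNReal.ofReal ((2 * C1) * M * (2:ℝ) ^ j * V j) := by
    intro j
    have h := H1 (Sj j) y m _ L (hFS j)
    rw [hGe] at h
    have h2 := level_bound 1 _ (2 * (2:ℝ) ^ j) one_pos (by positivity) (by positivity) (G j) h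
    simp only [ENNReal.rpow_one, Real.rpow_one, div_one] at h2
    refine h2.trans (ENNReal.ofReal_le_ofReal ?_)
    have h3 : (L ^ (d - 1)) ^ (-(1 - θ)) ≤ M := by
      refine Real.rpow_le_rpow_of_exponent_le hu1 ?_
      linarith
    calc _ ≤ 2 * (2:ℝ) ^ j * (C1 * M * V j) := by
          have := hV0 j
          gcongr
      _ = _ := by ring
  have B2 : ∀ j, ∫⁻ x, ‖G j x‖ₑ ^ p1 ≤ ENNReal.ofReal ((2 * C2) ^ p1 * M ^ p1 * ((2:ℝ) ^ j) ^ p1 * V j) := by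
    intro j
    have h := H2 (Sj j) y m _ L (hFS j)
    rw [hGe] at h
    have h2 := level_bound p1 _ (2 * (2:ℝ) ^ j) hp10 (by positivity) (by positivity) (G j) h
    refine h2.trans (ENNReal.ofReal_le_ofReal (le_of_eq ?_))
    have e : (V j ^ (1 / p1)) ^ p1 = V j := by
      rw [← Real.rpow_mul (hV0 j), one_div_mul_cancel hp10.ne', Real.rpow_one]
    have e2 : 2 * (2:ℝ) ^ j * (C2 * M * V j ^ (1 / p1)) = (2 * C2) * M * (2:ℝ) ^ j * V j ^ (1 / p1) := by ring
    rw [e2, Real.mul_rpow (by positivity) (by have := hV0 j; positivity), e, Real.mul_rpow (by positivity) (by positivity),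
      Real.mul_rpow (by positivity) (by positivity)]
  set k1 : ℤ → ℝ := fun j => M ^ p * C0 * M⁻¹ * ((2:ℝ) ^ j) ^ (p - 1) with hk1
  set k2 : ℤ → ℝ := fun j => M ^ p * C0 * M ^ (-p1) * ((2:ℝ) ^ j) ^ (p - p1) with hk2
  have hk10 : ∀ j, 0 ≤ k1 j := fun j => by positivity
  have hk20 : ∀ j, 0 ≤ k2 j := fun j => by positivity
  have pt : ∀ x, ‖∑ a ∈ S, g a x‖ₑ ^ p ≤ ∑ j ∈ J, (ENNReal.ofReal (k1 j) * ‖G j x‖ₑ + ENNReal.ofReal (k2 j) * ‖G j x‖ₑ ^ p1) := by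
    intro x
    have e : ∑ a ∈ S, g a x = ∑ j ∈ J, G j x :=
      (Finset.sum_fiberwise_of_maps_to (fun a ha => Finset.mem_image_of_mem _ ha) _).symm
    have h1 := HP J (fun j => M⁻¹ * ‖G j x‖) (fun j => by positivity)
    have h2 : ‖∑ a ∈ S, g a x‖ ^ p ≤ ∑ j ∈ J, (k1 j * ‖G j x‖ + k2 j * ‖G j x‖ ^ p1) := by
      calc ‖∑ a ∈ S, g a x‖ ^ p ≤ (M * ∑ j ∈ J, M⁻¹ * ‖G j x‖) ^ p := by
            refine Real.rpow_le_rpow (norm_nonneg _) ?_ (by linarith)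
            rw [← Finset.mul_sum, ← mul_assoc, mul_inv_cancel₀ hM0.ne', one_mul, e]
            exact norm_sum_le _ _
        _ = M ^ p * (∑ j ∈ J, M⁻¹ * ‖G j x‖) ^ p := by
            rw [Real.mul_rpow hM0.le (Finset.sum_nonneg fun j _ => by positivity)]
        _ ≤ M ^ p * (C0 * ∑ j ∈ J, (M⁻¹ * ‖G j x‖ * ((2 : ℝ) ^ j) ^ (p - 1) + (M⁻¹ * ‖G j x‖) ^ p1 * ((2 : ℝ) ^ j) ^ (p - p1))) := by
            gcongr
        _ = _ := by
            rw [← mul_assoc, Finset.mul_sum]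
            refine Finset.sum_congr rfl fun j _ => ?_
            rw [Real.mul_rpow (by positivity) (by positivity), Real.inv_rpow hM0.le, ← Real.rpow_neg hM0.le]
            simp only [hk1, hk2]; ring
    rw [← ofReal_norm, ENNReal.ofReal_rpow_of_nonneg (norm_nonneg _) (by linarith)]
    refine (ENNReal.ofReal_le_ofReal h2).trans ?_
    rw [ENNReal.ofReal_sum_of_nonneg (fun j _ => by have := hk10 j; have := hk20 j; positivity)]
    refine Finset.sum_le_sum fun j _ => ?_
    have := hk10 j; have := hk20 j
    rw [ENNReal.ofReal_add (by positivity) (by positivity), ENNReal.ofReal_mul (hk10 j), ENNReal.ofReal_mul (hk20 j),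
      ← ofReal_norm, ENNReal.ofReal_rpow_of_nonneg (norm_nonneg _) hp10.le]
  have fin : ∀ j ∈ J, ∫⁻ x, (ENNReal.ofReal (k1 j) * ‖G j x‖ₑ + ENNReal.ofReal (k2 j) * ‖G j x‖ₑ ^ p1) ≤
      ENNReal.ofReal (C0 * (2 * C1 + (2 * C2) ^ p1) * M ^ p * (L ^ d * ∑ a ∈ Sj j, γ a ^ p * (m a : ℝ) ^ (d - 1))) := by
    intro j _
    have hGj : AEMeasurable (fun x => ‖G j x‖ₑ) volume := (hGm j).enorm
    rw [lintegral_add_left' (hGj.const_mul _), lintegral_const_mul'' _ hGj, lintegral_const_mul'' _ (hGj.pow_const _)]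
    refine (add_le_add (mul_le_mul_right (B1 j) _) (mul_le_mul_right (B2 j) _)).trans ?_
    have := hV0 j
    rw [← ENNReal.ofReal_mul (hk10 j), ← ENNReal.ofReal_mul (hk20 j), ← ENNReal.ofReal_add
      (mul_nonneg (hk10 j) (by positivity)) (mul_nonneg (hk20 j) (by positivity))]
    refine ENNReal.ofReal_le_ofReal ?_
    have hl : (0:ℝ) < (2:ℝ) ^ j := by positivity
    have e1 : ((2:ℝ) ^ j) ^ (p - 1) * (2:ℝ) ^ j = ((2:ℝ) ^ j) ^ p := by
      nth_rewrite 2 [← Real.rpow_one ((2:ℝ) ^ j)]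
      rw [← Real.rpow_add hl]; congr 1; ring
    have e2 : ((2:ℝ) ^ j) ^ (p - p1) * ((2:ℝ) ^ j) ^ p1 = ((2:ℝ) ^ j) ^ p := by
      rw [← Real.rpow_add hl]; congr 1; ring
    have e3 : M ^ (-p1) * M ^ p1 = 1 := by
      rw [← Real.rpow_add hM0]; simp
    have e4 : ((2:ℝ) ^ j) ^ p * V j ≤ L ^ d * ∑ a ∈ Sj j, γ a ^ p * (m a : ℝ) ^ (d - 1) := by
      simp only [hV]
      rw [mul_left_comm, Finset.mul_sum]
      refine mul_le_mul_of_nonneg_left (Finset.sum_le_sum fun a ha => ?_) (by positivity)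
      obtain ⟨h1, h2⟩ := Finset.mem_filter.1 ha
      have := lev1 a h1
      rw [h2] at this
      gcongr
    calc k1 j * ((2 * C1) * M * (2:ℝ) ^ j * V j) + k2 j * ((2 * C2) ^ p1 * M ^ p1 * ((2:ℝ) ^ j) ^ p1 * V j)
        = C0 * M ^ p * V j * (2 * C1 * (M⁻¹ * M) * (((2:ℝ) ^ j) ^ (p - 1) * (2:ℝ) ^ j) +
          (2 * C2) ^ p1 * (M ^ (-p1) * M ^ p1) * (((2:ℝ) ^ j) ^ (p - p1) * ((2:ℝ) ^ j) ^ p1)) := by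
            simp only [hk1, hk2]; ring
      _ = C0 * (2 * C1 + (2 * C2) ^ p1) * M ^ p * (((2:ℝ) ^ j) ^ p * V j) := by
            rw [e1, e2, e3, inv_mul_cancel₀ hM0.ne']; ring
      _ ≤ _ := by gcongr
  calc _ ≤ ∫⁻ x, ∑ j ∈ J, (ENNReal.ofReal (k1 j) * ‖G j x‖ₑ + ENNReal.ofReal (k2 j) * ‖G j x‖ₑ ^ p1) := lintegral_mono pt
    _ = ∑ j ∈ J, ∫⁻ x, (ENNReal.ofReal (k1 j) * ‖G j x‖ₑ + ENNReal.ofReal (k2 j) * ‖G j x‖ₑ ^ p1) := by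
        rw [lintegral_finsetSum']
        intro j _
        have hGj : AEMeasurable (fun x => ‖G j x‖ₑ) volume := (hGm j).enorm
        exact (hGj.const_mul _).add ((hGj.pow_const _).const_mul _)
    _ ≤ ∑ j ∈ J, ENNReal.ofReal (C0 * (2 * C1 + (2 * C2) ^ p1) * M ^ p * (L ^ d * ∑ a ∈ Sj j, γ a ^ p * (m a : ℝ) ^ (d - 1))) :=
        Finset.sum_le_sum fin
    _ = _ := by
        rw [← ENNReal.ofReal_sum_of_nonneg]
        · congr 1
          rw [← Finset.mul_sum, ← Finset.mul_sum]
          congr 2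
          exact Finset.sum_fiberwise_of_maps_to (fun a ha => Finset.mem_image_of_mem _ ha) _
        · intro j _
          have : 0 ≤ ∑ a ∈ Sj j, γ a ^ p * (m a : ℝ) ^ (d - 1) := Finset.sum_nonneg fun a ha =>
            mul_nonneg (Real.rpow_nonneg (hγ a (Finset.mem_filter.1 ha).1).le _) (by positivity)
          positivity

theorem wcube_meas (d : ℕ) (ν : ℤ) (z : Fin d → ℤ) : MeasurableSet (Wcube d ν z) := by
  have : Wcube d ν z = ⋂ i, (fun x : Ed d => x i) ⁻¹' Set.Ico ((z i : ℝ) * 2 ^ ν) (((z i : ℝ) + 1) * 2 ^ ν) := by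
    ext x; simp [Wcube]
  rw [this]
  refine MeasurableSet.iInter fun i => ?_
  exact measurableSet_preimage (by fun_prop) measurableSet_Ico

theorem wcube_vol (d ℓ : ℕ) (z : Fin d → ℤ) : volume (Wcube d (ℓ : ℤ) z) = ENNReal.ofReal (((2 : ℝ) ^ ℓ) ^ d) := by
  have h := (EuclideanSpace.volume_preserving_symm_measurableEquiv_toLp (Fin d)).measure_preimage
    (s := Set.pi univ fun i => Set.Ico ((z i : ℝ) * 2 ^ ℓ) (((z i : ℝ) + 1) * 2 ^ ℓ))
    (MeasurableSet.univ_pi fun i => measurableSet_Ico).nullMeasurableSet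
  have e : Wcube d (ℓ : ℤ) z = (MeasurableEquiv.toLp 2 (Fin d → ℝ)).symm ⁻¹' (Set.pi univ fun i => Set.Ico ((z i : ℝ) * 2 ^ ℓ) (((z i : ℝ) + 1) * 2 ^ ℓ)) := by
    ext x
    simp only [Wcube, Set.mem_ofPred_eq, zpow_natCast, Set.mem_preimage, Set.mem_pi, Set.mem_univ, true_implies]
    rfl
  rw [e, h, Real.volume_pi_Ico]
  have : ∀ i, ((z i : ℝ) + 1) * 2 ^ ℓ - (z i : ℝ) * 2 ^ ℓ = 2 ^ ℓ := fun i => by ring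
  simp only [this, Finset.prod_const, Finset.card_univ, Fintype.card_fin]
  rw [ENNReal.ofReal_pow (p := (2:ℝ)^ℓ) (by positivity) d]

theorem wcube_mem_iff (d ℓ : ℕ) (z : Fin d → ℤ) (x : Ed d) :
    x ∈ Wcube d (ℓ : ℤ) z ↔ ∀ i, z i = ⌊x i / 2 ^ ℓ⌋ := by
  simp only [Wcube, Set.mem_ofPred_eq, zpow_natCast, Set.mem_Ico]
  refine forall_congr' fun i => ?_
  rw [eq_comm, Int.floor_eq_iff, le_div_iff₀ (by positivity), div_lt_iff₀ (by positivity)]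

theorem wcube_disj (d ℓ : ℕ) (z z' : Fin d → ℤ) (x : Ed d) (h : x ∈ Wcube d (ℓ : ℤ) z) (h' : x ∈ Wcube d (ℓ : ℤ) z') :
    z = z' := by
  rw [wcube_mem_iff] at h h'
  funext i; rw [h, h']

/-- Corner of the cube. -/
def wcorner (d ℓ : ℕ) (z : Fin d → ℤ) : Ed d := WithLp.toLp 2 (fun i => (z i : ℝ) * 2 ^ ℓ)

theorem ed_norm_le (d : ℕ) (x : Ed d) (M : ℝ) (h : ∀ i, |x i| ≤ M) : ‖x‖ ≤ d * M := by
  rcases Nat.eq_zero_or_pos d with rfl | hd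
  · have : x = 0 := Subsingleton.elim _ _
    simp [this]
  have hM : 0 ≤ M := (abs_nonneg _).trans (h ⟨0, hd⟩)
  have hd1 : (1 : ℝ) ≤ d := by exact_mod_cast hd
  rw [EuclideanSpace.norm_eq]
  apply Real.sqrt_le_iff.2 ⟨by positivity, ?_⟩
  calc ∑ i, ‖x i‖ ^ 2 ≤ ∑ i : Fin d, M ^ 2 := by
        refine Finset.sum_le_sum fun i _ => ?_
        have := h i
        rw [Real.norm_eq_abs]
        gcongr
    _ = d * M ^ 2 := by simp
    _ ≤ (d * M) ^ 2 := by
      rw [mul_pow]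
      gcongr
      nlinarith

theorem wcube_dist (d ℓ : ℕ) (z : Fin d → ℤ) (x : Ed d) (h : x ∈ Wcube d (ℓ : ℤ) z) :
    dist x (wcorner d ℓ z) ≤ d * 2 ^ ℓ := by
  rw [dist_eq_norm]
  apply ed_norm_le
  intro i
  have := h i
  rw [zpow_natCast] at this
  have e : (x - wcorner d ℓ z) i = x i - (z i : ℝ) * 2 ^ ℓ := by simp [wcorner]
  rw [e, abs_le]
  constructor
  · have := this.1; have : (0:ℝ) < 2 ^ ℓ := by positivity
    linarith
  · have := this.2; linarith

section PartC10

open scoped Convolution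

theorem fb_smul (d : ℕ) (ψ₀ : Ed d → ℂ) (b : Ed d → ℂ) (r : ℝ) (c : ℂ) (x : Ed d) :
    fb d ψ₀ (fun y => c * b y) r x = c * fb d ψ₀ b r x := by
  simp only [fb, mul_assoc]
  rw [integral_const_mul]

theorem fb_int (d : ℕ) (hd : 1 ≤ d) (ψ₀ : Ed d → ℂ) (hψ : Admissible d ψ₀) (b : Ed d → ℂ) (hb : Integrable b)
    (r : ℝ) (hr : 0 < r) (x : Ed d) : Integrable (fun y => b y * Fyr d ψ₀ y r x) := by
  exact HasCompactSupport.convolutionExists_right (ContinuousLinearMap.mul ℂ ℂ) (μ := volume)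
    (Gr_compact d ψ₀ hψ r) hb.locallyIntegrable (Gr_contDiff d hd ψ₀ hψ r hr).continuous x

theorem fb_sum (d : ℕ) (hd : 1 ≤ d) (ψ₀ : Ed d → ℂ) (hψ : Admissible d ψ₀) {ι : Type} (T : Finset ι)
    (b : ι → Ed d → ℂ) (hb : ∀ a ∈ T, Integrable (b a))
    (r : ℝ) (hr : 0 < r) (x : Ed d) : fb d ψ₀ (fun y => ∑ a ∈ T, b a y) r x = ∑ a ∈ T, fb d ψ₀ (b a) r x := by
  simp only [fb, Finset.sum_mul]
  rw [integral_finsetSum]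
  exact fun a ha => fb_int d hd ψ₀ hψ (b a) (hb a ha) r hr x

/-- cube-supported coefficient functions -/
structure CubeB (d ℓ : ℕ) (z : Fin d → ℤ) (M : ℝ) (b : Ed d → ℂ) : Prop where
  meas : Measurable b
  le : ∀ y, ‖b y‖ ≤ M
  supp : ∀ y, b y ≠ 0 → y ∈ Wcube d (ℓ : ℤ) z

theorem wcube_bdd (d ℓ : ℕ) (z : Fin d → ℤ) (y : Ed d) (hy : y ∈ Wcube d (ℓ : ℤ) z) :
    ‖y‖ ≤ d * 2 ^ ℓ + ‖wcorner d ℓ z‖ := by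
  have := wcube_dist d ℓ z y hy
  rw [dist_eq_norm] at this
  have h2 := norm_le_norm_sub_add y (wcorner d ℓ z)
  linarith

theorem CubeB.nice {d ℓ : ℕ} {z : Fin d → ℤ} {b : Ed d → ℂ} (h : CubeB d ℓ z 1 b) : NiceB d b :=
  ⟨h.meas, h.le, ⟨_, fun y hy => wcube_bdd d ℓ z y (h.supp y hy)⟩⟩

theorem CubeB.scale {d ℓ : ℕ} {z : Fin d → ℤ} {M : ℝ} {b : Ed d → ℂ} (h : CubeB d ℓ z M b) (lam : ℝ) (hl : 0 < lam)
    (hM : M ≤ lam) : CubeB d ℓ z 1 (fun y => (lam : ℂ)⁻¹ * b y) := by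
  refine ⟨h.meas.const_mul _, fun y => ?_, fun y hy => h.supp y (right_ne_zero_of_mul hy)⟩
  rw [norm_mul, norm_inv, Complex.norm_real, Real.norm_eq_abs, abs_of_pos hl, inv_mul_le_iff₀ hl, mul_one]
  exact (h.le y).trans hM

theorem CubeB.int_le {d ℓ : ℕ} {z : Fin d → ℤ} {b : Ed d → ℂ} (h : CubeB d ℓ z 1 b) :
    ∫ y, ‖b y‖ ≤ ((2 : ℝ) ^ ℓ) ^ d := by
  have hv : volume.real (Wcube d (ℓ : ℤ) z) = ((2 : ℝ) ^ ℓ) ^ d := by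
    rw [measureReal_def, wcube_vol, ENNReal.toReal_ofReal (by positivity)]
  have h1 : Integrable ((Wcube d (ℓ : ℤ) z).indicator (fun _ => (1 : ℝ))) :=
    (integrable_indicator_iff (wcube_meas d ℓ z)).2 (integrableOn_const (by rw [wcube_vol]; simp))
  calc ∫ y, ‖b y‖ ≤ ∫ y, (Wcube d (ℓ : ℤ) z).indicator (fun _ => (1 : ℝ)) y := by
        refine integral_mono h.nice.integrable.norm h1 fun y => ?_
        by_cases hy : y ∈ Wcube d (ℓ : ℤ) z
        · simp [hy, h.le y]
        · have : b y = 0 := by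
            by_contra hc; exact hy (h.supp y hc)
          simp [hy, this]
    _ = _ := by rw [integral_indicator_const _ (wcube_meas d ℓ z), hv, smul_eq_mul, mul_one]

theorem CubeB.memLp {d ℓ : ℕ} (hd : 1 ≤ d) {z : Fin d → ℤ} {M : ℝ} {b : Ed d → ℂ} (h : CubeB d ℓ z M b) (ψ₀ : Ed d → ℂ)
    (hψ : Admissible d ψ₀) (r : ℝ) (hr : 0 < r) : MemLp (fb d ψ₀ b r) 2 volume := by
  have hM : 0 < max M 1 := by positivity
  have h1 := (h.scale (max M 1) hM (le_max_left _ _)).nice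
  obtain ⟨f, hf, _⟩ := fb_schwartz d hd ψ₀ hψ _ h1 r hr
  have h2 := (f.memLp 2 volume).const_mul ((max M 1 : ℝ) : ℂ)
  refine (memLp_congr_ae (Filter.Eventually.of_forall fun x => ?_)).1 h2
  simp only [hf, fb_smul]
  rw [← mul_assoc, mul_inv_cancel₀, one_mul]
  exact_mod_cast hM.ne'

theorem CubeB.sum_nice {d ℓ : ℕ} (T : Finset ((Fin d → ℤ) × ℕ)) (n : ℕ) (hT : ∀ a ∈ T, a.2 = n)
    (b : ((Fin d → ℤ) × ℕ) → Ed d → ℂ) (hb : ∀ a ∈ T, CubeB d ℓ a.1 1 (b a)) :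
    NiceB d (fun y => ∑ a ∈ T, b a y) := by
  refine ⟨Finset.measurable_fun_sum _ fun a ha => (hb a ha).meas, fun y => ?_, ?_⟩
  · by_cases h : ∃ a ∈ T, b a y ≠ 0
    · obtain ⟨a, ha, hy⟩ := h
      rw [Finset.sum_eq_single_of_mem a ha]
      · exact (hb a ha).le y
      · intro a' ha' hne
        by_contra hc
        apply hne
        refine Prod.ext (wcube_disj d ℓ _ _ y ((hb a' ha').supp y hc) ((hb a ha).supp y hy)) ?_
        rw [hT a ha, hT a' ha']
    · push Not at h
      rw [Finset.sum_eq_zero h]; simp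
  · refine ⟨∑ a ∈ T, (d * 2 ^ ℓ + ‖wcorner d ℓ a.1‖), fun y hy => ?_⟩
    obtain ⟨a, ha, h0⟩ := Finset.exists_ne_zero_of_sum_ne_zero hy
    exact (wcube_bdd d ℓ _ y ((hb a ha).supp y h0)).trans
      (Finset.single_le_sum (f := fun a : (Fin d → ℤ) × ℕ => (d * 2 ^ ℓ + ‖wcorner d ℓ a.1‖ : ℝ)) (fun i _ => by positivity) ha)

theorem fsys_concrete (d : ℕ) (hd : 4 ≤ d) (ψ₀ : Ed d → ℂ) (hψ : Admissible d ψ₀) :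
    ∃ K : ℝ, 0 ≤ K ∧ ∀ (ℓ : ℕ) (t : ℝ), 0 < t → t ≤ 1 → ∀ (S : Finset ((Fin d → ℤ) × ℕ)),
      (∀ a ∈ S, 2 ^ ℓ ≤ a.2) → ∀ (b : ((Fin d → ℤ) × ℕ) → Ed d → ℂ), (∀ a, ∃ M, CubeB d ℓ a.1 M (b a)) →
      (∀ a ∈ S, CubeB d ℓ a.1 1 (b a)) →
      FSys d (4 * d) K (2 ^ ℓ) S (fun a => wcorner d ℓ a.1) (fun a => a.2) (fun a => fb d ψ₀ (b a) (a.2 + t)) := by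
  have hd1 : 1 ≤ d := by omega
  have hdr : (4 : ℝ) ≤ d := by exact_mod_cast hd
  obtain ⟨C1, hC1, h1⟩ := fb_L2 d hd1 ψ₀ hψ
  obtain ⟨C2, hC2, h2⟩ := fb_inner d hd1 ψ₀ hψ
  set e : ℝ := ((d : ℝ) - 1) / 2 with he
  have he0 : 0 < e := by rw [he]; linarith
  refine ⟨C1 * 2 ^ (d - 1) + C2 * 4 ^ e * 2 ^ e, by positivity, ?_⟩
  intro ℓ t ht0 ht1 S hS b hbM hb
  have hL : (1 : ℝ) ≤ 2 ^ ℓ := one_le_pow₀ (by norm_num)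
  have hm : ∀ a ∈ S, (2 : ℝ) ^ ℓ ≤ a.2 := fun a ha => by exact_mod_cast hS a ha
  have hr : ∀ a : (Fin d → ℤ) × ℕ, (0 : ℝ) < a.2 + t := fun a => by positivity
  have hr2 : ∀ a ∈ S, (a.2 + t : ℝ) ≤ 2 * a.2 := fun a ha => by have := hm a ha; linarith
  refine ⟨hL, hm, fun a => ?_, fun a x hx => ?_, fun T hT n hn => ?_, fun a ha a' ha' hdist => ?_⟩
  · obtain ⟨M, hM⟩ := hbM a
    exact hM.memLp hd1 ψ₀ hψ _ (hr a)
  · obtain ⟨M, hM⟩ := hbM a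
    obtain ⟨y, hy, hxy⟩ := fb_supp d ψ₀ hψ (b a) _ x hx
    have h3 := wcube_dist d ℓ _ y (hM.supp y hy)
    rw [← dist_eq_norm] at hxy
    have h4 := dist_triangle x y (wcorner d ℓ a.1)
    have h5 := dist_triangle_right x y (wcorner d ℓ a.1)
    have h6 := abs_le.1 hxy
    have h7 : (4 : ℝ) * 1 ≤ d * 2 ^ ℓ := mul_le_mul hdr hL (by norm_num) (by positivity)
    rw [ann, Set.mem_ofPred_eq, abs_le]
    constructor <;> nlinarith
  · have hTb : ∀ a ∈ T, CubeB d ℓ a.1 1 (b a) := fun a ha => hb a (hT ha)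
    have hN := CubeB.sum_nice (ℓ := ℓ) T n hn b hTb
    have e1 : ∀ x, ∑ a ∈ T, fb d ψ₀ (b a) (a.2 + t) x = fb d ψ₀ (fun y => ∑ a ∈ T, b a y) (n + t) x := by
      intro x
      rw [fb_sum d hd1 ψ₀ hψ T b (fun a ha => (hTb a ha).nice.integrable) _ (by positivity)]
      exact Finset.sum_congr rfl fun a ha => by rw [hn a ha]
    simp only [e1]
    rcases T.eq_empty_or_nonempty with rfl | ⟨a0, ha0⟩
    · simp [fb]
    have hn2 : (n + t : ℝ) ≤ 2 * n := by rw [← hn a0 ha0]; exact hr2 a0 (hT ha0)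
    have hi : ∫ y, ‖∑ a ∈ T, b a y‖ ≤ T.card * ((2 : ℝ) ^ ℓ) ^ d := by
      calc ∫ y, ‖∑ a ∈ T, b a y‖ ≤ ∫ y, ∑ a ∈ T, ‖b a y‖ :=
            integral_mono hN.integrable.norm (integrable_finsetSum _ fun a ha => (hTb a ha).nice.integrable.norm)
              fun y => norm_sum_le _ _
        _ = ∑ a ∈ T, ∫ y, ‖b a y‖ := integral_finsetSum _ fun a ha => (hTb a ha).nice.integrable.norm
        _ ≤ ∑ a ∈ T, ((2 : ℝ) ^ ℓ) ^ d := Finset.sum_le_sum fun a ha => (hTb a ha).int_le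
        _ = _ := by simp
    calc _ ≤ C1 * (n + t) ^ (d - 1) * ∫ y, ‖∑ a ∈ T, b a y‖ := h1 _ hN _ (by positivity)
      _ ≤ C1 * (2 * n) ^ (d - 1) * (T.card * ((2 : ℝ) ^ ℓ) ^ d) := by gcongr
      _ = (C1 * 2 ^ (d - 1)) * (((2 : ℝ) ^ ℓ) ^ d * n ^ (d - 1)) * T.card := by rw [mul_pow]; ring
      _ ≤ _ := by
        gcongr
        have : 0 ≤ C2 * 4 ^ e * 2 ^ e := by positivity
        linarith
  · set Δ := dist (wcorner d ℓ a.1) (wcorner d ℓ a'.1) with hΔ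
    have hΔ0 : 0 < Δ := lt_of_lt_of_le (by positivity) hdist
    have h3 := h2 (b a) (b a') (hb a ha).nice (hb a' ha').nice _ _ (hr a) (hr a') (Δ / 2) (by positivity) (by
      intro y y' hy hy'
      have k1 := wcube_dist d ℓ _ y ((hb a ha).supp y hy)
      have k2 := wcube_dist d ℓ _ y' ((hb a' ha').supp y' hy')
      rw [← dist_eq_norm]
      have k3 := dist_triangle4 (wcorner d ℓ a.1) y y' (wcorner d ℓ a'.1)
      rw [dist_comm _ y] at k3
      have : 2 * (d * 2 ^ ℓ : ℝ) ≤ Δ / 2 := by nlinarith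
      linarith)
    refine h3.trans ?_
    have hma : (0 : ℝ) ≤ a.2 := by positivity
    calc C2 * ((a.2 + t) * (a'.2 + t)) ^ e * (Δ / 2) ^ (-e) * ((∫ y, ‖b a y‖) * ∫ y, ‖b a' y‖)
        ≤ C2 * ((2 * a.2) * (2 * a'.2)) ^ e * (Δ / 2) ^ (-e) * (((2 : ℝ) ^ ℓ) ^ d * ((2 : ℝ) ^ ℓ) ^ d) := by
          have q1 := hr2 a ha
          have q2 := hr2 a' ha'
          have q3 := (hb a ha).int_le
          have q4 := (hb a' ha').int_le
          have q5 := (hr a).le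
          have q6 := (hr a').le
          have q7 : 0 ≤ ∫ y, ‖b a' y‖ := integral_nonneg fun _ => norm_nonneg _
          gcongr
      _ = (C2 * 4 ^ e * 2 ^ e) * ((2 : ℝ) ^ ℓ) ^ (2 * d) * ((a.2 : ℝ) * a'.2) ^ e * Δ ^ (-e) := by
          rw [show (2 * (a.2 : ℝ)) * (2 * a'.2) = 4 * ((a.2 : ℝ) * a'.2) by ring,
            Real.mul_rpow (by norm_num) (by positivity), div_eq_mul_inv, Real.mul_rpow hΔ0.le (by norm_num),
            Real.inv_rpow (by norm_num), ← Real.rpow_neg (by norm_num), neg_neg]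
          ring
      _ ≤ _ := by
        gcongr
        have : 0 ≤ C1 * 2 ^ (d - 1) := by positivity
        linarith

theorem cube_interp (d : ℕ) (hd : 4 ≤ d) (ψ₀ : Ed d → ℂ) (hψ : Admissible d ψ₀) (p p1 : ℝ) (hp : 1 < p) (hp1 : p < p1)
    (hqd : ((d : ℝ) + 1) / (2 * d - 2) < 1 / p1) :
    ∃ C : ℝ, 0 < C ∧ ∀ (ℓ : ℕ) (t : ℝ), 0 < t → t ≤ 1 → ∀ (S : Finset ((Fin d → ℤ) × ℕ)),
      (∀ a ∈ S, 2 ^ ℓ ≤ a.2) → ∀ (b : ((Fin d → ℤ) × ℕ) → Ed d → ℂ) (γ : ((Fin d → ℤ) × ℕ) → ℝ),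
      (∀ a, CubeB d ℓ a.1 (γ a) (b a)) →
      ∫⁻ x, ‖∑ a ∈ S, fb d ψ₀ (b a) (a.2 + t) x‖ₑ ^ p ≤
        ENNReal.ofReal (C * ((((2 : ℝ) ^ ℓ) ^ (d - 1)) ^ (-(1 / p1 - ((d : ℝ) + 1) / (2 * d - 2)))) ^ p *
          (((2 : ℝ) ^ ℓ) ^ d * ∑ a ∈ S, γ a ^ p * (a.2 : ℝ) ^ (d - 1))) := by
  classical
  obtain ⟨K, hK, hsys⟩ := fsys_concrete d hd ψ₀ hψ
  have hdr : (4 : ℝ) ≤ d := by exact_mod_cast hd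
  obtain ⟨C, hC, hmain⟩ := fsys_interp d hd (4 * d) K (by linarith) hK p p1 hp hp1 hqd
  refine ⟨C, hC, fun ℓ t ht0 ht1 S hS b γ hb => ?_⟩
  have hγ : ∀ a, 0 ≤ γ a := fun a => (norm_nonneg _).trans ((hb a).le 0)
  set S0 := S.filter (fun a => 0 < γ a) with hS0
  have e1 : ∀ x, ∑ a ∈ S, fb d ψ₀ (b a) (a.2 + t) x = ∑ a ∈ S0, fb d ψ₀ (b a) (a.2 + t) x := by
    intro x
    symm
    apply Finset.sum_subset (Finset.filter_subset _ _)
    intro a ha hna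
    have h0 : γ a = 0 := by
      by_contra hc
      exact hna (Finset.mem_filter.2 ⟨ha, lt_of_le_of_ne (hγ a) (Ne.symm hc)⟩)
    have : ∀ y, b a y = 0 := fun y => by
      have := (hb a).le y
      rw [h0] at this
      simpa using this
    simp [fb, this]
  have e2 : ∑ a ∈ S0, γ a ^ p * (a.2 : ℝ) ^ (d - 1) ≤ ∑ a ∈ S, γ a ^ p * (a.2 : ℝ) ^ (d - 1) :=
    Finset.sum_le_sum_of_subset_of_nonneg (Finset.filter_subset _ _) fun a _ _ => by
      have := hγ a
      positivity
  simp only [e1]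
  refine (hmain S0 (fun a => wcorner d ℓ a.1) (fun a => a.2) (fun a => fb d ψ₀ (b a) (a.2 + t)) γ (2 ^ ℓ)
    (one_le_pow₀ (by norm_num)) (fun a ha => (Finset.mem_filter.1 ha).2) ?_).trans ?_
  · intro S' hS' lam hlam hle
    have := hsys ℓ t ht0 ht1 S' (fun a ha => hS a (Finset.filter_subset _ _ (hS' ha)))
      (fun a y => (lam : ℂ)⁻¹ * b a y) (fun a => ?_) (fun a ha => (hb a).scale lam hlam (hle a ha))
    · convert this using 3 with a x
      rw [fb_smul]
    · refine ⟨lam⁻¹ * γ a, ((hb a).meas.const_mul _), fun y => ?_, fun y hy => (hb a).supp y (right_ne_zero_of_mul hy)⟩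
      rw [norm_mul, norm_inv, Complex.norm_real, Real.norm_eq_abs, abs_of_pos hlam]
      gcongr
      exact (hb a).le y
  · apply ENNReal.ofReal_le_ofReal
    gcongr

end PartC10

/-- The kernel `σ_r * ψ`, written over the unit sphere. -/
def FF (d : ℕ) (ψ₀ : Ed d → ℂ) (v : Ed d) (r : ℝ) : ℂ :=
  ((r ^ (d - 1) : ℝ) : ℂ) * ∫ z, psiOf d ψ₀ (v - r • z) ∂(sphereM d 1)

theorem psi_bdd (d : ℕ) (ψ₀ : Ed d → ℂ) (hψ : Admissible d ψ₀) : ∃ A : ℝ, 0 ≤ A ∧ ∀ x, ‖psiOf d ψ₀ x‖ ≤ A := by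
  obtain ⟨A, hA⟩ := (psi_compact d ψ₀ hψ).exists_bound_of_continuous (psi_contDiff d ψ₀ hψ).continuous
  exact ⟨A, (norm_nonneg _).trans (hA 0), hA⟩

theorem FF_cont (d : ℕ) (hd : 1 ≤ d) (ψ₀ : Ed d → ℂ) (hψ : Admissible d ψ₀) :
    Continuous (fun q : Ed d × ℝ => FF d ψ₀ q.1 q.2) := by
  have := sphereM_finite_one d hd
  obtain ⟨A, hA0, hA⟩ := psi_bdd d ψ₀ hψ
  have hc := (psi_contDiff d ψ₀ hψ).continuous
  unfold FF
  refine Continuous.mul (by fun_prop) ?_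
  refine continuous_of_dominated (bound := fun _ => A) (fun q => ?_) (fun q => Filter.Eventually.of_forall fun z => hA _)
    (integrable_const _) (Filter.Eventually.of_forall fun z => ?_)
  · exact (by fun_prop : Continuous fun z => psiOf d ψ₀ (q.1 - q.2 • z)).aestronglyMeasurable
  · fun_prop

theorem FF_eq (d : ℕ) (hd : 1 ≤ d) (ψ₀ : Ed d → ℂ) (hψ : Admissible d ψ₀) (y : Ed d) (r : ℝ) (hr : 0 < r) (x : Ed d) :
    Fyr d ψ₀ y r x = FF d ψ₀ (x - y) r := by
  have hc := (psi_contDiff d ψ₀ hψ).continuous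
  rw [Fyr, FF, sphereM_eq_smul_map d hd r hr, integral_smul_measure, integral_map (by fun_prop)
    (by exact (by fun_prop : Continuous fun z => psiOf d ψ₀ (x - y - z)).aestronglyMeasurable),
    ENNReal.toReal_ofReal (by positivity)]
  simp

theorem FF_bdd (d : ℕ) (hd : 1 ≤ d) (ψ₀ : Ed d → ℂ) (hψ : Admissible d ψ₀) :
    ∃ A : ℝ, 0 ≤ A ∧ ∀ v r, 0 ≤ r → ‖FF d ψ₀ v r‖ ≤ A * r ^ (d - 1) := by
  have := sphereM_finite_one d hd
  obtain ⟨A, hA0, hA⟩ := psi_bdd d ψ₀ hψ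
  refine ⟨A * (sphereM d 1).real univ, by positivity, fun v r hr => ?_⟩
  rw [FF, norm_mul, Complex.norm_real, Real.norm_eq_abs, abs_of_nonneg (by positivity), mul_comm]
  gcongr
  exact norm_integral_le_of_norm_le_const (Filter.Eventually.of_forall fun z => hA _)

theorem FF_supp (d : ℕ) (hd : 1 ≤ d) (ψ₀ : Ed d → ℂ) (hψ : Admissible d ψ₀) (v : Ed d) (r : ℝ) (hr : 0 < r)
    (h : FF d ψ₀ v r ≠ 0) : r ≤ ‖v‖ + 1 / 5 := by
  have e := FF_eq d hd ψ₀ hψ 0 r hr v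
  rw [sub_zero] at e
  rw [← e, Fyr_eq, sub_zero] at h
  have := (abs_le.1 (Gr_supp d ψ₀ hψ r v h)).1
  linarith

/-- Essential supremum of `h(·,r)` over a cube. -/
def gam (d ℓ : ℕ) (h : Ed d × ℝ → ℂ) (z : Fin d → ℤ) (r : ℝ) : ℝ≥0∞ :=
  essSup (fun y => ‖h (y, r)‖ₑ) (volume.restrict (Wcube d (ℓ : ℤ) z))

theorem gam_ae (d ℓ : ℕ) (h : Ed d × ℝ → ℂ) (z : Fin d → ℤ) (r : ℝ) :
    ∀ᵐ y ∂(volume.restrict (Wcube d (ℓ : ℤ) z)), ‖h (y, r)‖ₑ ≤ gam d ℓ h z r :=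
  ENNReal.ae_le_essSup _

theorem gam_meas (d ℓ : ℕ) (h : Ed d × ℝ → ℂ) (hh : Measurable h) (z : Fin d → ℤ) : Measurable (gam d ℓ h z) := by
  refine measurable_of_Iic fun c => ?_
  have e : gam d ℓ h z ⁻¹' Iic c = {r | (volume.restrict (Wcube d (ℓ : ℤ) z)) ((fun y => (y, r)) ⁻¹' {q | c < ‖h q‖ₑ}) = 0} := by
    ext r
    simp only [Set.mem_preimage, Set.mem_Iic, Set.mem_ofPred_eq]
    have : (fun y : Ed d => (y, r)) ⁻¹' {q | c < ‖h q‖ₑ} = {y | ¬ ‖h (y, r)‖ₑ ≤ c} := by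
      ext y; simp
    rw [this]
    constructor
    · intro hle
      exact ae_iff.1 ((gam_ae d ℓ h z r).mono fun y hy => hy.trans hle)
    · intro h0
      exact essSup_le_of_ae_le _ (ae_iff.2 h0)
  rw [e]
  refine measurableSet_eq_fun (measurable_measure_prodMk_right ?_) measurable_const
  exact measurableSet_lt measurable_const hh.enorm

theorem gam_le (d ℓ : ℕ) (h : Ed d × ℝ → ℂ) (z : Fin d → ℤ) (r : ℝ) (hr : 0 < r) (p : ℝ) (hp : 0 < p) :
    gam d ℓ h z r ^ p * ENNReal.ofReal (r ^ (d - 1)) ≤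
      ⨆ y ∈ Wcube d (ℓ : ℤ) z, ENNReal.ofReal (‖h (y, r)‖ ^ p * r ^ (d - 1)) := by
  set s := ⨆ y ∈ Wcube d (ℓ : ℤ) z, ENNReal.ofReal (‖h (y, r)‖ ^ p * r ^ (d - 1)) with hs
  have hw0 : ENNReal.ofReal (r ^ (d - 1)) ≠ 0 := by
    rw [Ne, ENNReal.ofReal_eq_zero, not_le]; positivity
  have hw1 : ENNReal.ofReal (r ^ (d - 1)) ≠ ⊤ := ENNReal.ofReal_ne_top
  have h1 : gam d ℓ h z r ≤ (s / ENNReal.ofReal (r ^ (d - 1))) ^ (1 / p) := by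
    refine essSup_le_of_ae_le _ ?_
    refine (ae_restrict_iff' (wcube_meas d ℓ z)).2 (Filter.Eventually.of_forall fun y hy => ?_)
    rw [one_div, ENNReal.le_rpow_inv_iff hp, ENNReal.le_div_iff_mul_le (Or.inl hw0) (Or.inl hw1)]
    have : ENNReal.ofReal (‖h (y, r)‖ ^ p * r ^ (d - 1)) ≤ s := le_iSup₂ (f := fun y (_ : y ∈ Wcube d (ℓ : ℤ) z) => ENNReal.ofReal (‖h (y, r)‖ ^ p * r ^ (d - 1))) y hy
    rwa [ENNReal.ofReal_mul (by positivity), ← ENNReal.ofReal_rpow_of_nonneg (norm_nonneg _) hp.le, ofReal_norm] at this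
  rw [one_div, ENNReal.le_rpow_inv_iff hp, ENNReal.le_div_iff_mul_le (Or.inl hw0) (Or.inl hw1)] at h1
  exact h1

/-- Contribution of one cube at one radius. -/
def uz (d : ℕ) (ψ₀ : Ed d → ℂ) (ℓ : ℕ) (h : Ed d × ℝ → ℂ) (z : Fin d → ℤ) (r : ℝ) (x : Ed d) : ℂ :=
  ∫ y in Wcube d (ℓ : ℤ) z, h (y, r) * FF d ψ₀ (x - y) r

theorem slice_bound (d : ℕ) (hd : 4 ≤ d) (ψ₀ : Ed d → ℂ) (hψ : Admissible d ψ₀) (p p1 : ℝ) (hp : 1 < p) (hp1 : p < p1)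
    (hqd : ((d : ℝ) + 1) / (2 * d - 2) < 1 / p1) :
    ∃ C : ℝ, 0 < C ∧ ∀ (ℓ : ℕ) (h : Ed d × ℝ → ℂ), Measurable h → ∀ (t : ℝ), 0 < t → t ≤ 1 →
      ∀ (S : Finset ((Fin d → ℤ) × ℕ)), (∀ a ∈ S, 2 ^ ℓ ≤ a.2) →
      ∫⁻ x, ‖∑ a ∈ S, uz d ψ₀ ℓ h a.1 (a.2 + t) x‖ₑ ^ p ≤
        ENNReal.ofReal (C * ((((2 : ℝ) ^ ℓ) ^ (d - 1)) ^ (-(1 / p1 - ((d : ℝ) + 1) / (2 * d - 2)))) ^ p *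
          ((2 : ℝ) ^ ℓ) ^ d) * ∑ a ∈ S, gam d ℓ h a.1 (a.2 + t) ^ p * ENNReal.ofReal ((a.2 + t) ^ (d - 1)) := by
  classical
  obtain ⟨C, hC, hmain⟩ := cube_interp d hd ψ₀ hψ p p1 hp hp1 hqd
  refine ⟨C, hC, fun ℓ h hh t ht0 ht1 S hS => ?_⟩
  have hr : ∀ a : (Fin d → ℤ) × ℕ, (0 : ℝ) < a.2 + t := fun a => by positivity
  set B := C * ((((2 : ℝ) ^ ℓ) ^ (d - 1)) ^ (-(1 / p1 - ((d : ℝ) + 1) / (2 * d - 2)))) ^ p *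
          ((2 : ℝ) ^ ℓ) ^ d with hB
  have hB0 : 0 < B := by positivity
  by_cases htop : ∃ a ∈ S, gam d ℓ h a.1 (a.2 + t) = ⊤
  · obtain ⟨a, ha, hat⟩ := htop
    have : ∑ a ∈ S, gam d ℓ h a.1 (a.2 + t) ^ p * ENNReal.ofReal ((a.2 + t) ^ (d - 1)) = ⊤ := by
      refine ENNReal.sum_eq_top.2 ⟨a, ha, ?_⟩
      rw [hat, ENNReal.top_rpow_of_pos (by linarith), ENNReal.top_mul]
      rw [Ne, ENNReal.ofReal_eq_zero, not_le]
      have := hr a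
      positivity
    rw [this, ENNReal.mul_top]
    · exact le_top
    · rw [Ne, ENNReal.ofReal_eq_zero, not_le]; exact hB0
  push Not at htop
  set γ : (Fin d → ℤ) × ℕ → ℝ := fun a => (gam d ℓ h a.1 (a.2 + t)).toReal with hγ
  set E : (Fin d → ℤ) × ℕ → Set (Ed d) := fun a => Wcube d (ℓ : ℤ) a.1 ∩ {y | ‖h (y, a.2 + t)‖ ≤ γ a} with hE
  have hmy : ∀ a : (Fin d → ℤ) × ℕ, Measurable fun y => h (y, (a.2 : ℝ) + t) := fun a => hh.comp (by fun_prop)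
  have hEm : ∀ a, MeasurableSet (E a) := fun a =>
    (wcube_meas d ℓ a.1).inter (measurableSet_le (hmy a).norm measurable_const)
  set b : (Fin d → ℤ) × ℕ → Ed d → ℂ := fun a => (E a).indicator (fun y => h (y, a.2 + t)) with hb
  have hcb : ∀ a, CubeB d ℓ a.1 (γ a) (b a) := by
    intro a
    refine ⟨(hmy a).indicator (hEm a), fun y => ?_, fun y hy => ?_⟩
    · by_cases hy : y ∈ E a
      · simp only [hb, Set.indicator_of_mem hy]; exact hy.2
      · simp only [hb, Set.indicator_of_notMem hy, norm_zero]; exact ENNReal.toReal_nonneg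
    · exact (Set.mem_of_indicator_ne_zero hy).1
  have key : ∀ a ∈ S, ∀ x, uz d ψ₀ ℓ h a.1 (a.2 + t) x = fb d ψ₀ (b a) (a.2 + t) x := by
    intro a ha x
    rw [uz, fb, ← integral_indicator (wcube_meas d ℓ a.1)]
    apply integral_congr_ae
    have h1 := gam_ae d ℓ h a.1 (a.2 + t)
    rw [ae_restrict_iff' (wcube_meas d ℓ a.1)] at h1
    filter_upwards [h1] with y hy
    rw [FF_eq d (by omega) ψ₀ hψ y _ (hr a)]
    by_cases hyW : y ∈ Wcube d (ℓ : ℤ) a.1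
    · have hyE : y ∈ E a := ⟨hyW, by
        have h2 := ENNReal.toReal_mono (htop a ha) (hy hyW)
        simpa using h2⟩
      simp only [hb, Set.indicator_of_mem hyW, Set.indicator_of_mem hyE]
    · have hyE : y ∉ E a := fun hc => hyW hc.1
      simp only [hb, Set.indicator_of_notMem hyW, Set.indicator_of_notMem hyE, zero_mul]
  have e1 : ∀ x, ∑ a ∈ S, uz d ψ₀ ℓ h a.1 (a.2 + t) x = ∑ a ∈ S, fb d ψ₀ (b a) (a.2 + t) x := fun x =>
    Finset.sum_congr rfl fun a ha => key a ha x
  simp only [e1]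
  refine (hmain ℓ t ht0 ht1 S hS b γ hcb).trans ?_
  rw [← mul_assoc, ENNReal.ofReal_mul hB0.le]
  gcongr
  rw [ENNReal.ofReal_sum_of_nonneg (fun a _ => by positivity)]
  refine Finset.sum_le_sum fun a ha => ?_
  have hg : (gam d ℓ h a.1 (a.2 + t)) = ENNReal.ofReal (γ a) := (ENNReal.ofReal_toReal (htop a ha)).symm
  rw [hg, ENNReal.ofReal_mul (by positivity), ENNReal.ofReal_rpow_of_nonneg ENNReal.toReal_nonneg (by linarith)]
  gcongr
  linarith

theorem restrict_Ioc_split (N T : ℕ) (hNT : N ≤ T) :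
    (volume : Measure ℝ).restrict (Ioc (N : ℝ) T) =
      ∑ m ∈ Finset.Ico N T, Measure.map (fun t : ℝ => (m : ℝ) + t) (volume.restrict (Ioc 0 1)) := by
  induction T, hNT using Nat.le_induction with
  | base => simp
  | succ n hn ih =>
    rw [Finset.sum_Ico_succ_top hn, ← ih]
    have h1 : Ioc (N : ℝ) ((n + 1 : ℕ) : ℝ) = Ioc (N : ℝ) n ∪ Ioc (n : ℝ) (n + 1) := by
      push_cast
      rw [Ioc_union_Ioc_eq_Ioc]
      · exact_mod_cast hn
      · linarith
    rw [h1, Measure.restrict_union (by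
      rw [Set.disjoint_left]; intro x hx hx'; exact absurd hx.2 (not_le.2 hx'.1)) measurableSet_Ioc]
    congr 1
    have h2 := (measurePreserving_add_left (volume : Measure ℝ) (n : ℝ)).restrict_preimage
      (measurableSet_Ioc (a := (n : ℝ)) (b := (n : ℝ) + 1))
    rw [← h2.map_eq]
    congr 2
    ext x
    simp

theorem jensen_unit (v : ℝ → ℂ) (hv : Measurable v) (p : ℝ) (hp : 1 ≤ p) :
    ‖∫ t in Ioc (0 : ℝ) 1, v t‖ₑ ^ p ≤ ∫⁻ t in Ioc (0 : ℝ) 1, ‖v t‖ₑ ^ p := by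
  have : IsProbabilityMeasure ((volume : Measure ℝ).restrict (Ioc (0 : ℝ) 1)) := ⟨by simp⟩
  have h1 := enorm_integral_le_lintegral_enorm (μ := volume.restrict (Ioc (0 : ℝ) 1)) v
  have h2 := eLpNorm_le_eLpNorm_of_exponent_le (μ := volume.restrict (Ioc (0 : ℝ) 1)) (f := v) (p := 1) (q := ENNReal.ofReal p)
    (by simpa using hp) hv.aestronglyMeasurable
  rw [eLpNorm_one_eq_lintegral_enorm, eLpNorm_eq_lintegral_rpow_enorm_toReal (by
    rw [Ne, ENNReal.ofReal_eq_zero, not_le]; linarith) ENNReal.ofReal_ne_top, ENNReal.toReal_ofReal (by linarith)] at h2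
  have h3 := h1.trans h2
  rw [one_div, ENNReal.le_rpow_inv_iff (by linarith)] at h3
  exact h3

theorem ennreal_le_add_rpow (g : ℝ≥0∞) (p : ℝ) (hp : 1 ≤ p) : g ≤ 1 + g ^ p := by
  rcases le_total g 1 with h | h
  · exact h.trans le_self_add
  · calc g = g ^ (1 : ℝ) := by simp
      _ ≤ g ^ p := ENNReal.rpow_le_rpow_of_exponent_le h hp
      _ ≤ _ := le_add_self

theorem hF_meas (d : ℕ) (hd : 1 ≤ d) (ψ₀ : Ed d → ℂ) (hψ : Admissible d ψ₀) (h : Ed d × ℝ → ℂ) (hh : Measurable h) :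
    Measurable (fun q : (ℝ × Ed d) × Ed d => h (q.2, q.1.1) * FF d ψ₀ (q.1.2 - q.2) q.1.1) := by
  have h1 := (FF_cont d hd ψ₀ hψ).measurable
  refine (hh.comp (by fun_prop)).mul ?_
  exact h1.comp (g := fun q : Ed d × ℝ => FF d ψ₀ q.1 q.2) (f := fun q : (ℝ × Ed d) × Ed d => (q.1.2 - q.2, q.1.1)) (by fun_prop)

theorem uz_meas (d : ℕ) (hd : 1 ≤ d) (ψ₀ : Ed d → ℂ) (hψ : Admissible d ψ₀) (ℓ : ℕ) (h : Ed d × ℝ → ℂ) (hh : Measurable h)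
    (z : Fin d → ℤ) : Measurable (fun q : ℝ × Ed d => uz d ψ₀ ℓ h z q.1 q.2) := by
  have := (hF_meas d hd ψ₀ hψ h hh).stronglyMeasurable
  exact (this.integral_prod_right (ν := volume.restrict (Wcube d (ℓ : ℤ) z))).measurable

theorem hF_int (d : ℕ) (hd : 1 ≤ d) (ψ₀ : Ed d → ℂ) (hψ : Admissible d ψ₀) (ℓ : ℕ) (h : Ed d × ℝ → ℂ) (hh : Measurable h)
    (z : Fin d → ℤ) (p : ℝ) (hp : 1 ≤ p) (N T : ℕ) 
    (hJ : ∫⁻ r in Ioc (N : ℝ) T, gam d ℓ h z r ^ p * ENNReal.ofReal (r ^ (d - 1)) ≠ ⊤) (x : Ed d) :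
    Integrable (fun q : Ed d × ℝ => h q * FF d ψ₀ (x - q.1) q.2)
      ((volume.restrict (Wcube d (ℓ : ℤ) z)).prod (volume.restrict (Ioc (N : ℝ) T))) := by
  obtain ⟨A, hA0, hA⟩ := FF_bdd d hd ψ₀ hψ
  have hm : Measurable (fun q : Ed d × ℝ => h q * FF d ψ₀ (x - q.1) q.2) :=
    (hF_meas d hd ψ₀ hψ h hh).comp (f := fun q : Ed d × ℝ => ((q.2, x), q.1)) (by fun_prop)
  refine ⟨hm.aestronglyMeasurable, ?_⟩
  rw [HasFiniteIntegral, lintegral_prod_symm _ hm.enorm.aemeasurable]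
  have hv : volume (Wcube d (ℓ : ℤ) z) ≠ ⊤ := by rw [wcube_vol]; simp
  calc ∫⁻ r in Ioc (N : ℝ) T, ∫⁻ y in Wcube d (ℓ : ℤ) z, ‖h (y, r) * FF d ψ₀ (x - y) r‖ₑ
      ≤ ∫⁻ r in Ioc (N : ℝ) T, (volume (Wcube d (ℓ : ℤ) z) * ENNReal.ofReal A) *
        (ENNReal.ofReal ((T : ℝ) ^ (d - 1)) + gam d ℓ h z r ^ p * ENNReal.ofReal (r ^ (d - 1))) := by
        refine setLIntegral_mono' measurableSet_Ioc fun r hr => ?_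
        have hr0 : 0 ≤ r := (Nat.cast_nonneg N).trans hr.1.le
        calc ∫⁻ y in Wcube d (ℓ : ℤ) z, ‖h (y, r) * FF d ψ₀ (x - y) r‖ₑ
            ≤ ∫⁻ y in Wcube d (ℓ : ℤ) z, gam d ℓ h z r * (ENNReal.ofReal A * ENNReal.ofReal (r ^ (d - 1))) := by
              refine lintegral_mono_ae ?_
              filter_upwards [gam_ae d ℓ h z r] with y hy
              rw [enorm_mul]
              refine mul_le_mul' hy ?_
              rw [← ENNReal.ofReal_mul hA0, ← ofReal_norm]
              exact ENNReal.ofReal_le_ofReal (hA _ _ hr0)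
          _ = (volume (Wcube d (ℓ : ℤ) z) * ENNReal.ofReal A) * (gam d ℓ h z r * ENNReal.ofReal (r ^ (d - 1))) := by
              rw [setLIntegral_const]; ring
          _ ≤ _ := by
              gcongr
              calc gam d ℓ h z r * ENNReal.ofReal (r ^ (d - 1)) ≤ (1 + gam d ℓ h z r ^ p) * ENNReal.ofReal (r ^ (d - 1)) := by
                    gcongr; exact ennreal_le_add_rpow _ _ hp
                _ ≤ _ := by
                    rw [add_mul, one_mul]
                    gcongr
                    exact hr.2
    _ = (volume (Wcube d (ℓ : ℤ) z) * ENNReal.ofReal A) * (ENNReal.ofReal ((T : ℝ) ^ (d - 1)) * volume (Ioc (N : ℝ) T) +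
        ∫⁻ r in Ioc (N : ℝ) T, gam d ℓ h z r ^ p * ENNReal.ofReal (r ^ (d - 1))) := by
        have h1 : Measurable fun r : ℝ => gam d ℓ h z r ^ p * ENNReal.ofReal (r ^ (d - 1)) :=
          ((gam_meas d ℓ h hh z).pow_const p).mul (by fun_prop)
        rw [lintegral_const_mul _ (by fun_prop), lintegral_add_left (by fun_prop), setLIntegral_const]
    _ < ⊤ := by
        refine ENNReal.mul_lt_top (ENNReal.mul_lt_top hv.lt_top ENNReal.ofReal_lt_top) ?_
        refine ENNReal.add_lt_top.2 ⟨ENNReal.mul_lt_top ENNReal.ofReal_lt_top ?_, hJ.lt_top⟩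
        simp

theorem fR_bound (d : ℕ) (hd : 1 ≤ d) (ψ₀ : Ed d → ℂ) (hψ : Admissible d ψ₀) (p : ℝ) (hp : 1 < p)
    (ℓ : ℕ) (h : Ed d × ℝ → ℂ) (hh : Measurable h) (B : ℝ≥0∞)
    (hslice : ∀ (t : ℝ), 0 < t → t ≤ 1 →
      ∀ (S : Finset ((Fin d → ℤ) × ℕ)), (∀ a ∈ S, 2 ^ ℓ ≤ a.2) →
      ∫⁻ x, ‖∑ a ∈ S, uz d ψ₀ ℓ h a.1 (a.2 + t) x‖ₑ ^ p ≤
        B * ∑ a ∈ S, gam d ℓ h a.1 (a.2 + t) ^ p * ENNReal.ofReal ((a.2 + t) ^ (d - 1)))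
    (Z : Finset (Fin d → ℤ)) (N T : ℕ) (hN : N = 2 ^ ℓ) (hNT : N ≤ T)
    (hJ : ∑ z ∈ Z, ∫⁻ r in Ioc (N : ℝ) T, gam d ℓ h z r ^ p * ENNReal.ofReal (r ^ (d - 1)) ≠ ⊤) :
    ∫⁻ x, ‖∑ z ∈ Z, ∫ y in Wcube d (ℓ : ℤ) z, ∫ r in Ioc (N : ℝ) T, h (y, r) * FF d ψ₀ (x - y) r‖ₑ ^ p ≤
      B * ∑ z ∈ Z, ∫⁻ r in Ioc (N : ℝ) T, gam d ℓ h z r ^ p * ENNReal.ofReal (r ^ (d - 1)) := by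
  have hJz : ∀ z ∈ Z, ∫⁻ r in Ioc (N : ℝ) T, gam d ℓ h z r ^ p * ENNReal.ofReal (r ^ (d - 1)) ≠ ⊤ :=
    fun z hz hc => hJ (ENNReal.sum_eq_top.2 ⟨z, hz, hc⟩)
  have hgm : ∀ z, Measurable fun r : ℝ => gam d ℓ h z r ^ p * ENNReal.ofReal (r ^ (d - 1)) := fun z =>
    ((gam_meas d ℓ h hh z).pow_const p).mul (by fun_prop)
  have hum := uz_meas d hd ψ₀ hψ ℓ h hh
  have hux : ∀ z x, Measurable fun r => uz d ψ₀ ℓ h z r x := fun z x => (hum z).comp (f := fun r : ℝ => (r, x)) (by fun_prop)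
  set S := Z ×ˢ Finset.Ico N T with hS
  have e1 : ∀ x, ∑ z ∈ Z, ∫ y in Wcube d (ℓ : ℤ) z, ∫ r in Ioc (N : ℝ) T, h (y, r) * FF d ψ₀ (x - y) r =
      ∫ t in Ioc (0 : ℝ) 1, ∑ a ∈ S, uz d ψ₀ ℓ h a.1 (a.2 + t) x := by
    intro x
    have hIntg : ∀ z ∈ Z, Integrable (fun r => uz d ψ₀ ℓ h z r x) (volume.restrict (Ioc (N : ℝ) T)) := fun z hz =>
      (hF_int d hd ψ₀ hψ ℓ h hh z p hp.le N T (hJz z hz) x).integral_prod_right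
    have hint2 : ∀ z ∈ Z, ∀ m ∈ Finset.Ico N T,
        Integrable (fun r => uz d ψ₀ ℓ h z r x) (Measure.map (fun t : ℝ => (m : ℝ) + t) (volume.restrict (Ioc 0 1))) := by
      intro z hz m hm
      have := hIntg z hz
      rw [restrict_Ioc_split N T hNT, integrable_finsetSum_measure] at this
      exact this m hm
    have hint3 : ∀ z ∈ Z, ∀ m ∈ Finset.Ico N T,
        Integrable (fun t : ℝ => uz d ψ₀ ℓ h z (m + t) x) (volume.restrict (Ioc 0 1)) := by
      intro z hz m hm
      exact (integrable_map_measure (hux z x).aestronglyMeasurable (by fun_prop)).1 (hint2 z hz m hm)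
    rw [integral_finsetSum _ (fun a ha => by
      have := Finset.mem_product.1 ha
      exact hint3 a.1 this.1 a.2 this.2), hS, Finset.sum_product]
    refine Finset.sum_congr rfl fun z hz => ?_
    rw [integral_integral_swap (f := fun y r => h (y, r) * FF d ψ₀ (x - y) r) (hF_int d hd ψ₀ hψ ℓ h hh z p hp.le N T (hJz z hz) x)]
    change ∫ r in Ioc (N : ℝ) T, uz d ψ₀ ℓ h z r x = _
    rw [restrict_Ioc_split N T hNT, integral_finsetSum_measure (fun m hm => hint2 z hz m hm)]
    refine Finset.sum_congr rfl fun m hm => ?_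
    rw [integral_map (by fun_prop) (hux z x).aestronglyMeasurable]
  have hsm : Measurable fun q : ℝ × Ed d => ∑ a ∈ S, uz d ψ₀ ℓ h a.1 (a.2 + q.1) q.2 :=
    Finset.measurable_fun_sum _ fun a _ => (hum a.1).comp (f := fun q : ℝ × Ed d => ((a.2 : ℝ) + q.1, q.2)) (by fun_prop)
  simp only [e1]
  calc ∫⁻ x, ‖∫ t in Ioc (0 : ℝ) 1, ∑ a ∈ S, uz d ψ₀ ℓ h a.1 (a.2 + t) x‖ₑ ^ p
      ≤ ∫⁻ x, ∫⁻ t in Ioc (0 : ℝ) 1, ‖∑ a ∈ S, uz d ψ₀ ℓ h a.1 (a.2 + t) x‖ₑ ^ p := by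
        refine lintegral_mono fun x => jensen_unit _ ?_ p hp.le
        exact hsm.comp (f := fun t : ℝ => (t, x)) (by fun_prop)
    _ = ∫⁻ t in Ioc (0 : ℝ) 1, ∫⁻ x, ‖∑ a ∈ S, uz d ψ₀ ℓ h a.1 (a.2 + t) x‖ₑ ^ p := by
        apply lintegral_lintegral_swap
        exact ((hsm.enorm.pow_const p).comp (f := fun q : Ed d × ℝ => (q.2, q.1)) (by fun_prop)).aemeasurable
    _ ≤ ∫⁻ t in Ioc (0 : ℝ) 1, B * ∑ a ∈ S, gam d ℓ h a.1 (a.2 + t) ^ p * ENNReal.ofReal ((a.2 + t) ^ (d - 1)) := by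
        refine setLIntegral_mono' measurableSet_Ioc fun t ht => hslice t ht.1 ht.2 S fun a ha => ?_
        rw [← hN]
        exact (Finset.mem_Ico.1 (Finset.mem_product.1 ha).2).1
    _ = B * ∑ z ∈ Z, ∫⁻ r in Ioc (N : ℝ) T, gam d ℓ h z r ^ p * ENNReal.ofReal (r ^ (d - 1)) := by
        have hm2 : ∀ a : (Fin d → ℤ) × ℕ, Measurable fun t : ℝ => gam d ℓ h a.1 (a.2 + t) ^ p * ENNReal.ofReal ((a.2 + t) ^ (d - 1)) :=
          fun a => (hgm a.1).comp (f := fun t : ℝ => (a.2 : ℝ) + t) (by fun_prop)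
        rw [lintegral_const_mul _ (Finset.measurable_fun_sum _ fun a _ => hm2 a), lintegral_finsetSum _ (fun a _ => hm2 a), hS,
          Finset.sum_product]
        congr 1
        refine Finset.sum_congr rfl fun z hz => ?_
        rw [restrict_Ioc_split N T hNT, lintegral_finsetSum_measure]
        refine Finset.sum_congr rfl fun m hm => ?_
        rw [lintegral_map (hgm z) (by fun_prop)]

/-- Index box. -/
def ZR (d R : ℕ) : Finset (Fin d → ℤ) := Fintype.piFinset fun _ => Finset.Icc (-(R : ℤ)) R

/-- Union of the cubes in the index box. -/
def YR (d ℓ R : ℕ) : Set (Ed d) := ⋃ z ∈ ZR d R, Wcube d (ℓ : ℤ) z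

theorem YR_norm (d ℓ R : ℕ) (y : Ed d) (hy : y ∈ YR d ℓ R) : ‖y‖ ≤ d * ((R + 1) * 2 ^ ℓ) := by
  simp only [YR, Set.mem_iUnion] at hy
  obtain ⟨z, hz, hy⟩ := hy
  apply ed_norm_le
  intro i
  have h1 := hy i
  rw [zpow_natCast] at h1
  have h2 := Finset.mem_Icc.1 (Fintype.mem_piFinset.1 hz i)
  have h3 : (-(R : ℝ)) ≤ z i := by exact_mod_cast h2.1
  have h4 : (z i : ℝ) ≤ R := by exact_mod_cast h2.2
  have hp : (0 : ℝ) < 2 ^ ℓ := by positivity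
  rw [abs_le]
  constructor
  · have := h1.1; nlinarith
  · have := h1.2; nlinarith

theorem YR_mono (d ℓ : ℕ) : Monotone (YR d ℓ) := by
  intro R R' h
  refine Set.biUnion_subset_biUnion_left ?_
  intro z hz
  rw [Finset.mem_coe, ZR, Fintype.mem_piFinset] at *
  intro i
  have := Finset.mem_Icc.1 (hz i)
  rw [Finset.mem_Icc]
  omega

theorem YR_univ (d ℓ : ℕ) : ⋃ R, YR d ℓ R = univ := by
  rw [Set.eq_univ_iff_forall]
  intro x
  set z : Fin d → ℤ := fun i => ⌊x i / 2 ^ ℓ⌋ with hz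
  have h1 : x ∈ Wcube d (ℓ : ℤ) z := (wcube_mem_iff d ℓ z x).2 fun i => rfl
  refine Set.mem_iUnion.2 ⟨∑ i, (z i).natAbs, Set.mem_biUnion (x := z) ?_ h1⟩
  rw [Finset.mem_coe, ZR, Fintype.mem_piFinset]
  intro i
  have h2 : (z i).natAbs ≤ ∑ i, (z i).natAbs := Finset.single_le_sum (f := fun i => (z i).natAbs) (fun _ _ => Nat.zero_le _) (Finset.mem_univ i)
  rw [Finset.mem_Icc]
  generalize ∑ i, (z i).natAbs = s at *
  omega

theorem YR_meas (d ℓ R : ℕ) : MeasurableSet (YR d ℓ R) :=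
  Finset.measurableSet_biUnion _ fun z _ => wcube_meas d ℓ z

/-- Radius cut-off. -/
def TR (d ℓ R : ℕ) : ℕ := 2 ^ ℓ + d * ((R + 1) * 2 ^ ℓ) + R + 1

theorem f_limit (d : ℕ) (hd : 1 ≤ d) (ψ₀ : Ed d → ℂ) (hψ : Admissible d ψ₀) (p : ℝ) (hp : 1 < p)
    (ℓ : ℕ) (h : Ed d × ℝ → ℂ) (N : ℕ) (hN : N = 2 ^ ℓ) (x : Ed d) :
    ‖∫ y : Ed d, ∫ r in Ioi (N : ℝ), h (y, r) * FF d ψ₀ (x - y) r‖ₑ ^ p ≤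
    Filter.liminf (fun R => ‖∑ z ∈ ZR d R, ∫ y in Wcube d (ℓ : ℤ) z, ∫ r in Ioc (N : ℝ) (TR d ℓ R),
      h (y, r) * FF d ψ₀ (x - y) r‖ₑ ^ p) Filter.atTop := by
  by_cases hI : Integrable (fun y : Ed d => ∫ r in Ioi (N : ℝ), h (y, r) * FF d ψ₀ (x - y) r)
  swap
  · rw [integral_undef hI, enorm_zero, ENNReal.zero_rpow_of_pos (by linarith)]
    exact bot_le
  have h1 := tendsto_setIntegral_of_monotone (fun R => YR_meas d ℓ R) (YR_mono d ℓ) hI.integrableOn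
  rw [YR_univ, setIntegral_univ] at h1
  have h2 := ((ENNReal.continuous_rpow_const (y := p)).tendsto _).comp h1.enorm
  refine le_of_eq ?_
  rw [← h2.liminf_eq]
  apply Filter.liminf_congr
  obtain ⟨R0, hR0⟩ := exists_nat_ge ‖x‖
  filter_upwards [Filter.eventually_ge_atTop R0] with R hR
  simp only [Function.comp_apply]
  congr 2
  have hxR : ‖x‖ ≤ R := hR0.trans (by exact_mod_cast hR)
  rw [YR, integral_biUnion_finset _ (fun z _ => wcube_meas d ℓ z) _ (fun z _ => hI.integrableOn)]
  · refine Finset.sum_congr rfl fun z hz => ?_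
    refine setIntegral_congr_fun (wcube_meas d ℓ z) fun y hy => ?_
    have hyR : ‖y‖ ≤ d * ((R + 1) * 2 ^ ℓ) := YR_norm d ℓ R y (Set.mem_biUnion (x := z) hz hy)
    refine setIntegral_eq_of_subset_of_forall_sdiff_eq_zero measurableSet_Ioi Ioc_subset_Ioi_self ?_ 
    intro r hr
    have hrN : (N : ℝ) < r := hr.1
    have hrT : ((TR d ℓ R : ℕ) : ℝ) < r := by
      by_contra hc
      exact hr.2 ⟨hrN, not_lt.1 hc⟩
    have hr0 : 0 < r := (Nat.cast_nonneg N).trans_lt hrN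
    have : FF d ψ₀ (x - y) r = 0 := by
      by_contra hc
      have k1 := FF_supp d hd ψ₀ hψ _ r hr0 hc
      have k2 := norm_sub_le x y
      rw [TR] at hrT
      push_cast at hrT
      have : (0 : ℝ) < 2 ^ ℓ := by positivity
      linarith
    rw [this, mul_zero]
  · intro z hz z' hz' hne
    rw [Function.onFun, Set.disjoint_left]
    intro y hy hy'
    exact hne (wcube_disj d ℓ z z' y hy hy')

theorem fR_meas (d : ℕ) (hd : 1 ≤ d) (ψ₀ : Ed d → ℂ) (hψ : Admissible d ψ₀)
    (ℓ : ℕ) (h : Ed d × ℝ → ℂ) (hh : Measurable h) (Z : Finset (Fin d → ℤ)) (a b : ℝ) :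
    Measurable fun x : Ed d => ∑ z ∈ Z, ∫ y in Wcube d (ℓ : ℤ) z, ∫ r in Ioc a b, h (y, r) * FF d ψ₀ (x - y) r := by
  refine Finset.measurable_fun_sum _ fun z _ => ?_
  have h1 : Measurable (fun q : (Ed d × Ed d) × ℝ => h (q.1.2, q.2) * FF d ψ₀ (q.1.1 - q.1.2) q.2) :=
    (hF_meas d hd ψ₀ hψ h hh).comp (f := fun q : (Ed d × Ed d) × ℝ => ((q.2, q.1.1), q.1.2)) (by fun_prop)
  have h2 := h1.stronglyMeasurable.integral_prod_right' (ν := volume.restrict (Ioc a b))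
  exact (h2.integral_prod_right (ν := volume.restrict (Wcube d (ℓ : ℤ) z))).measurable

theorem f_bound (d : ℕ) (hd : 1 ≤ d) (ψ₀ : Ed d → ℂ) (hψ : Admissible d ψ₀) (p : ℝ) (hp : 1 < p)
    (ℓ : ℕ) (h : Ed d × ℝ → ℂ) (hh : Measurable h) (B : ℝ≥0∞)
    (hslice : ∀ (t : ℝ), 0 < t → t ≤ 1 →
      ∀ (S : Finset ((Fin d → ℤ) × ℕ)), (∀ a ∈ S, 2 ^ ℓ ≤ a.2) →
      ∫⁻ x, ‖∑ a ∈ S, uz d ψ₀ ℓ h a.1 (a.2 + t) x‖ₑ ^ p ≤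
        B * ∑ a ∈ S, gam d ℓ h a.1 (a.2 + t) ^ p * ENNReal.ofReal ((a.2 + t) ^ (d - 1)))
    (J : ℝ≥0∞) (hJdef : J = ∫⁻ r in Set.Ioi ((2 : ℝ) ^ ℓ), ∑' z : Fin d → ℤ,
                  ⨆ y ∈ Wcube d (ℓ : ℤ) z, ENNReal.ofReal (‖h (y, r)‖ ^ p * r ^ (d - 1)))
    (hJ : J ≠ ⊤) :
    ∫⁻ x, ‖∫ y : Ed d, ∫ r in Set.Ioi ((2 : ℝ) ^ ℓ), h (y, r) * Fyr d ψ₀ y r x‖ₑ ^ p ≤ B * J := by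
  obtain ⟨N, hN⟩ : ∃ N : ℕ, N = 2 ^ ℓ := ⟨_, rfl⟩
  have hNr : ((2 : ℝ) ^ ℓ) = N := by rw [hN]; push_cast; rfl
  have e1 : ∀ x, ∫ y : Ed d, ∫ r in Set.Ioi ((2 : ℝ) ^ ℓ), h (y, r) * Fyr d ψ₀ y r x =
      ∫ y : Ed d, ∫ r in Ioi (N : ℝ), h (y, r) * FF d ψ₀ (x - y) r := by
    intro x
    rw [hNr]
    congr 1
    funext y
    refine setIntegral_congr_fun measurableSet_Ioi fun r hr => ?_
    have : 0 < r := (Nat.cast_nonneg N).trans_lt hr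
    simp only [FF_eq d hd ψ₀ hψ y r this x]
  simp only [e1]
  have hgm : ∀ z, Measurable fun r : ℝ => gam d ℓ h z r ^ p * ENNReal.ofReal (r ^ (d - 1)) := fun z =>
    ((gam_meas d ℓ h hh z).pow_const p).mul (by fun_prop)
  have hJR : ∀ (Z : Finset (Fin d → ℤ)) (T : ℕ), ∑ z ∈ Z, ∫⁻ r in Ioc (N : ℝ) T, gam d ℓ h z r ^ p * ENNReal.ofReal (r ^ (d - 1)) ≤ J := by
    intro Z T
    rw [← lintegral_finsetSum _ (fun z _ => hgm z), hJdef, hNr]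
    refine (lintegral_mono_set Ioc_subset_Ioi_self).trans ?_
    refine setLIntegral_mono' measurableSet_Ioi fun r hr => ?_
    have hr0 : 0 < r := (Nat.cast_nonneg N).trans_lt hr
    refine le_trans (Finset.sum_le_sum fun z _ => gam_le d ℓ h z r hr0 p (by linarith)) ?_
    exact ENNReal.sum_le_tsum _
  calc _ ≤ ∫⁻ x, Filter.liminf (fun R => ‖∑ z ∈ ZR d R, ∫ y in Wcube d (ℓ : ℤ) z, ∫ r in Ioc (N : ℝ) (TR d ℓ R),
      h (y, r) * FF d ψ₀ (x - y) r‖ₑ ^ p) Filter.atTop := lintegral_mono fun x => f_limit d hd ψ₀ hψ p hp ℓ h N hN x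
    _ ≤ Filter.liminf (fun R => ∫⁻ x, ‖∑ z ∈ ZR d R, ∫ y in Wcube d (ℓ : ℤ) z, ∫ r in Ioc (N : ℝ) (TR d ℓ R),
      h (y, r) * FF d ψ₀ (x - y) r‖ₑ ^ p) Filter.atTop :=
        lintegral_liminf_le fun R => (fR_meas d hd ψ₀ hψ ℓ h hh _ _ _).enorm.pow_const p
    _ ≤ Filter.liminf (fun _ : ℕ => B * J) Filter.atTop := by
        refine Filter.liminf_le_liminf (Filter.Eventually.of_forall fun R => ?_)
        refine (fR_bound d hd ψ₀ hψ p hp ℓ h hh B hslice (ZR d R) N (TR d ℓ R) hN ?_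
          (ne_top_of_le_ne_top hJ (hJR _ _))).trans ?_
        · rw [hN, TR]; omega
        · gcongr
          exact hJR _ _
    _ = B * J := by simp

/-- the large-radii variant of the continuous inequality, with
exponential gain `2^{-ℓε}` and suprema over dyadic cubes of sidelength `2^ℓ`. -/
theorem large_radii_inequality
    (d : ℕ) (hd : 4 ≤ d) (p : ℝ) (hp1 : 1 < p)
    (hpd : p < (2 * (d : ℝ) - 2) / ((d : ℝ) + 1))
    (ε : ℝ) (hε : ε < ((d : ℝ) - 1) * (1 / p - ((d : ℝ) + 1) / (2 * (d : ℝ) - 2)))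
    (ψ₀ : Ed d → ℂ) (hψ : Admissible d ψ₀) :
    ∃ C : ℝ, 0 < C ∧
      ∀ (ℓ : ℕ) (h : Ed d × ℝ → ℂ), Measurable h →
        eLpNorm
            (fun x => ∫ y : Ed d, ∫ r in Set.Ioi ((2 : ℝ) ^ ℓ),
                h (y, r) * Fyr d ψ₀ y r x)
            (ENNReal.ofReal p) volume ≤
          ENNReal.ofReal (C * 2 ^ (-(ℓ : ℝ) * ε) * 2 ^ ((ℓ : ℝ) * (d : ℝ) / p)) *
            (∫⁻ r in Set.Ioi ((2 : ℝ) ^ ℓ),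
                ∑' z : Fin d → ℤ,
                  ⨆ y ∈ Wcube d (ℓ : ℤ) z,
                    ENNReal.ofReal (‖h (y, r)‖ ^ p * r ^ (d - 1))) ^ (1 / p) := by
  have hdr : (4 : ℝ) ≤ d := by exact_mod_cast hd
  have hp0 : 0 < p := by linarith
  have hdm : 0 < (d : ℝ) - 1 := by linarith
  set q : ℝ := ((d : ℝ) + 1) / (2 * (d : ℝ) - 2) with hq
  have hq0 : 0 < q := by rw [hq]; apply div_pos <;> linarith
  have hqp : 0 < 1 / p - q := by
    have : q = 1 / ((2 * (d : ℝ) - 2) / ((d : ℝ) + 1)) := by rw [one_div_div]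
    rw [this, sub_pos]
    exact one_div_lt_one_div_of_lt hp0 hpd
  obtain ⟨ε', hεε, hε0, hε1⟩ : ∃ ε' : ℝ, ε ≤ ε' ∧ 0 < ε' ∧ ε' < ((d : ℝ) - 1) * (1 / p - q) := by
    have h1 : 0 < ((d : ℝ) - 1) * (1 / p - q) := mul_pos hdm hqp
    exact ⟨max ε (((d : ℝ) - 1) * (1 / p - q) / 2), le_max_left _ _, lt_of_lt_of_le (by linarith) (le_max_right _ _),
      max_lt hε (by linarith)⟩
  set s : ℝ := ε' / ((d : ℝ) - 1) with hs
  have hs0 : 0 < s := by positivity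
  have hs1 : s < 1 / p - q := by rw [hs, div_lt_iff₀ hdm]; linarith
  set p1 : ℝ := 1 / (q + s) with hp1'
  have hp1i : 1 / p1 = q + s := by rw [hp1', one_div_one_div]
  have hpp1 : p < p1 := by
    rw [hp1', lt_div_iff₀ (by positivity)]
    have : q + s < 1 / p := by linarith
    rwa [lt_div_iff₀ hp0, mul_comm] at this
  obtain ⟨C, hC, hmain⟩ := slice_bound d hd ψ₀ hψ p p1 hp1 hpp1 (by rw [← hq, hp1i]; linarith)
  refine ⟨C ^ (1 / p), by positivity, fun ℓ h hh => ?_⟩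
  set J : ℝ≥0∞ := ∫⁻ r in Set.Ioi ((2 : ℝ) ^ ℓ), ∑' z : Fin d → ℤ,
                  ⨆ y ∈ Wcube d (ℓ : ℤ) z, ENNReal.ofReal (‖h (y, r)‖ ^ p * r ^ (d - 1)) with hJdef
  by_cases hJ : J = ⊤
  · rw [hJ, ENNReal.top_rpow_of_pos (by positivity), ENNReal.mul_top]
    · exact le_top
    · rw [Ne, ENNReal.ofReal_eq_zero, not_le]; positivity
  have h1 := f_bound d (by omega) ψ₀ hψ p hp1 ℓ h hh _ (hmain ℓ h hh) J hJdef hJ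
  rw [← hq, hp1i, add_sub_cancel_left] at h1
  rw [eLpNorm_eq_lintegral_rpow_enorm_toReal (by
    rw [Ne, ENNReal.ofReal_eq_zero, not_le]; linarith) ENNReal.ofReal_ne_top, ENNReal.toReal_ofReal (by linarith)]
  refine (ENNReal.rpow_le_rpow h1 (by positivity)).trans ?_
  rw [ENNReal.mul_rpow_of_nonneg _ _ (by positivity)]
  gcongr
  rw [ENNReal.ofReal_rpow_of_nonneg (by positivity) (by positivity)]
  apply ENNReal.ofReal_le_ofReal
  have k1 : (((2 : ℝ) ^ ℓ) ^ (d - 1)) ^ (-s) = 2 ^ (-(ℓ : ℝ) * ε') := by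
    rw [← pow_mul, ← Real.rpow_natCast, ← Real.rpow_mul (by norm_num)]
    congr 1
    rw [Nat.cast_mul, Nat.cast_sub (by omega), Nat.cast_one, hs]
    field_simp
  have k2 : ((((2 : ℝ) ^ ℓ) ^ d)) ^ (1 / p) = 2 ^ ((ℓ : ℝ) * (d : ℝ) / p) := by
    rw [← pow_mul, ← Real.rpow_natCast, ← Real.rpow_mul (by norm_num)]
    congr 1
    rw [Nat.cast_mul]
    ring
  rw [k1, Real.mul_rpow (by positivity) (by positivity), Real.mul_rpow (by positivity) (by positivity), k2,
    ← Real.rpow_mul (by positivity), mul_one_div_cancel hp0.ne', Real.rpow_one]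
  have k3 : (2 : ℝ) ^ (-(ℓ : ℝ) * ε') ≤ 2 ^ (-(ℓ : ℝ) * ε) := by
    apply Real.rpow_le_rpow_of_exponent_le (by norm_num)
    have : (0 : ℝ) ≤ ℓ := by positivity
    nlinarith
  gcongr
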